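/- arXiv:2212.08240 — 2 statements merged into one kernel-verified Lean document; each statement's English description precedes it below -/
import Mathlib

section
/- Let C ⊆ ℝ² be a simple closed polygonal curve (consisting of finitely many line segments). Then the closed region enclosed by C can be triangulated so that every vertex of every triangle is a vertex (node) of C. -/
open Set

/-- The coordinate plane. -/
abbrev Plane := Fin 2 → ℝ

/-- Barycentric coordinates with respect to three points of the plane. -/
structure Bary (a b c : Plane) where
  α : Plane →ᵃ[ℝ] ℝ
  β : Plane →ᵃ[ℝ] ℝ
  γ : Plane →ᵃ[ℝ] ℝ
  sum : ∀ x, α x + β x + γ x = 1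
  comb : ∀ x, α x • a + β x • b + γ x • c = x
  α_a : α a = 1
  α_b : α b = 0
  α_c : α c = 0
  β_a : β a = 0
  β_b : β b = 1
  β_c : β c = 0
  γ_a : γ a = 0
  γ_b : γ b = 0
  γ_c : γ c = 1

theorem nonempty_bary {a b c : Plane} (h : AffineIndependent ℝ ![a, b, c]) :
    Nonempty (Bary a b c) := by
  let B : AffineBasis (Fin 3) ℝ Plane :=
    ⟨![a, b, c], h, h.affineSpan_eq_top_iff_card_eq_finrank_add_one.2 (by simp)⟩
  have hc : ∀ i j, B.coord i (B j) = if i = j then 1 else 0 := fun i j => B.coord_apply i j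
  have e0 : B 0 = a := rfl
  have e1 : B 1 = b := rfl
  have e2 : B 2 = c := rfl
  refine ⟨⟨B.coord 0, B.coord 1, B.coord 2, ?_, ?_, ?_, ?_, ?_, ?_, ?_, ?_, ?_, ?_, ?_⟩⟩
  · intro x
    have h := B.sum_coord_apply_eq_one x
    rwa [Fin.sum_univ_three] at h
  · intro x
    have h := B.linear_combination_coord_eq_self x
    rwa [Fin.sum_univ_three, e0, e1, e2] at h
  all_goals first
    | rw [← e0, hc]; simp
    | rw [← e1, hc]; simp
    | rw [← e2, hc]; simp

theorem affineMap_add_smul_sub (f : Plane →ᵃ[ℝ] ℝ) (p x y : Plane) (ε : ℝ) :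
    f (p + ε • (x - y)) = f p + ε * (f x - f y) := by
  have h1 : f (ε • (x - y) +ᵥ p) = f.linear (ε • (x - y)) +ᵥ f p := f.map_vadd p _
  have h2 : f.linear (x -ᵥ y) = f x -ᵥ f y := f.linearMap_vsub x y
  simp only [vadd_eq_add, vsub_eq_sub, map_smul, smul_eq_mul] at h1 h2
  rw [add_comm, h1, h2]; ring

theorem affineMap_combo (f : Plane →ᵃ[ℝ] ℝ) {x y : Plane} {s t : ℝ} (h : s + t = 1) :
    f (s • x + t • y) = s * f x + t * f y := by
  simpa using Convex.combo_affine_apply (f := f) (x := x) (y := y) h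

theorem affineMap_continuous (f : Plane →ᵃ[ℝ] ℝ) : Continuous f :=
  f.continuous_of_finiteDimensional

theorem convex_affine_lt (f : Plane →ᵃ[ℝ] ℝ) (r : ℝ) : Convex ℝ {x | f x < r} :=
  (convex_Iio r).affine_preimage f

theorem convex_affine_gt (f : Plane →ᵃ[ℝ] ℝ) (r : ℝ) : Convex ℝ {x | r < f x} :=
  (convex_Ioi r).affine_preimage f

theorem convex_affine_ge (f : Plane →ᵃ[ℝ] ℝ) (r : ℝ) : Convex ℝ {x | r ≤ f x} :=
  (convex_Ici r).affine_preimage f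

theorem convex_affine_eq (f : Plane →ᵃ[ℝ] ℝ) (r : ℝ) : Convex ℝ {x | f x = r} :=
  (convex_singleton r).affine_preimage f

theorem exists_pos_add_smul_mem {N : Set Plane} (hN : IsOpen N) {p : Plane} (hp : p ∈ N)
    (d : Plane) : ∃ ε : ℝ, 0 < ε ∧ ∀ δ : ℝ, 0 ≤ δ → δ ≤ ε → p + δ • d ∈ N := by
  have hc : Continuous fun t : ℝ => p + t • d := by fun_prop
  have hm : (fun t : ℝ => p + t • d) ⁻¹' N ∈ nhds (0 : ℝ) :=
    (hN.preimage hc).mem_nhds (by simpa using hp)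
  obtain ⟨r, hr, hs⟩ := Metric.mem_nhds_iff.1 hm
  refine ⟨r / 2, by positivity, fun δ h0 h1 => hs ?_⟩
  rw [Metric.mem_ball, Real.dist_eq, sub_zero, abs_of_nonneg h0]
  linarith

namespace Bary

variable {a b c : Plane}

/-- Exchange the first and the last point. -/
def swap (B : Bary a b c) : Bary c b a :=
  ⟨B.γ, B.β, B.α, fun x => by rw [← B.sum x]; ring,
    fun x => by nth_rw 4 [← B.comb x]; abel,
    B.γ_c, B.γ_b, B.γ_a, B.β_c, B.β_b, B.β_a, B.α_c, B.α_b, B.α_a⟩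

/-- Rotate the three points. -/
def rotate (B : Bary a b c) : Bary b c a :=
  ⟨B.β, B.γ, B.α, fun x => by rw [← B.sum x]; ring,
    fun x => by nth_rw 4 [← B.comb x]; abel,
    B.β_b, B.β_c, B.β_a, B.γ_b, B.γ_c, B.γ_a, B.α_b, B.α_c, B.α_a⟩

theorem mem_convexHull (B : Bary a b c) {x : Plane} :
    x ∈ convexHull ℝ {a, b, c} ↔ 0 ≤ B.α x ∧ 0 ≤ B.β x ∧ 0 ≤ B.γ x := by
  constructor
  · intro h
    have : convexHull ℝ {a, b, c} ⊆ {x | 0 ≤ B.α x} ∩ ({x | 0 ≤ B.β x} ∩ {x | 0 ≤ B.γ x}) := by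
      refine convexHull_min ?_ ((convex_affine_ge _ _).inter
        ((convex_affine_ge _ _).inter (convex_affine_ge _ _)))
      rintro y (rfl | rfl | rfl) <;>
        simp [B.α_a, B.α_b, B.α_c, B.β_a, B.β_b, B.β_c, B.γ_a, B.γ_b, B.γ_c]
    exact this h
  · rintro ⟨h1, h2, h3⟩
    rw [← B.comb x]
    have := (convex_convexHull ℝ {a, b, c}).sum_mem (t := Finset.univ)
      (w := ![B.α x, B.β x, B.γ x]) (z := ![a, b, c])
      (by intro i _; fin_cases i <;> simpa)
      (by simpa [Fin.sum_univ_three] using B.sum x)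
      (by intro i _; apply subset_convexHull; fin_cases i <;> simp)
    simpa [Fin.sum_univ_three] using this

theorem mem_segment (B : Bary a b c) {x : Plane} :
    x ∈ segment ℝ a c ↔ B.β x = 0 ∧ 0 ≤ B.α x ∧ 0 ≤ B.γ x := by
  constructor
  · rintro ⟨s, t, hs, ht, hst, rfl⟩
    simp [affineMap_combo _ hst, B.α_a, B.α_c, B.β_a, B.β_c, B.γ_a, B.γ_c, hs, ht]
  · rintro ⟨h1, h2, h3⟩
    refine ⟨B.α x, B.γ x, h2, h3, ?_, ?_⟩
    · have := B.sum x; linarith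
    · nth_rw 3 [← B.comb x]
      simp [h1]

theorem mem_segment_left (B : Bary a b c) {x : Plane} :
    x ∈ segment ℝ a b ↔ B.γ x = 0 ∧ 0 ≤ B.α x ∧ 0 ≤ B.β x := by
  rw [segment_symm, B.rotate.mem_segment]
  simp only [rotate]; tauto

theorem mem_segment_right (B : Bary a b c) {x : Plane} :
    x ∈ segment ℝ b c ↔ B.α x = 0 ∧ 0 ≤ B.β x ∧ 0 ≤ B.γ x := by
  rw [segment_symm, B.rotate.rotate.mem_segment]
  simp only [rotate]; tauto

end Bary

theorem isClosed_segment (a b : Plane) : IsClosed (segment ℝ a b) := by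
  rw [← convexHull_pair]
  exact ((Set.toFinite _).isCompact_convexHull (𝕜 := ℝ)).isClosed

/-- Gluing a triangle along an edge preserves connectedness of the complement. -/
theorem isPreconnected_compl_union_triangle {a b c : Plane} (B : Bary a b c) {K : Set Plane}
    (hK : IsClosed K) (hKc : IsPreconnected Kᶜ)
    (hKT : K ∩ convexHull ℝ {a, b, c} = segment ℝ a c) :
    IsPreconnected (K ∪ convexHull ℝ {a, b, c})ᶜ := by
  set T := convexHull ℝ {a, b, c} with hT
  have hTcl : IsClosed T := ((Set.toFinite _).isCompact_convexHull (𝕜 := ℝ)).isClosed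
  have cα := affineMap_continuous B.α
  have cβ := affineMap_continuous B.β
  have cγ := affineMap_continuous B.γ
  have hWo : IsOpen (K ∪ T)ᶜ := (hK.union hTcl).isOpen_compl
  have hβ : ∀ x ∈ T, x ∉ K → 0 < B.β x := by
    intro x hx hxK
    have h := B.mem_convexHull.1 hx
    rcases h.2.1.lt_or_eq with h' | h'
    · exact h'
    · exact (hxK (hKT.ge (B.mem_segment.2 ⟨h'.symm, h.1, h.2.2⟩)).1).elim
  have hβ' : ∀ x ∈ T, 0 < B.β x → x ∉ K := by
    intro x hx h0 hxK
    have := (B.mem_segment.1 (hKT.le ⟨hxK, hx⟩)).1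
    linarith
  set L : Set Plane := ({x | B.γ x = 0} ∩ ({x | 0 ≤ B.α x} ∩ {x | 0 < B.β x})) ∪
    ({x | B.α x = 0} ∩ ({x | 0 ≤ B.γ x} ∩ {x | 0 < B.β x})) with hL
  have hLconn : IsPreconnected L := by
    refine IsPreconnected.union b ?_ ?_ ?_ ?_
    · simp [B.α_b, B.β_b, B.γ_b]
    · simp [B.α_b, B.β_b, B.γ_b]
    · exact ((convex_affine_eq _ _).inter ((convex_affine_ge _ _).inter
        (convex_affine_gt _ _))).isPreconnected
    · exact ((convex_affine_eq _ _).inter ((convex_affine_ge _ _).inter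
        (convex_affine_gt _ _))).isPreconnected
  have hLT : ∀ p ∈ L, p ∈ T ∧ 0 < B.β p := by
    rintro p (⟨h1, h2, h3⟩ | ⟨h1, h2, h3⟩) <;> simp only [mem_ofPred_eq] at h1 h2 h3
    · exact ⟨B.mem_convexHull.2 ⟨h2, h3.le, h1.ge⟩, h3⟩
    · exact ⟨B.mem_convexHull.2 ⟨h1.ge, h3.le, h2⟩, h3⟩
  have hW : ∀ x, x ∉ K → 0 < B.β x → (x ∈ (K ∪ T)ᶜ ↔ B.α x < 0 ∨ B.γ x < 0) := by
    intro x hx h0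
    simp only [mem_compl_iff, mem_union, hx, false_or, hT, B.mem_convexHull, h0.le, true_and]
    rw [not_and_or, not_le, not_le]
  have hloc : ∀ p ∈ L, ∃ N, IsOpen N ∧ p ∈ N ∧ IsPreconnected (N ∩ (K ∪ T)ᶜ) ∧
      (N ∩ (K ∪ T)ᶜ).Nonempty := by
    intro p hp
    obtain ⟨hpT, hp0⟩ := hLT p hp
    have hpK := hβ' p hpT hp0
    have hO : IsOpen (Kᶜ ∩ {x | 0 < B.β x}) :=
      hK.isOpen_compl.inter (isOpen_lt continuous_const cβ)
    have key : ∀ M : Set Plane, IsOpen M → p ∈ M → ∃ N, IsOpen N ∧ p ∈ N ∧ Convex ℝ N ∧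
        N ⊆ M ∧ N ∩ (K ∪ T)ᶜ = (N ∩ {x | B.α x < 0}) ∪ (N ∩ {x | B.γ x < 0}) := by
      intro M hM hpM
      obtain ⟨r, hr, hs⟩ := Metric.isOpen_iff.1 (hO.inter hM) p ⟨⟨hpK, hp0⟩, hpM⟩
      refine ⟨Metric.ball p r, Metric.isOpen_ball, Metric.mem_ball_self hr, convex_ball _ _,
        fun x hx => (hs hx).2, ?_⟩
      ext x
      constructor
      · rintro ⟨h1, h2⟩
        rcases (hW x (hs h1).1.1 (hs h1).1.2).1 h2 with h | h
        · exact Or.inl ⟨h1, h⟩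
        · exact Or.inr ⟨h1, h⟩
      · rintro (⟨h1, h2⟩ | ⟨h1, h2⟩)
        · exact ⟨h1, (hW x (hs h1).1.1 (hs h1).1.2).2 (Or.inl h2)⟩
        · exact ⟨h1, (hW x (hs h1).1.1 (hs h1).1.2).2 (Or.inr h2)⟩
    have hTp := B.mem_convexHull.1 hpT
    rcases hTp.1.lt_or_eq with hα | hα
    · have hγ : B.γ p = 0 := by
        rcases hp with h | h
        · exact h.1
        · exact absurd h.1 hα.ne'
      obtain ⟨N, hNo, hpN, hNc, hNM, hNW⟩ := key {x | 0 < B.α x}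
        (isOpen_lt continuous_const cα) hα
      have h0 : N ∩ {x | B.α x < 0} = ∅ := by
        ext x
        simp only [mem_inter_iff, mem_ofPred_eq, mem_empty_iff_false, iff_false, not_and, not_lt]
        exact fun hx => (hNM hx).le
      rw [h0, empty_union] at hNW
      refine ⟨N, hNo, hpN, ?_, ?_⟩
      · rw [hNW]; exact (hNc.inter (convex_affine_lt _ _)).isPreconnected
      · rw [hNW]
        obtain ⟨ε, hε, hm⟩ := exists_pos_add_smul_mem hNo hpN (b - c)
        refine ⟨_, hm ε hε.le le_rfl, ?_⟩
        rw [mem_ofPred_eq, affineMap_add_smul_sub, hγ, B.γ_b, B.γ_c]; linarith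
    rcases hTp.2.2.lt_or_eq with hγ | hγ
    · obtain ⟨N, hNo, hpN, hNc, hNM, hNW⟩ := key {x | 0 < B.γ x}
        (isOpen_lt continuous_const cγ) hγ
      have h0 : N ∩ {x | B.γ x < 0} = ∅ := by
        ext x
        simp only [mem_inter_iff, mem_ofPred_eq, mem_empty_iff_false, iff_false, not_and, not_lt]
        exact fun hx => (hNM hx).le
      rw [h0, union_empty] at hNW
      refine ⟨N, hNo, hpN, ?_, ?_⟩
      · rw [hNW]; exact (hNc.inter (convex_affine_lt _ _)).isPreconnected
      · rw [hNW]
        obtain ⟨ε, hε, hm⟩ := exists_pos_add_smul_mem hNo hpN (b - a)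
        refine ⟨_, hm ε hε.le le_rfl, ?_⟩
        rw [mem_ofPred_eq, affineMap_add_smul_sub, ← hα, B.α_b, B.α_a]; linarith
    · obtain ⟨N, hNo, hpN, hNc, hNM, hNW⟩ := key univ isOpen_univ trivial
      obtain ⟨ε, hε, hm⟩ := exists_pos_add_smul_mem hNo hpN (b - ((1 / 2 : ℝ) • a + (1 / 2 : ℝ) • c))
      have h1 : B.α (p + ε • (b - ((1 / 2 : ℝ) • a + (1 / 2 : ℝ) • c))) < 0 := by
        rw [affineMap_add_smul_sub, affineMap_combo _ (by norm_num), ← hα, B.α_a, B.α_b, B.α_c]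
        linarith
      have h2 : B.γ (p + ε • (b - ((1 / 2 : ℝ) • a + (1 / 2 : ℝ) • c))) < 0 := by
        rw [affineMap_add_smul_sub, affineMap_combo _ (by norm_num), ← hγ, B.γ_a, B.γ_b, B.γ_c]
        linarith
      have hm' := hm ε hε.le le_rfl
      refine ⟨N, hNo, hpN, ?_, ?_⟩
      · rw [hNW]
        exact IsPreconnected.union _ ⟨hm', h1⟩ ⟨hm', h2⟩
          (hNc.inter (convex_affine_lt _ _)).isPreconnected
          (hNc.inter (convex_affine_lt _ _)).isPreconnected
      · rw [hNW]; exact ⟨_, Or.inl ⟨hm', h1⟩⟩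
  intro u v hu hv huv hUne hVne
  by_contra hne
  rw [not_nonempty_iff_eq_empty] at hne
  set U := (K ∪ T)ᶜ ∩ u
  set V := (K ∪ T)ᶜ ∩ v
  have hUo : IsOpen U := hWo.inter hu
  have hVo : IsOpen V := hWo.inter hv
  have hUV : Disjoint U V := by
    rw [disjoint_left]
    intro x h1 h2
    have : x ∈ (K ∪ T)ᶜ ∩ (u ∩ v) := ⟨h1.1, h1.2, h2.2⟩
    rw [hne] at this; exact this
  have hcov : ∀ x ∈ (K ∪ T)ᶜ, x ∈ U ∨ x ∈ V := fun x hx =>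
    (huv hx).imp (fun h => ⟨hx, h⟩) (fun h => ⟨hx, h⟩)
  have hnot : ∀ p ∈ L, ¬ (p ∈ closure U ∧ p ∈ closure V) := by
    rintro p hp ⟨h1, h2⟩
    obtain ⟨N, hNo, hpN, hNc, -⟩ := hloc p hp
    obtain ⟨x, hxN, hxU⟩ := mem_closure_iff.1 h1 N hNo hpN
    obtain ⟨y, hyN, hyV⟩ := mem_closure_iff.1 h2 N hNo hpN
    rcases hNc.subset_or_subset hUo hVo hUV (fun z hz => hcov z hz.2) with h | h
    · exact disjoint_left.1 hUV (h ⟨hyN, hyV.1⟩) hyV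
    · exact disjoint_left.1 hUV hxU (h ⟨hxN, hxU.1⟩)
  have hLcov : L ⊆ closure U ∪ closure V := by
    intro p hp
    rw [← closure_union, mem_closure_iff]
    intro O hO hpO
    obtain ⟨N, hNo, hpN, hNc, -⟩ := hloc p hp
    have : p ∈ closure (K ∪ T)ᶜ := by
      rw [mem_closure_iff]
      intro O hO hpO
      have hpT := hLT p hp
      have hTp := B.mem_convexHull.1 hpT.1
      have hO' : IsOpen (O ∩ (Kᶜ ∩ {x | 0 < B.β x})) :=
        hO.inter (hK.isOpen_compl.inter (isOpen_lt continuous_const cβ))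
      have hpO' : p ∈ O ∩ (Kᶜ ∩ {x | 0 < B.β x}) := ⟨hpO, hβ' p hpT.1 hpT.2, hpT.2⟩
      rcases hp with h | h
      · obtain ⟨ε, hε, hm⟩ := exists_pos_add_smul_mem hO' hpO' (b - c)
        have hm' := hm ε hε.le le_rfl
        refine ⟨_, hm'.1, (hW _ hm'.2.1 hm'.2.2).2 (Or.inr ?_)⟩
        rw [affineMap_add_smul_sub, show B.γ p = 0 from h.1, B.γ_b, B.γ_c]; linarith
      · obtain ⟨ε, hε, hm⟩ := exists_pos_add_smul_mem hO' hpO' (b - a)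
        have hm' := hm ε hε.le le_rfl
        refine ⟨_, hm'.1, (hW _ hm'.2.1 hm'.2.2).2 (Or.inl ?_)⟩
        rw [affineMap_add_smul_sub, show B.α p = 0 from h.1, B.α_b, B.α_a]; linarith
    obtain ⟨x, hx1, hx2⟩ := mem_closure_iff.1 this O hO hpO
    exact ⟨x, hx1, hcov x hx2⟩
  have final : ∀ U V : Set Plane, IsOpen U → IsOpen V → Disjoint U V → U ⊆ (K ∪ T)ᶜ →
      V ⊆ (K ∪ T)ᶜ → (∀ x ∈ (K ∪ T)ᶜ, x ∈ U ∨ x ∈ V) → U.Nonempty → V.Nonempty →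
      ¬ (L ∩ closure V = ∅) := by
    intro U V hUo hVo hUV hUW hVW hcov hUne hVne hemp
    have hUcl : ∀ x ∈ U, x ∉ closure V := fun x hx =>
      disjoint_left.1 (hUV.closure_right hUo) hx
    have hc : Kᶜ ⊆ V ∪ (closure V)ᶜ := by
      intro x hx
      by_cases hxT : x ∈ T
      · right
        have h0 := hβ x hxT hx
        have h := B.mem_convexHull.1 hxT
        intro hxV
        rcases h.1.lt_or_eq with h1 | h1
        · rcases h.2.2.lt_or_eq with h2 | h2
          · have hO : IsOpen ({x | 0 < B.α x} ∩ ({x | 0 < B.β x} ∩ {x | 0 < B.γ x})) :=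
              (isOpen_lt continuous_const cα).inter
                ((isOpen_lt continuous_const cβ).inter (isOpen_lt continuous_const cγ))
            obtain ⟨y, hy1, hy2⟩ := mem_closure_iff.1 hxV _ hO ⟨h1, h0, h2⟩
            exact hVW hy2 (Or.inr (B.mem_convexHull.2 ⟨hy1.1.le, hy1.2.1.le, hy1.2.2.le⟩))
          · exact (eq_empty_iff_forall_notMem.1 hemp) x ⟨Or.inl ⟨h2.symm, h.1, h0⟩, hxV⟩
        · exact (eq_empty_iff_forall_notMem.1 hemp) x ⟨Or.inr ⟨h1.symm, h.2.2, h0⟩, hxV⟩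
      · rcases hcov x (by simp [hxT]; exact hx) with h | h
        · exact Or.inr (hUcl x h)
        · exact Or.inl h
    have hd : Disjoint V (closure V)ᶜ :=
      disjoint_compl_right_iff_subset.2 subset_closure
    obtain ⟨x, hx⟩ := hUne
    obtain ⟨y, hy⟩ := hVne
    rcases hKc.subset_or_subset hVo isClosed_closure.isOpen_compl hd hc with h | h
    · exact disjoint_left.1 hUV hx (h fun hk => hUW hx (Or.inl hk))
    · exact h (fun hk => hVW hy (Or.inl hk)) (subset_closure hy)
  have hU1 := final U V hUo hVo hUV inter_subset_left inter_subset_left hcov hUne hVne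
  have hV1 := final V U hVo hUo hUV.symm inter_subset_left inter_subset_left
    (fun x hx => (hcov x hx).symm) hVne hUne
  obtain ⟨p, hp, h1, h2⟩ := isPreconnected_closed_iff.1 hLconn (closure U) (closure V)
    isClosed_closure isClosed_closure hLcov (nonempty_iff_ne_empty.2 hV1)
    (nonempty_iff_ne_empty.2 hU1)
  exact hnot p hp ⟨h1, h2⟩

theorem exists_bary_of_ne {p q : Plane} (hpq : p ≠ q) : ∃ r, Nonempty (Bary p r q) := by
  refine ⟨p + ![-(q 1 - p 1), q 0 - p 0], nonempty_bary ?_⟩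
  rw [affineIndependent_iff_not_collinear_set, collinear_iff_of_mem (p₀ := p) (by simp)]
  rintro ⟨d, hd⟩
  obtain ⟨r, hr⟩ := hd (p + ![-(q 1 - p 1), q 0 - p 0]) (by simp)
  obtain ⟨s, hs⟩ := hd q (by simp)
  have r0 := congrFun hr 0
  have r1 := congrFun hr 1
  have s0 := congrFun hs 0
  have s1 := congrFun hs 1
  simp at r0 r1 s0 s1
  have h0 : q 0 - p 0 = s * d 0 := by linarith
  have h1 : q 1 - p 1 = s * d 1 := by linarith
  have h2 : -(q 1 - p 1) = r * d 0 := by linarith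
  have h3 : q 0 - p 0 = r * d 1 := by linarith
  have key : (q 0 - p 0) ^ 2 + (q 1 - p 1) ^ 2 = 0 := by
    calc (q 0 - p 0) ^ 2 + (q 1 - p 1) ^ 2
        = (q 0 - p 0) * (q 0 - p 0) - (q 1 - p 1) * -(q 1 - p 1) := by ring
      _ = (s * d 0) * (r * d 1) - (s * d 1) * (r * d 0) := by
          rw [h2, h1, ← h0, ← h3]
      _ = 0 := by ring
  apply hpq
  ext i
  fin_cases i
  · have : q 0 - p 0 = 0 := by nlinarith [sq_nonneg (q 0 - p 0), sq_nonneg (q 1 - p 1)]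
    simp; linarith
  · have : q 1 - p 1 = 0 := by nlinarith [sq_nonneg (q 0 - p 0), sq_nonneg (q 1 - p 1)]
    simp; linarith

theorem isPreconnected_compl_segment {p q : Plane} (hpq : p ≠ q) :
    IsPreconnected (segment ℝ p q)ᶜ := by
  obtain ⟨r, ⟨B⟩⟩ := exists_bary_of_ne hpq
  have : (segment ℝ p q)ᶜ = (({x | 0 < B.β x} ∪ {x | B.α x < 0}) ∪ {x | B.β x < 0}) ∪
      {x | B.γ x < 0} := by
    ext x
    simp only [mem_compl_iff, B.mem_segment, mem_union, mem_ofPred_eq]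
    constructor
    · intro h
      by_contra! hc
      exact h ⟨le_antisymm hc.1.1.1 hc.1.2, hc.1.1.2, hc.2⟩
    · rintro (((h | h) | h) | h) ⟨h1, h2, h3⟩ <;> linarith
  have e1 : r + (1 : ℝ) • (r - p) ∈ {x | 0 < B.β x} ∧ r + (1 : ℝ) • (r - p) ∈ {x | B.α x < 0} := by
    simp only [mem_ofPred_eq, affineMap_add_smul_sub, B.β_b, B.β_a, B.α_b, B.α_a]; norm_num
  have e2 : r + (1 : ℝ) • (r - q) ∈ {x | 0 < B.β x} ∧ r + (1 : ℝ) • (r - q) ∈ {x | B.γ x < 0} := by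
    simp only [mem_ofPred_eq, affineMap_add_smul_sub, B.β_b, B.β_c, B.γ_b, B.γ_c]; norm_num
  have e3 : q + (1 : ℝ) • (q - ((1 / 2 : ℝ) • p + (1 / 2 : ℝ) • r)) ∈ {x | B.α x < 0} ∧
      q + (1 : ℝ) • (q - ((1 / 2 : ℝ) • p + (1 / 2 : ℝ) • r)) ∈ {x | B.β x < 0} := by
    have h : (1 / 2 : ℝ) + 1 / 2 = 1 := by norm_num
    simp only [mem_ofPred_eq, affineMap_add_smul_sub, affineMap_combo _ h, B.β_a, B.β_b, B.β_c,
      B.α_a, B.α_b, B.α_c]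
    norm_num
  rw [this]
  refine IsPreconnected.union _ (Or.inl (Or.inl e2.1)) e2.2
    (IsPreconnected.union _ (Or.inr e3.1) e3.2 (IsPreconnected.union _ e1.1 e1.2 ?_ ?_) ?_) ?_
  · exact (convex_affine_gt _ _).isPreconnected
  · exact (convex_affine_lt _ _).isPreconnected
  · exact (convex_affine_lt _ _).isPreconnected
  · exact (convex_affine_lt _ _).isPreconnected

/-- The union of the segments joining the given pairs of points. -/
def edgeUnion (E : Set (Plane × Plane)) : Set Plane := ⋃ e ∈ E, segment ℝ e.1 e.2

/-- The union of the given triangles. -/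
def triangleUnion (T : Set (Fin 3 → Plane)) : Set Plane := ⋃ t ∈ T, convexHull ℝ (range t)

theorem mem_edgeUnion {E : Set (Plane × Plane)} {x : Plane} :
    x ∈ edgeUnion E ↔ ∃ e ∈ E, x ∈ segment ℝ e.1 e.2 := by
  simp [edgeUnion]

theorem mem_triangleUnion {T : Set (Fin 3 → Plane)} {x : Plane} :
    x ∈ triangleUnion T ↔ ∃ t ∈ T, x ∈ convexHull ℝ (range t) := by
  simp [triangleUnion]

theorem edgeUnion_insert (e : Plane × Plane) (E : Set (Plane × Plane)) :
    edgeUnion (insert e E) = segment ℝ e.1 e.2 ∪ edgeUnion E := by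
  simp [edgeUnion]

theorem edgeUnion_union (E F : Set (Plane × Plane)) :
    edgeUnion (E ∪ F) = edgeUnion E ∪ edgeUnion F := by
  simp only [edgeUnion, biUnion_union]

theorem triangleUnion_union (S T : Set (Fin 3 → Plane)) :
    triangleUnion (S ∪ T) = triangleUnion S ∪ triangleUnion T := by
  simp only [triangleUnion, biUnion_union]

theorem isClosed_edgeUnion {E : Set (Plane × Plane)} (hE : E.Finite) : IsClosed (edgeUnion E) :=
  hE.isClosed_biUnion fun _ _ => isClosed_segment _ _

/-- `T` is a triangulation of a region whose boundary is the polygon with edge set `E`. -/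
structure IsTriangulation (E : Set (Plane × Plane)) (T : Set (Fin 3 → Plane)) : Prop where
  finite_edges : E.Finite
  finite : T.Finite
  indep : ∀ t ∈ T, AffineIndependent ℝ t
  vertex : ∀ t ∈ T, ∀ i, ∃ e ∈ E, t i = e.1
  face : ∀ s ∈ T, ∀ t ∈ T, s ≠ t →
    interior (convexHull ℝ (range s)) ∩ interior (convexHull ℝ (range t)) = ∅ ∧
    convexHull ℝ (range s) ∩ convexHull ℝ (range t) = convexHull ℝ (range s ∩ range t)
  edge : ∀ e ∈ E, ∀ t ∈ T, ∀ x ∈ convexHull ℝ (range t), x ∈ segment ℝ e.1 e.2 →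
    (x = e.1 ∧ e.1 ∈ range t) ∨ (x = e.2 ∧ e.2 ∈ range t) ∨ (e.1 ∈ range t ∧ e.2 ∈ range t)
  boundary_subset : edgeUnion E ⊆ triangleUnion T
  isOpen_diff : IsOpen (triangleUnion T \ edgeUnion E)
  isPreconnected_diff : IsPreconnected (triangleUnion T \ edgeUnion E)
  subset_closure_diff : edgeUnion E ⊆ closure (triangleUnion T \ edgeUnion E)
  isPreconnected_compl_union : ∀ e ∈ E, ∀ K : Set Plane, IsClosed K → IsPreconnected Kᶜ →
    K ∩ triangleUnion T = segment ℝ e.1 e.2 → IsPreconnected (K ∪ triangleUnion T)ᶜ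

theorem isCompact_triangleUnion {T : Set (Fin 3 → Plane)} (hT : T.Finite) :
    IsCompact (triangleUnion T) :=
  hT.isCompact_biUnion fun _ _ => (finite_range _).isCompact_convexHull (𝕜 := ℝ)

theorem IsTriangulation.subset_or_disjoint {E T} (h : IsTriangulation E T) {S : Set Plane}
    (hS : IsPreconnected S) (hSE : Disjoint S (edgeUnion E)) :
    S ⊆ triangleUnion T \ edgeUnion E ∨ Disjoint S (triangleUnion T) := by
  have hcov : S ⊆ triangleUnion T \ edgeUnion E ∪ (triangleUnion T)ᶜ := by
    intro x hx
    by_cases hxT : x ∈ triangleUnion T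
    · exact Or.inl ⟨hxT, disjoint_left.1 hSE hx⟩
    · exact Or.inr hxT
  rcases hS.subset_or_subset h.isOpen_diff (isCompact_triangleUnion h.finite).isClosed.isOpen_compl
    (disjoint_compl_right.mono_left sdiff_subset) hcov with h' | h'
  · exact Or.inl h'
  · exact Or.inr (disjoint_left.2 h')

theorem range_triple (a b c : Plane) : range ![a, b, c] = {a, b, c} := by
  simp [Matrix.range_cons]
  ext; simp; tauto

theorem isTriangulation_triangle {a b c : Plane} (h : AffineIndependent ℝ ![a, b, c]) :
    IsTriangulation {(a, b), (b, c), (c, a)} {![a, b, c]} := by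
  obtain ⟨B⟩ := nonempty_bary h
  have hR : triangleUnion {![a, b, c]} = convexHull ℝ {a, b, c} := by
    simp only [triangleUnion, mem_singleton_iff, iUnion_iUnion_eq_left, range_triple]
  have hE : edgeUnion {(a, b), (b, c), (c, a)} =
      segment ℝ a b ∪ (segment ℝ b c ∪ segment ℝ c a) := by
    rw [edgeUnion_insert, edgeUnion_insert]; simp [edgeUnion]
  have hI : triangleUnion {![a, b, c]} \ edgeUnion {(a, b), (b, c), (c, a)} =
      {x | 0 < B.α x} ∩ ({x | 0 < B.β x} ∩ {x | 0 < B.γ x}) := by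
    rw [hR, hE]
    ext x
    simp only [mem_sdiff, mem_union, mem_inter_iff, mem_ofPred_eq, B.mem_convexHull,
      B.mem_segment_left, B.mem_segment_right, segment_symm ℝ c a, B.mem_segment]
    constructor
    · rintro ⟨⟨h1, h2, h3⟩, hn⟩
      refine ⟨h1.lt_of_ne fun h => ?_, h2.lt_of_ne fun h => ?_, h3.lt_of_ne fun h => ?_⟩
      · exact hn (Or.inr (Or.inl ⟨h.symm, h2, h3⟩))
      · exact hn (Or.inr (Or.inr ⟨h.symm, h1, h3⟩))
      · exact hn (Or.inl ⟨h.symm, h1, h2⟩)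
    · rintro ⟨h1, h2, h3⟩
      refine ⟨⟨h1.le, h2.le, h3.le⟩, ?_⟩
      rintro (h | h | h)
      · exact h3.ne' h.1
      · exact h1.ne' h.1
      · exact h2.ne' h.1
  have hsub : edgeUnion {(a, b), (b, c), (c, a)} ⊆ convexHull ℝ {a, b, c} := by
    rw [hE]
    refine union_subset ?_ (union_subset ?_ ?_) <;>
      exact (convex_convexHull ℝ _).segment_subset (subset_convexHull ℝ _ (by simp))
        (subset_convexHull ℝ _ (by simp))
  have hmem : ∀ x, x ∈ range ![a, b, c] ↔ x ∈ ({a, b, c} : Set Plane) := by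
    intro x; rw [range_triple]
  refine ⟨by simp, by simp, by simpa using h, ?_, ?_, ?_, ?_, ?_, ?_, ?_, ?_⟩
  · rintro t rfl i
    fin_cases i
    · exact ⟨(a, b), by simp, rfl⟩
    · exact ⟨(b, c), by simp, rfl⟩
    · exact ⟨(c, a), by simp, rfl⟩
  · rintro s rfl t rfl hst
    exact (hst rfl).elim
  · rintro e he t rfl x - -
    right; right
    rw [hmem, hmem]
    rcases he with rfl | rfl | rfl <;> simp
  · rw [hR]; exact hsub
  · rw [hI]
    exact (isOpen_lt continuous_const (affineMap_continuous _)).inter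
      ((isOpen_lt continuous_const (affineMap_continuous _)).inter
        (isOpen_lt continuous_const (affineMap_continuous _)))
  · rw [hI]
    exact ((convex_affine_gt _ _).inter
      ((convex_affine_gt _ _).inter (convex_affine_gt _ _))).isPreconnected
  · intro x hx
    rw [hI, mem_closure_iff]
    intro O hO hxO
    have hx' := B.mem_convexHull.1 (hsub hx)
    obtain ⟨ε, hε, hm⟩ := exists_pos_add_smul_mem hO hxO
      (((1 / 3 : ℝ) • a + (2 / 3 : ℝ) • ((1 / 2 : ℝ) • b + (1 / 2 : ℝ) • c)) - x)
    have hδ : 0 < min ε (1 / 2) := by positivity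
    have hδ1 : min ε (1 / 2) ≤ 1 / 2 := min_le_right _ _
    refine ⟨_, hm (min ε (1 / 2)) hδ.le (min_le_left _ _), ?_⟩
    set δ := min ε (1 / 2)
    have e1 : (1 / 2 : ℝ) + 1 / 2 = 1 := by norm_num
    have e2 : (1 / 3 : ℝ) + 2 / 3 = 1 := by norm_num
    simp only [mem_inter_iff, mem_ofPred_eq, affineMap_add_smul_sub, affineMap_combo _ e2,
      affineMap_combo _ e1, B.α_a, B.α_b, B.α_c, B.β_a, B.β_b, B.β_c, B.γ_a, B.γ_b, B.γ_c]
    refine ⟨?_, ?_, ?_⟩ <;> nlinarith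
  · intro e he K hK hKc hKT
    rw [hR] at hKT ⊢
    have e1 : ({a, b, c} : Set Plane) = {b, c, a} := by ext; simp; tauto
    have e2 : ({a, b, c} : Set Plane) = {c, a, b} := by ext; simp; tauto
    rcases he with rfl | rfl | rfl
    · rw [e1] at hKT ⊢
      exact isPreconnected_compl_union_triangle B.rotate hK hKc
        (hKT.trans (segment_symm ℝ _ _))
    · rw [e2] at hKT ⊢
      exact isPreconnected_compl_union_triangle B.rotate.rotate hK hKc
        (hKT.trans (segment_symm ℝ _ _))
    · exact isPreconnected_compl_union_triangle B hK hKc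
        (hKT.trans (segment_symm ℝ _ _))

/-- Two triangulated polygons lying on different sides of a common edge `pq`. -/
structure IsSplit (p q : Plane) (A₁ A₂ : Set (Plane × Plane)) (T₁ T₂ : Set (Fin 3 → Plane)) :
    Prop where
  ne : p ≠ q
  tri₁ : IsTriangulation (insert (q, p) A₁) T₁
  tri₂ : IsTriangulation (insert (p, q) A₂) T₂
  inter₁ : ∀ x ∈ edgeUnion A₁, x ∈ segment ℝ p q → x = p ∨ x = q
  inter₂ : ∀ x ∈ edgeUnion A₂, x ∈ segment ℝ p q → x = p ∨ x = q
  inter : ∀ x ∈ edgeUnion A₁, x ∈ edgeUnion A₂ → x = p ∨ x = q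
  left_mem₁ : p ∈ edgeUnion A₁
  left_mem₂ : p ∈ edgeUnion A₂
  right_mem₁ : q ∈ edgeUnion A₁
  right_mem₂ : q ∈ edgeUnion A₂
  left_end : ∀ e ∈ A₁ ∪ A₂, p ∈ segment ℝ e.1 e.2 → p = e.1 ∨ p = e.2
  right_end : ∀ e ∈ A₁ ∪ A₂, q ∈ segment ℝ e.1 e.2 → q = e.1 ∨ q = e.2
  left_start : ∃ e ∈ A₁ ∪ A₂, p = e.1
  right_start : ∃ e ∈ A₁ ∪ A₂, q = e.1
  out₁ : ∀ x ∈ edgeUnion A₁, x ≠ p → x ≠ q → x ∉ triangleUnion T₂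
  out₂ : ∀ x ∈ edgeUnion A₂, x ≠ p → x ≠ q → x ∉ triangleUnion T₁
  nonempty₁ : ∃ x ∈ edgeUnion A₁, x ≠ p ∧ x ≠ q
  nonempty₂ : ∃ x ∈ edgeUnion A₂, x ≠ p ∧ x ≠ q

namespace IsSplit

variable {p q : Plane} {A₁ A₂ : Set (Plane × Plane)} {T₁ T₂ : Set (Fin 3 → Plane)}

theorem symm (h : IsSplit p q A₁ A₂ T₁ T₂) : IsSplit q p A₂ A₁ T₂ T₁ where
  ne := h.ne.symm
  tri₁ := h.tri₂
  tri₂ := h.tri₁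
  inter₁ x h1 h2 := (h.inter₂ x h1 (segment_symm ℝ q p ▸ h2)).symm
  inter₂ x h1 h2 := (h.inter₁ x h1 (segment_symm ℝ q p ▸ h2)).symm
  inter x h1 h2 := (h.inter x h2 h1).symm
  left_mem₁ := h.right_mem₂
  left_mem₂ := h.right_mem₁
  right_mem₁ := h.left_mem₂
  right_mem₂ := h.left_mem₁
  left_end e he := h.right_end e he.symm
  right_end e he := h.left_end e he.symm
  left_start := by rw [union_comm]; exact h.right_start
  right_start := by rw [union_comm]; exact h.left_start
  out₁ x hx h1 h2 := h.out₂ x hx h2 h1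
  out₂ x hx h1 h2 := h.out₁ x hx h2 h1
  nonempty₁ := let ⟨x, h1, h2, h3⟩ := h.nonempty₂; ⟨x, h1, h3, h2⟩
  nonempty₂ := let ⟨x, h1, h2, h3⟩ := h.nonempty₁; ⟨x, h1, h3, h2⟩

theorem mem_edges₁ (x : Plane) :
    x ∈ edgeUnion (insert (q, p) A₁) ↔ x ∈ segment ℝ p q ∨ x ∈ edgeUnion A₁ := by
  rw [edgeUnion_insert, mem_union, segment_symm]

theorem mem_edges₂ (x : Plane) :
    x ∈ edgeUnion (insert (p, q) A₂) ↔ x ∈ segment ℝ p q ∨ x ∈ edgeUnion A₂ := by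
  rw [edgeUnion_insert, mem_union]

theorem segment_subset₁ (h : IsSplit p q A₁ A₂ T₁ T₂) : segment ℝ p q ⊆ triangleUnion T₁ :=
  fun x hx => h.tri₁.boundary_subset ((mem_edges₁ x).2 (Or.inl hx))

theorem disjoint_diff (h : IsSplit p q A₁ A₂ T₁ T₂) :
    Disjoint (triangleUnion T₁ \ edgeUnion (insert (q, p) A₁)) (triangleUnion T₂) := by
  have hd : Disjoint (triangleUnion T₁ \ edgeUnion (insert (q, p) A₁))
      (edgeUnion (insert (p, q) A₂)) := by
    rw [disjoint_left]
    rintro x ⟨hx1, hx2⟩ hx3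
    rw [mem_edges₁] at hx2
    rcases (mem_edges₂ x).1 hx3 with hx | hx
    · exact hx2 (Or.inl hx)
    · refine h.out₂ x hx ?_ ?_ hx1
      · rintro rfl; exact hx2 (Or.inl (left_mem_segment ℝ _ _))
      · rintro rfl; exact hx2 (Or.inl (right_mem_segment ℝ _ _))
  rcases h.tri₂.subset_or_disjoint h.tri₁.isPreconnected_diff hd with h' | h'
  · exfalso
    obtain ⟨x, hx, hxp, hxq⟩ := h.nonempty₁
    have h1 : x ∈ closure (triangleUnion T₂) :=
      closure_mono (h'.trans sdiff_subset)
        (h.tri₁.subset_closure_diff ((mem_edges₁ x).2 (Or.inr hx)))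
    rw [(isCompact_triangleUnion h.tri₂.finite).isClosed.closure_eq] at h1
    exact h.out₁ x hx hxp hxq h1
  · exact h'

theorem inter_eq (h : IsSplit p q A₁ A₂ T₁ T₂) :
    triangleUnion T₁ ∩ triangleUnion T₂ = segment ℝ p q := by
  apply Subset.antisymm
  · rintro x ⟨h1, h2⟩
    by_cases hx1 : x ∈ edgeUnion (insert (q, p) A₁)
    · rcases (mem_edges₁ x).1 hx1 with hx | hx
      · exact hx
      · by_contra hn
        refine h.out₁ x hx ?_ ?_ h2
        · rintro rfl; exact hn (left_mem_segment ℝ _ _)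
        · rintro rfl; exact hn (right_mem_segment ℝ _ _)
    · exact (disjoint_left.1 h.disjoint_diff ⟨h1, hx1⟩ h2).elim
  · exact subset_inter h.segment_subset₁ (segment_symm ℝ q p ▸ h.symm.segment_subset₁)

theorem face (h : IsSplit p q A₁ A₂ T₁ T₂) {s t : Fin 3 → Plane} (hs : s ∈ T₁) (ht : t ∈ T₂) :
    interior (convexHull ℝ (range s)) ∩ interior (convexHull ℝ (range t)) = ∅ ∧
    convexHull ℝ (range s) ∩ convexHull ℝ (range t) = convexHull ℝ (range s ∩ range t) := by
  have hs' : convexHull ℝ (range s) ⊆ triangleUnion T₁ := fun x hx =>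
    mem_triangleUnion.2 ⟨s, hs, hx⟩
  have ht' : convexHull ℝ (range t) ⊆ triangleUnion T₂ := fun x hx =>
    mem_triangleUnion.2 ⟨t, ht, hx⟩
  constructor
  · rw [eq_empty_iff_forall_notMem]
    rintro x ⟨hx1, hx2⟩
    have hD : x ∈ segment ℝ p q := by
      rw [← h.inter_eq]
      exact ⟨hs' (interior_subset hx1), ht' (interior_subset hx2)⟩
    have hcl := h.tri₁.subset_closure_diff ((mem_edges₁ x).2 (Or.inl hD))
    obtain ⟨y, hy1, hy2⟩ := mem_closure_iff.1 hcl _ (isOpen_interior.inter isOpen_interior)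
      ⟨hx1, hx2⟩
    exact disjoint_left.1 h.disjoint_diff hy2 (ht' (interior_subset hy1.2))
  · apply Subset.antisymm
    · rintro x ⟨hx1, hx2⟩
      have hD : x ∈ segment ℝ p q := by
        rw [← h.inter_eq]; exact ⟨hs' hx1, ht' hx2⟩
      have e1 := h.tri₁.edge (q, p) (mem_insert _ _) s hs x hx1 (segment_symm ℝ q p ▸ hD)
      have e2 := h.tri₂.edge (p, q) (mem_insert _ _) t ht x hx2 hD
      have hne := h.ne
      have key : (x = p ∧ p ∈ range s ∩ range t) ∨ (x = q ∧ q ∈ range s ∩ range t) ∨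
          (p ∈ range s ∩ range t ∧ q ∈ range s ∩ range t) := by
        simp only [mem_inter_iff]
        grind
      rcases key with ⟨rfl, k⟩ | ⟨rfl, k⟩ | ⟨k1, k2⟩
      · exact subset_convexHull ℝ _ k
      · exact subset_convexHull ℝ _ k
      · exact (convex_convexHull ℝ _).segment_subset (subset_convexHull ℝ _ k1)
          (subset_convexHull ℝ _ k2) hD
    · exact subset_inter (convexHull_mono inter_subset_left) (convexHull_mono inter_subset_right)

theorem edge (h : IsSplit p q A₁ A₂ T₁ T₂) {e : Plane × Plane} (he : e ∈ A₁)
    {t : Fin 3 → Plane} (ht : t ∈ T₁ ∪ T₂) {x : Plane} (hx : x ∈ convexHull ℝ (range t))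
    (hxe : x ∈ segment ℝ e.1 e.2) :
    (x = e.1 ∧ e.1 ∈ range t) ∨ (x = e.2 ∧ e.2 ∈ range t) ∨
      (e.1 ∈ range t ∧ e.2 ∈ range t) := by
  rcases ht with ht | ht
  · exact h.tri₁.edge e (mem_insert_of_mem _ he) t ht x hx hxe
  · have hxA : x ∈ edgeUnion A₁ := mem_edgeUnion.2 ⟨e, he, hxe⟩
    have hxT : x ∈ triangleUnion T₂ := mem_triangleUnion.2 ⟨t, ht, hx⟩
    have hpq : x = p ∨ x = q := by
      by_contra! hn
      exact h.out₁ x hxA hn.1 hn.2 hxT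
    have hD : x ∈ segment ℝ p q := by
      rcases hpq with rfl | rfl
      · exact left_mem_segment ℝ _ _
      · exact right_mem_segment ℝ _ _
    have hxt : x ∈ range t := by
      have hne := h.ne
      rcases h.tri₂.edge (p, q) (mem_insert _ _) t ht x hx hD with ⟨rfl, a⟩ | ⟨rfl, a⟩ | ⟨a, b⟩
      · exact a
      · exact a
      · rcases hpq with rfl | rfl
        · exact a
        · exact b
    have hend : x = e.1 ∨ x = e.2 := by
      rcases hpq with rfl | rfl
      · exact h.left_end e (Or.inl he) hxe
      · exact h.right_end e (Or.inl he) hxe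
    rcases hend with h1 | h1
    · exact Or.inl ⟨h1, h1 ▸ hxt⟩
    · exact Or.inr (Or.inl ⟨h1, h1 ▸ hxt⟩)

theorem isPreconnected_compl_union (h : IsSplit p q A₁ A₂ T₁ T₂) {e : Plane × Plane}
    (he : e ∈ A₁) {K : Set Plane} (hK : IsClosed K) (hKc : IsPreconnected Kᶜ)
    (hKT : K ∩ triangleUnion (T₁ ∪ T₂) = segment ℝ e.1 e.2) :
    IsPreconnected (K ∪ triangleUnion (T₁ ∪ T₂))ᶜ := by
  rw [triangleUnion_union] at hKT ⊢
  have heT : segment ℝ e.1 e.2 ⊆ triangleUnion T₁ := fun x hx =>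
    h.tri₁.boundary_subset (mem_edgeUnion.2 ⟨e, mem_insert_of_mem _ he, hx⟩)
  have h1 : K ∩ triangleUnion T₁ = segment ℝ e.1 e.2 := by
    apply Subset.antisymm
    · exact fun x hx => hKT.le ⟨hx.1, Or.inl hx.2⟩
    · exact fun x hx => ⟨(hKT.ge hx).1, heT hx⟩
  have h2 := h.tri₁.isPreconnected_compl_union e (mem_insert_of_mem _ he) K hK hKc h1
  rw [← union_assoc]
  refine h.tri₂.isPreconnected_compl_union (p, q) (mem_insert _ _) _
    (hK.union (isCompact_triangleUnion h.tri₁.finite).isClosed) h2 ?_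
  rw [← h.inter_eq]
  apply Subset.antisymm
  · rintro x ⟨hx1 | hx1, hx2⟩
    · exact ⟨heT (hKT.le ⟨hx1, Or.inr hx2⟩), hx2⟩
    · exact ⟨hx1, hx2⟩
  · exact inter_subset_inter_left _ subset_union_right

theorem diff_eq (h : IsSplit p q A₁ A₂ T₁ T₂) :
    triangleUnion (T₁ ∪ T₂) \ edgeUnion (A₁ ∪ A₂) =
      ((triangleUnion T₁ \ edgeUnion (insert (q, p) A₁)) ∪ (segment ℝ p q \ {p, q})) ∪
      ((triangleUnion T₂ \ edgeUnion (insert (p, q) A₂)) ∪ (segment ℝ p q \ {p, q})) := by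
  have hT : ∀ x ∈ segment ℝ p q, x ∈ triangleUnion T₁ := h.segment_subset₁
  have h1 := h.inter₁
  have h2 := h.inter₂
  have h3 := h.left_mem₁
  have h4 := h.right_mem₁
  ext x
  rw [triangleUnion_union, edgeUnion_union]
  simp only [mem_sdiff, mem_union, mem_edges₁ (p := p), mem_edges₂ (p := p), mem_insert_iff,
    mem_singleton_iff]
  constructor
  · rintro ⟨hx1, hx2⟩
    by_cases hD : x ∈ segment ℝ p q
    · have : ¬ (x = p ∨ x = q) := by
        rintro (rfl | rfl)
        · exact hx2 (Or.inl h3)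
        · exact hx2 (Or.inl h4)
      exact Or.inl (Or.inr ⟨hD, this⟩)
    · tauto
  · have key : x ∈ segment ℝ p q ∧ ¬ (x = p ∨ x = q) → (x ∈ triangleUnion T₁ ∨ x ∈ triangleUnion T₂) ∧
        ¬ (x ∈ edgeUnion A₁ ∨ x ∈ edgeUnion A₂) := by
      rintro ⟨hD, hn⟩
      refine ⟨Or.inl (hT x hD), ?_⟩
      rintro (h' | h')
      · exact hn (h1 x h' hD)
      · exact hn (h2 x h' hD)
    rintro ((⟨hx1, hx2⟩ | hx) | (⟨hx1, hx2⟩ | hx))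
    · refine ⟨Or.inl hx1, ?_⟩
      rintro (h' | h')
      · exact hx2 (Or.inr h')
      · have hxA : x ∉ segment ℝ p q := fun hh => hx2 (Or.inl hh)
        refine h.out₂ x h' ?_ ?_ hx1
        · rintro rfl; exact hxA (left_mem_segment ℝ _ _)
        · rintro rfl; exact hxA (right_mem_segment ℝ _ _)
    · exact key hx
    · refine ⟨Or.inr hx1, ?_⟩
      rintro (h' | h')
      · have hxA : x ∉ segment ℝ p q := fun hh => hx2 (Or.inl hh)
        refine h.out₁ x h' ?_ ?_ hx1
        · rintro rfl; exact hxA (left_mem_segment ℝ _ _)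
        · rintro rfl; exact hxA (right_mem_segment ℝ _ _)
      · exact hx2 (Or.inr h')
    · exact key hx

theorem openSegment_nonempty_diff (h : IsSplit p q A₁ A₂ T₁ T₂) :
    (segment ℝ p q \ {p, q}).Nonempty := by
  obtain ⟨r, ⟨B⟩⟩ := exists_bary_of_ne h.ne
  have e1 : (1 / 2 : ℝ) + 1 / 2 = 1 := by norm_num
  refine ⟨(1 / 2 : ℝ) • p + (1 / 2 : ℝ) • q, ⟨1 / 2, 1 / 2, by norm_num, by norm_num, e1, rfl⟩, ?_⟩
  rintro (hx | hx) <;> have := congrArg B.α hx <;>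
    rw [affineMap_combo _ e1] at this <;> norm_num [B.α_a, B.α_c] at this

theorem isPreconnected_diff_union (h : IsSplit p q A₁ A₂ T₁ T₂) :
    IsPreconnected ((triangleUnion T₁ \ edgeUnion (insert (q, p) A₁)) ∪
      (segment ℝ p q \ {p, q})) := by
  refine h.tri₁.isPreconnected_diff.subset_closure subset_union_left
    (union_subset subset_closure ?_)
  exact fun x hx => h.tri₁.subset_closure_diff ((mem_edges₁ x).2 (Or.inl hx.1))

theorem mem_nhds_of_mem_segment (h : IsSplit p q A₁ A₂ T₁ T₂) {x : Plane}
    (hx : x ∈ segment ℝ p q) (hxp : x ≠ p) (hxq : x ≠ q) :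
    triangleUnion (T₁ ∪ T₂) ∈ nhds x := by
  obtain ⟨r, ⟨B⟩⟩ := exists_bary_of_ne h.ne
  have hx' := B.mem_segment.1 hx
  have hcomb := B.comb x
  have hsum := B.sum x
  rw [hx'.1] at hcomb hsum
  have hα : 0 < B.α x := by
    refine hx'.2.1.lt_of_ne fun h0 => hxq ?_
    rw [← h0] at hcomb hsum
    rw [← hcomb, show B.γ x = 1 by linarith]; simp
  have hγ : 0 < B.γ x := by
    refine hx'.2.2.lt_of_ne fun h0 => hxp ?_
    rw [← h0] at hcomb hsum
    rw [← hcomb, show B.α x = 1 by linarith]; simp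
  have hA₁ : A₁.Finite := h.tri₁.finite_edges.subset (subset_insert _ _)
  have hA₂ : A₂.Finite := h.tri₂.finite_edges.subset (subset_insert _ _)
  have hO : IsOpen (((edgeUnion A₁)ᶜ ∩ (edgeUnion A₂)ᶜ) ∩ ({y | 0 < B.α y} ∩ {y | 0 < B.γ y})) :=
    ((isClosed_edgeUnion hA₁).isOpen_compl.inter (isClosed_edgeUnion hA₂).isOpen_compl).inter
      ((isOpen_lt continuous_const (affineMap_continuous _)).inter
        (isOpen_lt continuous_const (affineMap_continuous _)))
  have hxO : x ∈ ((edgeUnion A₁)ᶜ ∩ (edgeUnion A₂)ᶜ) ∩ ({y | 0 < B.α y} ∩ {y | 0 < B.γ y}) := by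
    refine ⟨⟨fun hh => ?_, fun hh => ?_⟩, hα, hγ⟩
    · rcases h.inter₁ x hh hx with rfl | rfl
      · exact hxp rfl
      · exact hxq rfl
    · rcases h.inter₂ x hh hx with rfl | rfl
      · exact hxp rfl
      · exact hxq rfl
  obtain ⟨ε, hε, hball⟩ := Metric.isOpen_iff.1 hO x hxO
  refine Filter.mem_of_superset (Metric.ball_mem_nhds x hε) ?_
  have hline : ∀ y ∈ Metric.ball x ε, B.β y = 0 → y ∈ segment ℝ p q := fun y hy h0 =>
    B.mem_segment.2 ⟨h0, (hball hy).2.1.le, (hball hy).2.2.le⟩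
  have hpc : ∀ S : Set Plane, Convex ℝ S → (∀ y ∈ S, B.β y ≠ 0) →
      (Metric.ball x ε ∩ S ⊆ triangleUnion T₁ \ edgeUnion (insert (q, p) A₁) ∨
        Disjoint (Metric.ball x ε ∩ S) (triangleUnion T₁)) ∧
      (Metric.ball x ε ∩ S ⊆ triangleUnion T₂ \ edgeUnion (insert (p, q) A₂) ∨
        Disjoint (Metric.ball x ε ∩ S) (triangleUnion T₂)) := by
    intro S hS hS0
    have hc := ((convex_ball x ε).inter hS).isPreconnected
    refine ⟨h.tri₁.subset_or_disjoint hc ?_, h.tri₂.subset_or_disjoint hc ?_⟩ <;>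
      rw [disjoint_left] <;> rintro y ⟨hy1, hy2⟩ hy3
    · rcases (mem_edges₁ y).1 hy3 with h' | h'
      · exact hS0 y hy2 (B.mem_segment.1 h').1
      · exact (hball hy1).1.1 h'
    · rcases (mem_edges₂ y).1 hy3 with h' | h'
      · exact hS0 y hy2 (B.mem_segment.1 h').1
      · exact (hball hy1).1.2 h'
  have hpos := hpc {y | 0 < B.β y} (convex_affine_gt _ _) (fun y hy => ne_of_gt hy)
  have hneg := hpc {y | B.β y < 0} (convex_affine_lt _ _) (fun y hy => ne_of_lt hy)
  have hmeet : ∀ {E : Set (Plane × Plane)} {T : Set (Fin 3 → Plane)}, IsTriangulation E T →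
      segment ℝ p q ⊆ edgeUnion E →
      (Metric.ball x ε ∩ {y | 0 < B.β y} ⊆ triangleUnion T \ edgeUnion E ∨
        Disjoint (Metric.ball x ε ∩ {y | 0 < B.β y}) (triangleUnion T)) →
      (Metric.ball x ε ∩ {y | B.β y < 0} ⊆ triangleUnion T \ edgeUnion E ∨
        Disjoint (Metric.ball x ε ∩ {y | B.β y < 0}) (triangleUnion T)) →
      Metric.ball x ε ∩ {y | 0 < B.β y} ⊆ triangleUnion T \ edgeUnion E ∨
      Metric.ball x ε ∩ {y | B.β y < 0} ⊆ triangleUnion T \ edgeUnion E := by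
    intro E T hT hsub h1 h2
    obtain ⟨y, hy1, hy2⟩ := mem_closure_iff.1 (hT.subset_closure_diff (hsub hx)) _
      Metric.isOpen_ball (Metric.mem_ball_self hε)
    have hy0 : B.β y ≠ 0 := fun h0 => hy2.2 (hsub (hline y hy1 h0))
    rcases hy0.lt_or_gt with hy | hy
    · exact Or.inr (h2.resolve_right fun hd => disjoint_left.1 hd ⟨hy1, hy⟩ hy2.1)
    · exact Or.inl (h1.resolve_right fun hd => disjoint_left.1 hd ⟨hy1, hy⟩ hy2.1)
  have m1 := hmeet h.tri₁ (fun y hy => (mem_edges₁ y).2 (Or.inl hy)) hpos.1 hneg.1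
  have m2 := hmeet h.tri₂ (fun y hy => (mem_edges₂ y).2 (Or.inl hy)) hpos.2 hneg.2
  have hside : ∀ d : Plane, ∃ y ∈ Metric.ball x ε, ∃ δ : ℝ, 0 < δ ∧ y = x + δ • d := by
    intro d
    obtain ⟨δ, hδ, hm⟩ := exists_pos_add_smul_mem Metric.isOpen_ball (Metric.mem_ball_self hε) d
    exact ⟨_, hm δ hδ.le le_rfl, δ, hδ, rfl⟩
  have hno : ∀ S : Set Plane, S.Nonempty →
      S ⊆ triangleUnion T₁ \ edgeUnion (insert (q, p) A₁) →
      S ⊆ triangleUnion T₂ \ edgeUnion (insert (p, q) A₂) → False :=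
    fun S ⟨y, hy⟩ h1 h2 => disjoint_left.1 h.disjoint_diff (h1 hy) (h2 hy).1
  have nepos : (Metric.ball x ε ∩ {y | 0 < B.β y}).Nonempty := by
    obtain ⟨y, hy, δ, hδ, rfl⟩ := hside (r - p)
    refine ⟨_, hy, ?_⟩
    rw [mem_ofPred_eq, affineMap_add_smul_sub, hx'.1, B.β_b, B.β_a]; linarith
  have neneg : (Metric.ball x ε ∩ {y | B.β y < 0}).Nonempty := by
    obtain ⟨y, hy, δ, hδ, rfl⟩ := hside (p - r)
    refine ⟨_, hy, ?_⟩
    rw [mem_ofPred_eq, affineMap_add_smul_sub, hx'.1, B.β_b, B.β_a]; linarith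
  have hcover : ∀ y ∈ Metric.ball x ε, B.β y ≠ 0 → y ∈ triangleUnion T₁ ∪ triangleUnion T₂ := by
    intro y hy h0
    rcases m1 with m1 | m1 <;> rcases m2 with m2 | m2
    · exact (hno _ nepos m1 m2).elim
    · rcases h0.lt_or_gt with h0 | h0
      · exact Or.inr (m2 ⟨hy, h0⟩).1
      · exact Or.inl (m1 ⟨hy, h0⟩).1
    · rcases h0.lt_or_gt with h0 | h0
      · exact Or.inl (m1 ⟨hy, h0⟩).1
      · exact Or.inr (m2 ⟨hy, h0⟩).1
    · exact (hno _ neneg m1 m2).elim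
  intro y hy
  rw [triangleUnion_union]
  by_cases h0 : B.β y = 0
  · exact Or.inl (h.segment_subset₁ (hline y hy h0))
  · exact hcover y hy h0

theorem isTriangulation (h : IsSplit p q A₁ A₂ T₁ T₂) :
    IsTriangulation (A₁ ∪ A₂) (T₁ ∪ T₂) where
  finite_edges := (h.tri₁.finite_edges.subset (subset_insert _ _)).union
    (h.tri₂.finite_edges.subset (subset_insert _ _))
  finite := h.tri₁.finite.union h.tri₂.finite
  indep t ht := ht.elim (h.tri₁.indep t) (h.tri₂.indep t)
  vertex t ht i := by
    rcases ht with ht | ht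
    · obtain ⟨e, he | he, hi⟩ := h.tri₁.vertex t ht i
      · rw [hi, he]; exact h.right_start
      · exact ⟨e, Or.inl he, hi⟩
    · obtain ⟨e, he | he, hi⟩ := h.tri₂.vertex t ht i
      · rw [hi, he]; exact h.left_start
      · exact ⟨e, Or.inr he, hi⟩
  face s hs t ht hst := by
    rcases hs with hs | hs <;> rcases ht with ht | ht
    · exact h.tri₁.face s hs t ht hst
    · exact h.face hs ht
    · exact h.symm.face hs ht
    · exact h.tri₂.face s hs t ht hst
  edge e he t ht x hx hxe := by
    rcases he with he | he
    · exact h.edge he ht hx hxe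
    · exact h.symm.edge he ht.symm hx hxe
  boundary_subset := by
    rw [edgeUnion_union, triangleUnion_union]
    exact union_subset_union (fun x hx => h.tri₁.boundary_subset ((mem_edges₁ x).2 (Or.inr hx)))
      (fun x hx => h.tri₂.boundary_subset ((mem_edges₂ x).2 (Or.inr hx)))
  isOpen_diff := by
    have hA₁ : A₁.Finite := h.tri₁.finite_edges.subset (subset_insert _ _)
    have hA₂ : A₂.Finite := h.tri₂.finite_edges.subset (subset_insert _ _)
    have hcl : IsClosed (edgeUnion (A₁ ∪ A₂)) := isClosed_edgeUnion (hA₁.union hA₂)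
    rw [isOpen_iff_mem_nhds]
    intro x hx
    refine Filter.inter_mem ?_ (hcl.isOpen_compl.mem_nhds hx.2)
    rw [h.diff_eq] at hx
    rcases hx with (hx | hx) | (hx | hx)
    · refine Filter.mem_of_superset (h.tri₁.isOpen_diff.mem_nhds hx) ?_
      rw [triangleUnion_union]
      exact sdiff_subset.trans subset_union_left
    · exact h.mem_nhds_of_mem_segment hx.1 (fun h' => hx.2 (Or.inl h')) (fun h' => hx.2 (Or.inr h'))
    · refine Filter.mem_of_superset (h.tri₂.isOpen_diff.mem_nhds hx) ?_
      rw [triangleUnion_union]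
      exact sdiff_subset.trans subset_union_right
    · exact h.mem_nhds_of_mem_segment hx.1 (fun h' => hx.2 (Or.inl h')) (fun h' => hx.2 (Or.inr h'))
  isPreconnected_diff := by
    rw [h.diff_eq]
    obtain ⟨x, hx⟩ := h.openSegment_nonempty_diff
    refine IsPreconnected.union x (Or.inr hx) (Or.inr hx) h.isPreconnected_diff_union ?_
    have := h.symm.isPreconnected_diff_union
    rwa [segment_symm, pair_comm] at this
  subset_closure_diff := by
    rw [h.diff_eq, edgeUnion_union]
    refine union_subset ?_ ?_
    · intro x hx
      exact closure_mono (subset_union_left.trans subset_union_left)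
        (h.tri₁.subset_closure_diff ((mem_edges₁ x).2 (Or.inr hx)))
    · intro x hx
      exact closure_mono (subset_union_left.trans subset_union_right)
        (h.tri₂.subset_closure_diff ((mem_edges₂ x).2 (Or.inr hx)))
  isPreconnected_compl_union e he K hK hKc hKT := by
    rcases he with he | he
    · exact h.isPreconnected_compl_union he hK hKc hKT
    · rw [union_comm T₁] at hKT ⊢
      exact h.symm.isPreconnected_compl_union he hK hKc hKT

end IsSplit

/-- The edges of the polygonal chain `v` with indices in `s`. -/
def chainEdges (v : ℕ → Plane) (s : Set ℕ) : Set (Plane × Plane) := (fun i => (v i, v (i + 1))) '' s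

theorem mem_edgeUnion_chainEdges {v : ℕ → Plane} {s : Set ℕ} {x : Plane} :
    x ∈ edgeUnion (chainEdges v s) ↔ ∃ i ∈ s, x ∈ segment ℝ (v i) (v (i + 1)) := by
  simp [mem_edgeUnion, chainEdges]

/-- `v 0, …, v k` is a simple closed polygon. -/
structure IsPolygon (k : ℕ) (v : ℕ → Plane) : Prop where
  closed : v k = v 0
  inj : ∀ i j, i < k → j < k → v i = v j → i = j
  meet : ∀ i j, i < j → j < k → ∀ x, x ∈ segment ℝ (v i) (v (i + 1)) →
    x ∈ segment ℝ (v j) (v (j + 1)) → (j = i + 1 ∧ x = v j) ∨ (i = 0 ∧ j + 1 = k ∧ x = v 0)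

namespace IsPolygon

variable {k : ℕ} {v : ℕ → Plane}

theorem inj_succ (h : IsPolygon k v) {i j : ℕ} (hi : i < k) (hj : j < k)
    (hij : v (i + 1) = v (j + 1)) : i = j := by
  have h1 := h.closed
  have h2 := h.inj
  rcases Nat.lt_or_ge (i + 1) k with hi' | hi' <;> rcases Nat.lt_or_ge (j + 1) k with hj' | hj'
  · have := h2 _ _ hi' hj' hij; omega
  · rw [show j + 1 = k by omega, h1] at hij
    have := h2 _ _ hi' (by omega) hij; omega
  · rw [show i + 1 = k by omega, h1] at hij
    have := h2 _ _ (by omega) hj' hij; omega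
  · omega

theorem rotate (h : IsPolygon k v) (hk : 2 ≤ k) :
    IsPolygon k (fun i => if i < k then v (i + 1) else v 1) where
  closed := by simp [show 0 < k by omega]
  inj i j hi hj hij := by
    simp only [hi, hj, if_true] at hij
    exact h.inj_succ hi hj hij
  meet i j hij hj x hx1 hx2 := by
    have hi1 : i < k := by omega
    have hi2 : i + 1 < k := by omega
    simp only [hi1, hi2, hj, if_true] at hx1 hx2 ⊢
    simp only [show 0 < k by omega, if_true]
    by_cases hj' : j + 1 < k
    · simp only [hj', if_true] at hx2
      rcases h.meet (i + 1) (j + 1) (by omega) hj' x hx1 hx2 with h' | h'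
      · exact Or.inl ⟨by omega, h'.2⟩
      · omega
    · simp only [hj', if_false] at hx2
      have hjk : j + 1 = k := by omega
      rw [hjk, h.closed] at hx2
      rcases h.meet 0 (i + 1) (by omega) hi2 x hx2 hx1 with h' | h'
      · have : i = 0 := by omega
        subst this
        exact Or.inr ⟨rfl, hjk, h'.2⟩
      · refine Or.inl ⟨by omega, ?_⟩
        rw [hjk, h.closed]; exact h'.2.2

theorem chainEdges_rotate (h : IsPolygon k v) (hk : 2 ≤ k) :
    chainEdges (fun i => if i < k then v (i + 1) else v 1) (Iio k) = chainEdges v (Iio k) := by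
  ext e
  constructor
  · rintro ⟨i, hi, rfl⟩
    simp only [mem_Iio] at hi
    by_cases hi' : i + 1 < k
    · exact ⟨i + 1, hi', by simp [hi, hi']⟩
    · refine ⟨0, by simp; omega, ?_⟩
      have : i + 1 = k := by omega
      simp [hi, this, h.closed]
  · rintro ⟨i, hi, rfl⟩
    simp only [mem_Iio] at hi
    rcases i with _ | i
    · refine ⟨k - 1, by simp; omega, ?_⟩
      have : k - 1 + 1 = k := by omega
      simp [this, h.closed, show k - 1 < k by omega]
    · exact ⟨i, by simp; omega, by simp [hi, show i < k by omega]⟩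

theorem exists_rotate (hk : 2 ≤ k) (j : ℕ) (hj : j < k) :
    ∀ {v : ℕ → Plane}, IsPolygon k v → ∃ w, IsPolygon k w ∧
      chainEdges w (Iio k) = chainEdges v (Iio k) ∧ w 1 = v (j + 1) := by
  induction j with
  | zero => exact fun {v} h => ⟨v, h, rfl, rfl⟩
  | succ j ih =>
    intro v h
    obtain ⟨w, h1, h2, h3⟩ := ih (by omega) (h.rotate hk)
    refine ⟨w, h1, h2.trans (h.chainEdges_rotate hk), ?_⟩
    rw [h3]; simp [hj]

theorem vertex_mem (h : IsPolygon k v) {i j : ℕ} (hi : i < k) (hj : j < k)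
    (hx : v j ∈ segment ℝ (v i) (v (i + 1))) : v j = v i ∨ v j = v (i + 1) := by
  rcases lt_trichotomy i j with hij | rfl | hij
  · rcases h.meet i j hij hj _ hx (left_mem_segment ℝ _ _) with h' | h'
    · right; rw [h'.1]
    · left; rw [h'.1]; exact h'.2.2
  · exact Or.inl rfl
  · rcases h.meet j i hij hi _ (left_mem_segment ℝ _ _) hx with h' | h'
    · exact Or.inl h'.2
    · right; rw [h'.2.1, h'.1, h.closed]

theorem ne_succ (h : IsPolygon k v) (hk : 2 ≤ k) {i : ℕ} (hi : i < k) : v i ≠ v (i + 1) := by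
  intro hij
  by_cases hi' : i + 1 < k
  · have := h.inj _ _ hi hi' hij; omega
  · rw [show i + 1 = k by omega, h.closed] at hij
    have := h.inj _ _ hi (by omega) hij; omega

theorem vertex_mem_le (h : IsPolygon k v) {i j : ℕ} (hi : i < k) (hj : j ≤ k)
    (hx : v j ∈ segment ℝ (v i) (v (i + 1))) : v j = v i ∨ v j = v (i + 1) := by
  rcases hj.lt_or_eq with hj | rfl
  · exact h.vertex_mem hi hj hx
  · rw [h.closed] at hx ⊢
    exact h.vertex_mem hi (by omega) hx

theorem isPreconnected_chain (h : IsPolygon k v) (hk : 2 ≤ k) {m n : ℕ} (hn : n ≤ k) (hmn : m < n) :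
    IsPreconnected (edgeUnion (chainEdges v (Ico m n)) \ {v m, v n}) := by
  have : edgeUnion (chainEdges v (Ico m n)) \ {v m, v n} =
      ⋃ i ∈ Ico m n, segment ℝ (v i) (v (i + 1)) \ {v m, v n} := by
    ext x
    simp only [mem_sdiff, mem_edgeUnion_chainEdges, mem_iUnion, exists_prop]
    constructor
    · rintro ⟨⟨i, hi, hx⟩, hn⟩; exact ⟨i, hi, hx, hn⟩
    · rintro ⟨i, hi, hx, hn⟩; exact ⟨⟨i, hi, hx⟩, hn⟩
  rw [this]
  refine IsPreconnected.biUnion_of_chain ordConnected_Ico ?_ ?_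
  · intro i hi
    have hik : i < k := lt_of_lt_of_le hi.2 hn
    have hne := h.ne_succ hk hik
    have hopen : ∀ j ≤ k, v j ∉ openSegment ℝ (v i) (v (i + 1)) := by
      intro j hj hx
      rcases h.vertex_mem_le hik hj (openSegment_subset_segment ℝ _ _ hx) with h' | h'
      · rw [h', left_mem_openSegment_iff] at hx; exact hne hx
      · rw [h', right_mem_openSegment_iff] at hx; exact hne hx
    refine (convex_openSegment (𝕜 := ℝ) (v i) (v (i + 1))).isPreconnected.subset_closure ?_ ?_
    · intro x hx
      refine ⟨openSegment_subset_segment ℝ _ _ hx, ?_⟩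
      rintro (rfl | rfl)
      · exact hopen m (by omega) hx
      · exact hopen n hn hx
    · exact sdiff_subset.trans segment_subset_closure_openSegment
  · intro i hi hi'
    simp only [Nat.succ_eq_succ, Nat.succ_eq_add_one, mem_Ico] at hi hi'
    refine ⟨v (i + 1), ⟨right_mem_segment ℝ _ _, ?_⟩, left_mem_segment ℝ _ _, ?_⟩ <;>
    · rintro (hx | hx)
      · have := h.inj _ _ (by omega) (by omega) hx; omega
      · rcases hn.lt_or_eq with hn | rfl
        · have := h.inj _ _ (by omega) (by omega) hx; omega
        · rw [mem_singleton_iff, h.closed] at hx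
          have := h.inj _ _ (by omega) (by omega) hx; omega

/-- The chord from `v 0` to `v m` meets the polygon only at its endpoints. -/
def IsDiagonal (k : ℕ) (v : ℕ → Plane) (m : ℕ) : Prop :=
  ∀ i < k, ∀ x ∈ segment ℝ (v i) (v (i + 1)), x ∈ segment ℝ (v 0) (v m) → x = v 0 ∨ x = v m

theorem cut_left (h : IsPolygon k v) {m : ℕ} (hm : 2 ≤ m) (hmk : m + 2 ≤ k)
    (hd : IsDiagonal k v m) : IsPolygon (m + 1) (fun i => if i ≤ m then v i else v 0) where
  closed := by simp
  inj i j hi hj hij := by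
    simp only [show i ≤ m by omega, show j ≤ m by omega, if_true] at hij
    exact h.inj i j (by omega) (by omega) hij
  meet i j hij hj x hx1 hx2 := by
    simp only [show i ≤ m by omega, show i + 1 ≤ m by omega, show j ≤ m by omega, if_true,
      Nat.zero_le] at hx1 hx2 ⊢
    by_cases hj' : j + 1 ≤ m
    · simp only [hj', if_true] at hx2
      rcases h.meet i j hij (by omega) x hx1 hx2 with h' | h'
      · exact Or.inl h'
      · omega
    · have hjm : j = m := by omega
      subst hjm
      simp only [hj', if_false] at hx2
      rw [segment_symm] at hx2
      rcases hd i (by omega) x hx1 hx2 with rfl | rfl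
      · rcases h.vertex_mem (by omega) (by omega) hx1 with h' | h'
        · have := h.inj _ _ (by omega) (by omega) h'
          exact Or.inr ⟨this.symm, rfl, rfl⟩
        · have := h.inj _ _ (by omega) (by omega) h'; omega
      · rcases h.vertex_mem (by omega) (by omega) hx1 with h' | h'
        · have := h.inj _ _ (by omega) (by omega) h'; omega
        · have := h.inj _ _ (by omega) (by omega) h'
          exact Or.inl ⟨this, rfl⟩

theorem chainEdges_cut_left (v : ℕ → Plane) (m : ℕ) :
    chainEdges (fun i => if i ≤ m then v i else v 0) (Iio (m + 1)) =
      insert (v m, v 0) (chainEdges v (Ico 0 m)) := by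
  ext e
  constructor
  · rintro ⟨i, hi, rfl⟩
    simp only [mem_Iio] at hi
    rcases Nat.lt_or_ge i m with hi' | hi'
    · right
      exact ⟨i, by simpa using hi', by simp [hi'.le, show i + 1 ≤ m by omega]⟩
    · left
      have : i = m := by omega
      subst this; simp
  · rintro (rfl | ⟨i, hi, rfl⟩)
    · exact ⟨m, by simp, by simp⟩
    · simp only [mem_Ico] at hi
      exact ⟨i, by simp; omega, by simp [hi.2.le, show i + 1 ≤ m by omega]⟩

theorem cut_right (h : IsPolygon k v) {m : ℕ} (hm : 2 ≤ m) (hmk : m + 2 ≤ k)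
    (hd : IsDiagonal k v m) :
    IsPolygon (k - m + 1) (fun i => if i ≤ k - m then v (m + i) else v m) where
  closed := by simp
  inj i j hi hj hij := by
    simp only [show i ≤ k - m by omega, show j ≤ k - m by omega, if_true] at hij
    obtain ⟨m, rfl⟩ : ∃ n, m = n + 1 := ⟨m - 1, by omega⟩
    have := h.inj_succ (i := m + i) (j := m + j) (by omega) (by omega)
      (by rw [← add_right_comm, hij, ← add_right_comm])
    omega
  meet i j hij hj x hx1 hx2 := by
    simp only [show i ≤ k - m by omega, show i + 1 ≤ k - m by omega, show j ≤ k - m by omega,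
      if_true, Nat.zero_le, add_zero] at hx1 hx2 ⊢
    by_cases hj' : j + 1 ≤ k - m
    · simp only [hj', if_true] at hx2
      rcases h.meet (m + i) (m + j) (by omega) (by omega) x hx1 hx2 with h' | h'
      · exact Or.inl ⟨by omega, h'.2⟩
      · omega
    · have hjm : m + j = k := by omega
      simp only [hj', if_false, hjm, h.closed] at hx2 ⊢
      rcases hd (m + i) (by omega) x hx1 hx2 with rfl | rfl
      · rcases h.vertex_mem (by omega) (by omega) hx1 with h' | h'
        · have := h.inj _ _ (by omega) (by omega) h'; omega
        · rw [← h.closed, show k = (k - 1) + 1 by omega] at h'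
          have := h.inj_succ (by omega) (by omega) h'
          exact Or.inl ⟨by omega, rfl⟩
      · rcases h.vertex_mem (by omega) (by omega) hx1 with h' | h'
        · have := h.inj _ _ (by omega) (by omega) h'
          exact Or.inr ⟨by omega, by omega, rfl⟩
        · rw [show m = (m - 1) + 1 by omega] at h'
          have := h.inj_succ (by omega) (by omega) h'; omega

theorem chainEdges_cut_right (h : IsPolygon k v) {m : ℕ} (hmk : m + 2 ≤ k) :
    chainEdges (fun i => if i ≤ k - m then v (m + i) else v m) (Iio (k - m + 1)) =
      insert (v 0, v m) (chainEdges v (Ico m k)) := by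
  ext e
  constructor
  · rintro ⟨i, hi, rfl⟩
    simp only [mem_Iio] at hi
    rcases Nat.lt_or_ge i (k - m) with hi' | hi'
    · right
      exact ⟨m + i, by simp; omega, by simp [hi'.le, show i + 1 ≤ k - m by omega, add_assoc]⟩
    · left
      have h1 : i = k - m := by omega
      have h2 : m + (k - m) = k := by omega
      subst h1; simp [h2, h.closed]
  · rintro (rfl | ⟨i, hi, rfl⟩)
    · have h2 : m + (k - m) = k := by omega
      exact ⟨k - m, by simp, by simp [h2, h.closed]⟩
    · simp only [mem_Ico] at hi
      refine ⟨i - m, by simp; omega, ?_⟩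
      have h1 : m + (i - m) = i := by omega
      have h2 : m + (i - m + 1) = i + 1 := by omega
      simp [h1, h2, show i - m + 1 ≤ k - m by omega, show i - m ≤ k - m by omega]

theorem isSplit (h : IsPolygon k v) {m : ℕ} (hm : 2 ≤ m) (hmk : m + 2 ≤ k)
    (hd : IsDiagonal k v m) {T₁ T₂ : Set (Fin 3 → Plane)}
    (h₁ : IsTriangulation (insert (v m, v 0) (chainEdges v (Ico 0 m))) T₁)
    (h₂ : IsTriangulation (insert (v 0, v m) (chainEdges v (Ico m k))) T₂)
    (o₁ : ∃ x ∈ edgeUnion (chainEdges v (Ico 0 m)), x ≠ v 0 ∧ x ≠ v m ∧ x ∉ triangleUnion T₂)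
    (o₂ : ∃ x ∈ edgeUnion (chainEdges v (Ico m k)), x ≠ v 0 ∧ x ≠ v m ∧ x ∉ triangleUnion T₁) :
    IsSplit (v 0) (v m) (chainEdges v (Ico 0 m)) (chainEdges v (Ico m k)) T₁ T₂ := by
  have hinter : ∀ x ∈ edgeUnion (chainEdges v (Ico 0 m)), x ∈ edgeUnion (chainEdges v (Ico m k)) →
      x = v 0 ∨ x = v m := by
    intro x hx1 hx2
    obtain ⟨i, hi, hxi⟩ := mem_edgeUnion_chainEdges.1 hx1
    obtain ⟨j, hj, hxj⟩ := mem_edgeUnion_chainEdges.1 hx2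
    simp only [mem_Ico] at hi hj
    rcases h.meet i j (by omega) (by omega) x hxi hxj with h' | h'
    · right; rw [h'.2]; congr 1; omega
    · exact Or.inl h'.2.2
  have hi₁ : ∀ x ∈ edgeUnion (chainEdges v (Ico 0 m)), x ∈ segment ℝ (v 0) (v m) →
      x = v 0 ∨ x = v m := by
    intro x hx1 hx2
    obtain ⟨i, hi, hxi⟩ := mem_edgeUnion_chainEdges.1 hx1
    simp only [mem_Ico] at hi
    exact hd i (by omega) x hxi hx2
  have hi₂ : ∀ x ∈ edgeUnion (chainEdges v (Ico m k)), x ∈ segment ℝ (v 0) (v m) →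
      x = v 0 ∨ x = v m := by
    intro x hx1 hx2
    obtain ⟨i, hi, hxi⟩ := mem_edgeUnion_chainEdges.1 hx1
    simp only [mem_Ico] at hi
    exact hd i (by omega) x hxi hx2
  have hend : ∀ j ≤ k, ∀ e ∈ chainEdges v (Ico 0 m) ∪ chainEdges v (Ico m k),
      v j ∈ segment ℝ e.1 e.2 → v j = e.1 ∨ v j = e.2 := by
    rintro j hj e (⟨i, hi, rfl⟩ | ⟨i, hi, rfl⟩) hx <;> simp only [mem_Ico] at hi <;>
      exact h.vertex_mem_le (by omega) hj hx
  have c₁ := h.isPreconnected_chain (by omega) (m := 0) (n := m) (by omega) (by omega)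
  have c₂ := h.isPreconnected_chain (by omega) (m := m) (n := k) le_rfl (by omega)
  rw [h.closed] at c₂
  have d₁ : Disjoint (edgeUnion (chainEdges v (Ico 0 m)) \ {v 0, v m})
      (edgeUnion (insert (v 0, v m) (chainEdges v (Ico m k)))) := by
    rw [disjoint_left]
    rintro x ⟨hx1, hx2⟩ hx3
    rcases (IsSplit.mem_edges₂ x).1 hx3 with hx | hx
    · exact hx2 (hi₁ x hx1 hx)
    · exact hx2 (hinter x hx1 hx)
  have d₂ : Disjoint (edgeUnion (chainEdges v (Ico m k)) \ {v m, v 0})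
      (edgeUnion (insert (v m, v 0) (chainEdges v (Ico 0 m)))) := by
    rw [disjoint_left]
    rintro x ⟨hx1, hx2⟩ hx3
    rcases (IsSplit.mem_edges₁ x).1 hx3 with hx | hx
    · exact hx2 (hi₂ x hx1 hx).symm
    · exact hx2 (hinter x hx hx1).symm
  refine ⟨fun he => ?_, h₁, h₂, hi₁, hi₂, hinter, ?_, ?_, ?_, ?_, hend 0 (by omega),
    hend m (by omega), ?_, ?_, ?_, ?_, ?_, ?_⟩
  · have := h.inj _ _ (by omega) (by omega) he; omega
  · exact mem_edgeUnion_chainEdges.2 ⟨0, by simp; omega, left_mem_segment ℝ _ _⟩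
  · refine mem_edgeUnion_chainEdges.2 ⟨k - 1, by simp; omega, ?_⟩
    rw [show k - 1 + 1 = k by omega, h.closed]
    exact right_mem_segment ℝ _ _
  · refine mem_edgeUnion_chainEdges.2 ⟨m - 1, by simp; omega, ?_⟩
    rw [show m - 1 + 1 = m by omega]
    exact right_mem_segment ℝ _ _
  · exact mem_edgeUnion_chainEdges.2 ⟨m, by simp; omega, left_mem_segment ℝ _ _⟩
  · exact ⟨_, Or.inl ⟨0, by simp; omega, rfl⟩, rfl⟩
  · exact ⟨_, Or.inr ⟨m, by simp; omega, rfl⟩, rfl⟩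
  · intro x hx hx0 hxm hxT
    obtain ⟨y, hy, hy0, hym, hyT⟩ := o₁
    have hy' : y ∈ edgeUnion (chainEdges v (Ico 0 m)) \ {v 0, v m} := ⟨hy, by simp [hy0, hym]⟩
    have hx' : x ∈ edgeUnion (chainEdges v (Ico 0 m)) \ {v 0, v m} := ⟨hx, by simp [hx0, hxm]⟩
    rcases h₂.subset_or_disjoint c₁ d₁ with h' | h'
    · exact hyT (h' hy').1
    · exact disjoint_left.1 h' hx' hxT
  · intro x hx hx0 hxm hxT
    obtain ⟨y, hy, hy0, hym, hyT⟩ := o₂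
    have hy' : y ∈ edgeUnion (chainEdges v (Ico m k)) \ {v m, v 0} := ⟨hy, by simp [hy0, hym]⟩
    have hx' : x ∈ edgeUnion (chainEdges v (Ico m k)) \ {v m, v 0} := ⟨hx, by simp [hx0, hxm]⟩
    rcases h₁.subset_or_disjoint c₂ d₂ with h' | h'
    · exact hyT (h' hy').1
    · exact disjoint_left.1 h' hx' hxT
  · obtain ⟨y, hy, hy0, hym, -⟩ := o₁; exact ⟨y, hy, hy0, hym⟩
  · obtain ⟨y, hy, hy0, hym, -⟩ := o₂; exact ⟨y, hy, hy0, hym⟩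

theorem chainEdges_split (v : ℕ → Plane) {m : ℕ} (hmk : m ≤ k) :
    chainEdges v (Ico 0 m) ∪ chainEdges v (Ico m k) = chainEdges v (Iio k) := by
  rw [chainEdges, chainEdges, ← image_union, Ico_union_Ico_eq_Ico (Nat.zero_le _) hmk]
  congr 1
  ext; simp

end IsPolygon

/-- The affine function vanishing on the line through `b` perpendicular to `b`. -/
theorem exists_affine_supporting (b : Plane) : ∃ f : Plane →ᵃ[ℝ] ℝ,
    ∀ x, f x = b 0 * (b 0 - x 0) + b 1 * (b 1 - x 1) := by
  refine ⟨AffineMap.const ℝ Plane (b 0 * b 0 + b 1 * b 1) -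
    (b 0 • (LinearMap.proj 0 : Plane →ₗ[ℝ] ℝ) + b 1 • LinearMap.proj 1).toAffineMap, fun x => ?_⟩
  simp
  ring

theorem triangleUnion_subset {E : Set (Plane × Plane)} {T : Set (Fin 3 → Plane)}
    (h : IsTriangulation E T) {S : Set Plane} (hS : Convex ℝ S) (hE : ∀ e ∈ E, e.1 ∈ S) :
    triangleUnion T ⊆ S := by
  refine iUnion₂_subset fun t ht => convexHull_min ?_ hS
  rintro _ ⟨i, rfl⟩
  obtain ⟨e, he, hi⟩ := h.vertex t ht i
  rw [hi]; exact hE e he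

theorem IsPolygon.exists_rotate_extremal {k : ℕ} {v : ℕ → Plane} (h : IsPolygon k v) (hk : 2 ≤ k) :
    ∃ w, IsPolygon k w ∧ chainEdges w (Iio k) = chainEdges v (Iio k) ∧
      ∃ f : Plane →ᵃ[ℝ] ℝ, f (w 1) = 0 ∧ ∀ i < k, i ≠ 1 → 0 < f (w i) := by
  obtain ⟨j, hj, hmax⟩ := Finset.exists_max_image (Finset.range k)
    (fun j => v (j + 1) 0 ^ 2 + v (j + 1) 1 ^ 2) ⟨0, by simp; omega⟩
  rw [Finset.mem_range] at hj
  obtain ⟨w, hw, hE, h1⟩ := h.exists_rotate hk j hj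
  obtain ⟨f, hf⟩ := exists_affine_supporting (w 1)
  refine ⟨w, hw, hE, f, by rw [hf]; ring, fun i hi hi1 => ?_⟩
  have hne : w i ≠ w 1 := fun he => hi1 (hw.inj _ _ hi (by omega) he)
  have hle : w i 0 ^ 2 + w i 1 ^ 2 ≤ w 1 0 ^ 2 + w 1 1 ^ 2 := by
    have hmem : (w i, w (i + 1)) ∈ chainEdges v (Iio k) := hE ▸ ⟨i, hi, rfl⟩
    obtain ⟨n, hn, hn'⟩ := hmem
    simp only [mem_Iio, Prod.mk.injEq] at hn hn'
    rw [h1, ← hn'.1]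
    rcases n with _ | n
    · have := hmax (k - 1) (by simp; omega)
      simpa [show k - 1 + 1 = k by omega, h.closed] using this
    · exact hmax n (by simp; omega)
  rw [hf]
  by_contra! hc
  apply hne
  have key : (w 1 0 - w i 0) ^ 2 + (w 1 1 - w i 1) ^ 2 ≤ 0 := by nlinarith
  ext n
  fin_cases n
  · have : w 1 0 - w i 0 = 0 := by nlinarith [sq_nonneg (w 1 0 - w i 0), sq_nonneg (w 1 1 - w i 1)]
    simp; linarith
  · have : w 1 1 - w i 1 = 0 := by nlinarith [sq_nonneg (w 1 0 - w i 0), sq_nonneg (w 1 1 - w i 1)]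
    simp; linarith

/-- Two points of a line through `b` lying on the same side of `b` are nested. -/
theorem affineIndependent_of_supporting {a b c : Plane} (f : Plane →ᵃ[ℝ] ℝ) (fa : 0 < f a)
    (fb : f b = 0) (fc : 0 < f c) (h₁ : a ∉ segment ℝ b c) (h₂ : c ∉ segment ℝ a b) :
    AffineIndependent ℝ ![a, b, c] := by
  rw [affineIndependent_iff_not_collinear_set, collinear_iff_of_mem (p₀ := b) (by simp)]
  rintro ⟨d, hd⟩
  obtain ⟨r, hr⟩ := hd a (by simp)
  obtain ⟨s, hs⟩ := hd c (by simp)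
  have hfd : ∀ r : ℝ, f (r • d +ᵥ b) = r * f.linear d := by
    intro r; rw [f.map_vadd, fb]; simp
  rw [hr, hfd] at fa
  rw [hs, hfd] at fc
  simp only [vadd_eq_add] at hr hs
  have aux : ∀ r s : ℝ, 0 < r * f.linear d → r * f.linear d ≤ s * f.linear d →
      r • d + b ∈ segment ℝ b (s • d + b) := by
    intro r s h0 h1
    have h2 : 0 < s * f.linear d := h0.trans_le h1
    have hs0 : s ≠ 0 := by rintro rfl; simp at h2
    have hd0 : f.linear d ≠ 0 := by intro h; simp [h] at h2
    have e : r / s = (r * f.linear d) / (s * f.linear d) := by field_simp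
    rw [segment_eq_image']
    refine ⟨r / s, ⟨by rw [e]; positivity, by rw [e]; exact (div_le_one h2).2 h1⟩, ?_⟩
    simp only [add_sub_cancel_right, smul_smul, div_mul_cancel₀ _ hs0]
    abel
  rcases le_total (r * f.linear d) (s * f.linear d) with h | h
  · apply h₁; rw [hr, hs]; exact aux r s fa h
  · apply h₂; rw [segment_symm, hr, hs]; exact aux s r fc h

namespace Bary

variable {a b c : Plane}

/-- A segment leaving the triangle upwards crosses one of the sides at `b`. -/
theorem exists_mem_sides (B : Bary a b c) {p u : Plane} (pα : 0 < B.α p) (pγ : 0 < B.γ p)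
    (pβ : 0 ≤ B.β p) (uβ : 0 < B.β u) (hu : u ∉ convexHull ℝ {a, b, c}) :
    ∃ q ∈ segment ℝ p u, 0 < B.β q ∧ (q ∈ segment ℝ a b ∨ q ∈ segment ℝ b c) := by
  let g : ℝ → ℝ := fun t => min (B.α (p + t • (u - p))) (B.γ (p + t • (u - p)))
  have hg : Continuous g := by
    have h1 : Continuous fun t : ℝ => p + t • (u - p) := by fun_prop
    exact ((affineMap_continuous B.α).comp h1).min ((affineMap_continuous B.γ).comp h1)
  have hu' : min (B.α u) (B.γ u) < 0 := by
    by_contra! hc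
    rw [le_min_iff] at hc
    exact hu (B.mem_convexHull.2 ⟨hc.1, uβ.le, hc.2⟩)
  have h0 : (0 : ℝ) ∈ Icc (g 1) (g 0) := by
    constructor
    · simpa [g] using hu'.le
    · simp [g, pα.le, pγ.le]
  obtain ⟨t, ht, hgt⟩ := intermediate_value_Icc' zero_le_one hg.continuousOn h0
  have ht0 : t ≠ 0 := by
    rintro rfl
    have : 0 < g 0 := by simp [g, pα, pγ]
    linarith
  have ht0 : 0 < t := lt_of_le_of_ne ht.1 ht0.symm
  have hβ : ∀ f : Plane →ᵃ[ℝ] ℝ, f (p + t • (u - p)) = (1 - t) * f p + t * f u := by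
    intro f
    have : p + t • (u - p) = (1 - t) • p + t • u := by module
    rw [this, affineMap_combo f (by ring)]
  have hq : 0 < B.β (p + t • (u - p)) := by
    rw [hβ]
    have := mul_pos ht0 uβ
    have := mul_nonneg (sub_nonneg.2 ht.2) pβ
    linarith
  refine ⟨p + t • (u - p), ?_, hq, ?_⟩
  · rw [segment_eq_image']; exact ⟨t, ht, rfl⟩
  · rcases min_choice (B.α (p + t • (u - p))) (B.γ (p + t • (u - p))) with h | h
    · right
      have e : B.α (p + t • (u - p)) = 0 := h ▸ hgt
      refine B.mem_segment_right.2 ⟨e, hq.le, ?_⟩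
      rw [← hgt]; exact min_le_right _ _
    · left
      have e : B.γ (p + t • (u - p)) = 0 := h ▸ hgt
      refine B.mem_segment_left.2 ⟨e, ?_, hq.le⟩
      rw [← hgt]; exact min_le_left _ _

theorem ext_of_eq (B : Bary a b c) {x y : Plane} (h₁ : B.α x = B.α y) (h₂ : B.β x = B.β y) :
    x = y := by
  have h₃ : B.γ x = B.γ y := by linarith [B.sum x, B.sum y]
  rw [← B.comb x, ← B.comb y, h₁, h₂, h₃]

end Bary

/-- If the edges near `b` run along the chord from `b` to `z` and along the side `[b, c]`, then the
triangulated region does not reach the side `[b, a]` on the other side of the chord. -/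
theorem IsTriangulation.exists_mem_openSegment_notMem {E : Set (Plane × Plane)}
    {T : Set (Fin 3 → Plane)} (h : IsTriangulation E T) {a b c z : Plane} (B : Bary a b c)
    (zα : 0 < B.α z) (zγ : 0 < B.γ z) (f : Plane →ᵃ[ℝ] ℝ) (fb : f b = 0) (fz : 0 < f z)
    (hf : ∀ e ∈ E, 0 ≤ f e.1) {F : Set Plane} (hF : IsClosed F) (hb : b ∉ F)
    (hE : edgeUnion E ⊆ segment ℝ b z ∪ (segment ℝ b c ∪ F)) :
    ∃ x ∈ openSegment ℝ b a, x ∉ triangleUnion T := by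
  let g : Plane →ᵃ[ℝ] ℝ := B.γ z • B.α - B.α z • B.γ
  have hg : ∀ x, g x = B.γ z * B.α x - B.α z * B.γ x := fun x => by simp [g]
  have gb : g b = 0 := by simp [hg, B.α_b, B.γ_b]
  have gz : g z = 0 := by simp [hg]; ring
  have ga : 0 < g a := by simp [hg, B.α_a, B.γ_a, zγ]
  have gc : g c < 0 := by simp [hg, B.α_c, B.γ_c, zα]
  obtain ⟨r, hr, hN⟩ := Metric.isOpen_iff.1 hF.isOpen_compl b hb
  have hH : Convex ℝ (Metric.ball b r ∩ {x | 0 < g x}) :=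
    (convex_ball _ _).inter (convex_affine_gt _ _)
  have hHE : Disjoint (Metric.ball b r ∩ {x | 0 < g x}) (edgeUnion E) := by
    rw [disjoint_left]
    rintro x ⟨hxN, hx⟩ hxE
    simp only [mem_ofPred_eq] at hx
    rcases hE hxE with hx' | hx' | hx'
    · obtain ⟨s, t, hs, ht, hst, rfl⟩ := hx'
      rw [affineMap_combo _ hst, gb, gz] at hx
      simp at hx
    · obtain ⟨s, t, hs, ht, hst, rfl⟩ := hx'
      rw [affineMap_combo _ hst, gb] at hx
      nlinarith
    · exact hN hxN hx'
  set q := b + ((f a + 1) / f z) • (z - b) with hq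
  obtain ⟨δ, hδ, hδN⟩ := exists_pos_add_smul_mem Metric.isOpen_ball (Metric.mem_ball_self hr)
    (a - q)
  obtain ⟨ε, hε, hεN⟩ := exists_pos_add_smul_mem Metric.isOpen_ball (Metric.mem_ball_self hr)
    (a - b)
  have hy := hδN δ hδ.le le_rfl
  have gy : 0 < g (b + δ • (a - q)) := by
    rw [affineMap_add_smul_sub, hq, affineMap_add_smul_sub, gb, gz]
    simpa using mul_pos hδ ga
  have fy : f (b + δ • (a - q)) < 0 := by
    rw [affineMap_add_smul_sub, hq, affineMap_add_smul_sub, fb]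
    rw [sub_zero, div_mul_cancel₀ _ fz.ne']
    linarith
  have hyT : b + δ • (a - q) ∉ triangleUnion T := fun hy' =>
    absurd (triangleUnion_subset h (convex_affine_ge f 0) hf hy') (by simpa using fy)
  have hdisj : Disjoint (Metric.ball b r ∩ {x | 0 < g x}) (triangleUnion T) := by
    rcases h.subset_or_disjoint hH.isPreconnected hHE with h' | h'
    · exact (hyT (h' ⟨hy, gy⟩).1).elim
    · exact h'
  have hε0 : 0 < min ε (1 / 2) := lt_min hε (by norm_num)
  refine ⟨b + min ε (1 / 2) • (a - b), ?_, fun hx => disjoint_left.1 hdisj ⟨?_, ?_⟩ hx⟩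
  · rw [openSegment_eq_image']
    exact ⟨_, ⟨hε0, (min_le_right _ _).trans_lt (by norm_num)⟩, rfl⟩
  · exact hεN _ hε0.le (min_le_left _ _)
  · simp only [mem_ofPred_eq]
    rw [affineMap_add_smul_sub, gb]
    have := mul_pos hε0 ga
    linarith

theorem Bary.mem_segment_of_le {a b c : Plane} (B : Bary a b c) {u w y : Plane} (hu : B.β u = 0)
    (hw : B.β w = 0) (hy : B.β y = 0) (h₁ : B.α u ≤ B.α y) (h₂ : B.α y ≤ B.α w) :
    y ∈ segment ℝ u w := by
  obtain ⟨s, t, hs, ht, hst, hα⟩ : B.α y ∈ segment ℝ (B.α u) (B.α w) := by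
    rw [segment_eq_Icc (h₁.trans h₂)]; exact ⟨h₁, h₂⟩
  refine ⟨s, t, hs, ht, hst, B.ext_of_eq ?_ ?_⟩
  · rw [affineMap_combo _ hst]; exact hα
  · rw [affineMap_combo _ hst, hu, hw, hy]; ring

namespace IsPolygon

variable {k : ℕ} {v : ℕ → Plane}

theorem two_le_of_mem (B : Bary (v 0) (v 1) (v 2)) {i : ℕ} {p : Plane}
    (hp : p ∈ segment ℝ (v i) (v (i + 1))) (pα : 0 < B.α p) (pγ : 0 < B.γ p) : 2 ≤ i := by
  by_contra! hi
  interval_cases i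
  · exact pγ.ne' (B.mem_segment_left.1 hp).1
  · exact pα.ne' (B.mem_segment_right.1 hp).1

theorem mem_convexHull_of_mem (h : IsPolygon k v) (B : Bary (v 0) (v 1) (v 2)) {i : ℕ}
    (hi : i < k) {p u : Plane} (hp : p ∈ segment ℝ (v i) (v (i + 1)))
    (hu : u ∈ segment ℝ (v i) (v (i + 1))) (pα : 0 < B.α p) (pγ : 0 < B.γ p) (pβ : 0 ≤ B.β p)
    (uβ : 0 < B.β u) : u ∈ convexHull ℝ {v 0, v 1, v 2} := by
  have hi2 := two_le_of_mem B hp pα pγ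
  by_contra hn
  obtain ⟨q, hq, qβ, hq'⟩ := B.exists_mem_sides pα pγ pβ uβ hn
  have hqi := (convex_segment (𝕜 := ℝ) (v i) (v (i + 1))).segment_subset hp hu hq
  rcases hq' with hq' | hq'
  · rcases h.meet 0 i (by omega) hi q hq' hqi with h' | h'
    · omega
    · rw [h'.2.2, B.β_a] at qβ; exact lt_irrefl _ qβ
  · rcases h.meet 1 i (by omega) hi q hq' hqi with h' | h'
    · obtain ⟨rfl, rfl⟩ := h'
      rw [B.β_c] at qβ; exact lt_irrefl _ qβ
    · omega

/-- An edge crossing the triangle at the first three vertices has an endpoint in the triangle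
that lies at least as far from the line through the first and third vertex. -/
theorem exists_vertex_of_mem (h : IsPolygon k v) (B : Bary (v 0) (v 1) (v 2)) {i : ℕ}
    (hi : i < k) {p : Plane} (hp : p ∈ segment ℝ (v i) (v (i + 1))) (pα : 0 < B.α p)
    (pγ : 0 < B.γ p) (pβ : 0 < B.β p) :
    ∃ j, 3 ≤ j ∧ j < k ∧ v j ∈ convexHull ℝ {v 0, v 1, v 2} ∧ B.β p ≤ B.β (v j) := by
  have hi2 := two_le_of_mem B hp pα pγ
  have hmax : B.β p ≤ B.β (v i) ∨ B.β p ≤ B.β (v (i + 1)) := by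
    by_contra! hc
    have := (convex_affine_lt B.β (B.β p)).segment_subset hc.1 hc.2 hp
    simp at this
  rcases hmax with hm | hm
  · refine ⟨i, ?_, hi, ?_, hm⟩
    · by_contra! hc
      obtain rfl : i = 2 := by omega
      rw [B.β_c] at hm; linarith
    · exact h.mem_convexHull_of_mem B hi hp (left_mem_segment ℝ _ _) pα pγ pβ.le (by linarith)
  · refine ⟨i + 1, by omega, ?_, ?_, hm⟩
    · by_contra! hc
      rw [show i + 1 = k by omega, h.closed, B.β_a] at hm; linarith
    · exact h.mem_convexHull_of_mem B hi hp (right_mem_segment ℝ _ _) pα pγ pβ.le (by linarith)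

theorem pos_of_mem_convexHull (h : IsPolygon k v) (B : Bary (v 0) (v 1) (v 2)) {m : ℕ}
    (hm : 3 ≤ m) (hmk : m < k) (hz : v m ∈ convexHull ℝ {v 0, v 1, v 2}) :
    0 < B.α (v m) ∧ 0 < B.γ (v m) := by
  obtain ⟨h1, h2, h3⟩ := B.mem_convexHull.1 hz
  constructor
  · refine lt_of_le_of_ne h1 fun h0 => ?_
    rcases h.vertex_mem (i := 1) (by omega) hmk (B.mem_segment_right.2 ⟨h0.symm, h2, h3⟩) with
      h' | h' <;> have := h.inj _ _ hmk (by omega) h' <;> omega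
  · refine lt_of_le_of_ne h3 fun h0 => ?_
    rcases h.vertex_mem (i := 0) (by omega) hmk (B.mem_segment_left.2 ⟨h0.symm, h1, h2⟩) with
      h' | h' <;> have := h.inj _ _ hmk (by omega) h' <;> omega

theorem eq_or_eq_of_mem_chord (h : IsPolygon k v) (B : Bary (v 0) (v 1) (v 2)) {m : ℕ}
    (hm : 3 ≤ m) (hmk : m < k) (hz : v m ∈ convexHull ℝ {v 0, v 1, v 2})
    (hmax : ∀ j, 3 ≤ j → j < k → v j ∈ convexHull ℝ {v 0, v 1, v 2} → B.β (v j) ≤ B.β (v m))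
    {i : ℕ} (hi : i < k) {x : Plane} (hx : x ∈ segment ℝ (v i) (v (i + 1)))
    (hx' : x ∈ segment ℝ (v 1) (v m)) : x = v 1 ∨ x = v m := by
  obtain ⟨zα, zγ⟩ := h.pos_of_mem_convexHull B hm hmk hz
  have zβ := (B.mem_convexHull.1 hz).2.1
  have hsum := B.sum (v m)
  by_contra! hc
  obtain ⟨s, t, hs, ht, hst, rfl⟩ := hx'
  have hs0 : 0 < s := by
    refine lt_of_le_of_ne hs fun h0 => hc.2 ?_
    rw [← h0, show t = 1 by linarith]; simp
  have ht0 : 0 < t := by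
    refine lt_of_le_of_ne ht fun h0 => hc.1 ?_
    rw [← h0, show s = 1 by linarith]; simp
  have hβ : B.β (v m) < B.β (s • v 1 + t • v m) := by
    rw [affineMap_combo _ hst, B.β_b]
    have : s * B.β (v m) < s * 1 := mul_lt_mul_of_pos_left (by linarith) hs0
    have : t * B.β (v m) = B.β (v m) - s * B.β (v m) := by
      rw [show t = 1 - s by linarith]; ring
    linarith
  obtain ⟨j, hj3, hjk, hj, hjβ⟩ := h.exists_vertex_of_mem B hi hx
    (by rw [affineMap_combo _ hst, B.α_b]; simpa using mul_pos ht0 zα)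
    (by rw [affineMap_combo _ hst, B.γ_b]; simpa using mul_pos ht0 zγ) (zβ.trans_lt hβ)
  have := hmax j hj3 hjk hj
  linarith

theorem isDiagonal_two (h : IsPolygon k v) (hk : 4 ≤ k) (B : Bary (v 0) (v 1) (v 2))
    (hno : ∀ j, 3 ≤ j → j < k → v j ∉ convexHull ℝ {v 0, v 1, v 2}) : IsDiagonal k v 2 := by
  intro i hi x hx hx'
  by_contra! hc
  obtain ⟨xβ, xα, xγ⟩ := B.mem_segment.1 hx'
  have hsum := B.sum x
  have xα : 0 < B.α x := by
    refine lt_of_le_of_ne xα fun h0 => hc.2 (B.ext_of_eq ?_ ?_)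
    · rw [B.α_c, h0]
    · rw [B.β_c, xβ]
  have xγ : 0 < B.γ x := by
    refine lt_of_le_of_ne xγ fun h0 => hc.1 (B.ext_of_eq ?_ ?_)
    · rw [B.α_a]; linarith
    · rw [B.β_a, xβ]
  have hi2 := two_le_of_mem B hx xα xγ
  have h1 : B.β (v i) ≤ 0 := by
    by_contra! hβ
    have := h.mem_convexHull_of_mem B hi hx (left_mem_segment ℝ _ _) xα xγ xβ.ge hβ
    rcases hi2.lt_or_eq with h' | rfl
    · exact hno i h' hi this
    · rw [B.β_c] at hβ; exact lt_irrefl _ hβ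
  have h2 : B.β (v (i + 1)) ≤ 0 := by
    by_contra! hβ
    have := h.mem_convexHull_of_mem B hi hx (right_mem_segment ℝ _ _) xα xγ xβ.ge hβ
    by_cases h' : i + 1 < k
    · exact hno _ (by omega) h' this
    · rw [show i + 1 = k by omega, h.closed, B.β_a] at hβ; exact lt_irrefl _ hβ
  have hout : ∀ j, 2 ≤ j → j ≤ k → B.β (v j) = 0 → B.α (v j) ≤ 0 ∨ B.γ (v j) ≤ 0 := by
    intro j hj hjk hβ
    rcases hj.lt_or_eq with hj | rfl
    · rcases hjk.lt_or_eq with hjk | rfl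
      · by_contra! hc
        exact hno j hj hjk (B.mem_convexHull.2 ⟨hc.1.le, hβ.ge, hc.2.le⟩)
      · rw [h.closed, B.γ_a]; simp
    · rw [B.α_c]; simp
  have h0i : v 0 ∈ segment ℝ (v i) (v (i + 1)) ∧ v 2 ∈ segment ℝ (v i) (v (i + 1)) := by
    obtain ⟨s, t, hs, ht, hst, hxe⟩ := id hx
    have eα := affineMap_combo B.α (x := v i) (y := v (i + 1)) hst
    have eβ := affineMap_combo B.β (x := v i) (y := v (i + 1)) hst
    have eγ := affineMap_combo B.γ (x := v i) (y := v (i + 1)) hst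
    rw [hxe] at eα eβ eγ
    have hs0 : 0 < s := by
      refine lt_of_le_of_ne hs fun h0 => ?_
      obtain rfl : t = 1 := by linarith
      subst h0
      simp only [one_mul, zero_mul, zero_add] at eα eβ eγ
      rcases hout (i + 1) (by omega) hi (by linarith) with h' | h' <;> linarith
    have ht0 : 0 < t := by
      refine lt_of_le_of_ne ht fun h0 => ?_
      obtain rfl : s = 1 := by linarith
      subst h0
      simp only [one_mul, zero_mul, add_zero] at eα eβ eγ
      rcases hout i hi2 hi.le (by linarith) with h' | h' <;> linarith
    have z1 : B.β (v i) = 0 := by nlinarith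
    have z2 : B.β (v (i + 1)) = 0 := by nlinarith
    have s1 := B.sum (v i)
    have s2 := B.sum (v (i + 1))
    have ha := B.α_a
    have hc := B.α_c
    rcases hout i hi2 hi.le z1 with h3 | h3 <;> rcases hout (i + 1) (by omega) hi z2 with h4 | h4
    · nlinarith
    · exact ⟨B.mem_segment_of_le z1 z2 B.β_a (by linarith) (by linarith),
        B.mem_segment_of_le z1 z2 B.β_c (by linarith) (by linarith)⟩
    · rw [segment_symm]
      exact ⟨B.mem_segment_of_le z2 z1 B.β_a (by linarith) (by linarith),
        B.mem_segment_of_le z2 z1 B.β_c (by linarith) (by linarith)⟩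
    · nlinarith
  have i2 : i = 2 := by
    rcases h.vertex_mem hi (by omega) h0i.2 with h' | h'
    · exact (h.inj _ _ (by omega) hi h').symm
    · have := h.inj_succ (i := 1) (by omega) hi h'; omega
  subst i2
  rcases h.vertex_mem hi (by omega) h0i.1 with h' | h' <;>
    have := h.inj _ _ (by omega) (by omega) h' <;> omega

theorem exists_isTriangulation_of_isDiagonal
    (ih : ∀ n < k, ∀ w : ℕ → Plane, IsPolygon n w → 3 ≤ n →
      ∃ T, IsTriangulation (chainEdges w (Iio n)) T)
    (h : IsPolygon k v) {m : ℕ} (hm : 2 ≤ m) (hmk : m + 2 ≤ k) (hd : IsDiagonal k v m)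
    (o₁ : ∀ T, IsTriangulation (insert (v 0, v m) (chainEdges v (Ico m k))) T →
      ∃ x ∈ edgeUnion (chainEdges v (Ico 0 m)), x ≠ v 0 ∧ x ≠ v m ∧ x ∉ triangleUnion T)
    (o₂ : ∀ T, IsTriangulation (insert (v m, v 0) (chainEdges v (Ico 0 m))) T →
      ∃ x ∈ edgeUnion (chainEdges v (Ico m k)), x ≠ v 0 ∧ x ≠ v m ∧ x ∉ triangleUnion T) :
    ∃ T, IsTriangulation (chainEdges v (Iio k)) T := by
  obtain ⟨T₁, h₁⟩ := ih _ (by omega) _ (h.cut_left hm hmk hd) (by omega)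
  obtain ⟨T₂, h₂⟩ := ih _ (by omega) _ (h.cut_right hm hmk hd) (by omega)
  rw [chainEdges_cut_left] at h₁
  rw [h.chainEdges_cut_right hmk] at h₂
  refine ⟨T₁ ∪ T₂, ?_⟩
  rw [← chainEdges_split v (show m ≤ k by omega)]
  exact (h.isSplit hm hmk hd h₁ h₂ (o₁ T₂ h₂) (o₂ T₁ h₁)).isTriangulation

theorem isClosed_chain (v : ℕ → Plane) {s : Set ℕ} (hs : s.Finite) :
    IsClosed (edgeUnion (chainEdges v s)) :=
  isClosed_edgeUnion (hs.image _)

theorem exists_isTriangulation (k : ℕ) : ∀ v : ℕ → Plane, IsPolygon k v → 3 ≤ k →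
    ∃ T, IsTriangulation (chainEdges v (Iio k)) T := by
  induction k using Nat.strong_induction_on with
  | _ k ih =>
  intro v₀ h₀ hk
  obtain ⟨v, h, hE, f, f1, fpos⟩ := h₀.exists_rotate_extremal (by omega)
  rw [← hE]
  have f0 : ∀ i ≤ k, 0 ≤ f (v i) := by
    intro i hi
    rcases eq_or_ne i 1 with rfl | hi1
    · exact f1.ge
    · rcases hi.lt_or_eq with hi | rfl
      · exact (fpos i hi hi1).le
      · rw [h.closed]; exact (fpos 0 (by omega) (by omega)).le
  have hind : AffineIndependent ℝ ![v 0, v 1, v 2] := by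
    refine affineIndependent_of_supporting f (fpos 0 (by omega) (by omega)) f1
      (fpos 2 (by omega) (by omega)) (fun hx => ?_) (fun hx => ?_)
    · rcases h.vertex_mem (i := 1) (by omega) (by omega) hx with h' | h' <;>
        have := h.inj _ _ (by omega) (by omega) h' <;> omega
    · rcases h.vertex_mem (i := 0) (by omega) (by omega) hx with h' | h' <;>
        have := h.inj _ _ (by omega) (by omega) h' <;> omega
  rcases hk.lt_or_eq with hk4 | rfl
  swap
  · refine ⟨{![v 0, v 1, v 2]}, ?_⟩
    have : chainEdges v (Iio 3) = {(v 0, v 1), (v 1, v 2), (v 2, v 0)} := by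
      have hI : Iio 3 = ({0, 1, 2} : Set ℕ) := by ext i; simp; omega
      have h3 := h.closed
      simp [chainEdges, hI, image_insert_eq, h3]
    rw [this]
    exact isTriangulation_triangle hind
  obtain ⟨B⟩ := nonempty_bary hind
  by_cases hno : ∃ j, (3 ≤ j ∧ j < k) ∧ v j ∈ convexHull ℝ {v 0, v 1, v 2}
  · have hfin : {j | (3 ≤ j ∧ j < k) ∧ v j ∈ convexHull ℝ {v 0, v 1, v 2}}.Finite :=
      (finite_Iio k).subset fun j hj => hj.1.2
    obtain ⟨m, ⟨⟨hm, hmk⟩, hz⟩, hmax⟩ := exists_max_image _ (fun j => B.β (v j)) hfin hno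
    have hmax : ∀ j, 3 ≤ j → j < k → v j ∈ convexHull ℝ {v 0, v 1, v 2} →
        B.β (v j) ≤ B.β (v m) := fun j h1 h2 h3 => hmax j ⟨⟨h1, h2⟩, h3⟩
    obtain ⟨zα, zγ⟩ := h.pos_of_mem_convexHull B hm hmk hz
    have hdiag := fun i hi x => h.eq_or_eq_of_mem_chord B hm hmk hz hmax (i := i) hi (x := x)
    have fz := fpos m hmk (by omega)
    have hR := h.rotate (by omega)
    rw [← h.chainEdges_rotate (by omega)]
    have hw : ∀ i < k, (fun i => if i < k then v (i + 1) else v 1) i = v (i + 1) := by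
      intro i hi; simp [hi]
    have hwk : (fun i => if i < k then v (i + 1) else v 1) k = v 1 := by simp
    have hRE := h.chainEdges_rotate (by omega)
    generalize (fun i => if i < k then v (i + 1) else v 1) = w at hR hw hwk hRE
    have w0 := hw 0 (by omega)
    have w1 := hw 1 (by omega)
    have wm := hw (m - 1) (by omega)
    have wk := hw (k - 1) (by omega)
    rw [show m - 1 + 1 = m by omega] at wm
    rw [show k - 1 + 1 = k by omega, h.closed] at wk
    simp only [zero_add, Nat.reduceAdd] at w0 w1
    have fw : ∀ i < k, 0 ≤ f (w i) := fun i hi => by rw [hw i hi]; exact f0 _ (by omega)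
    have hd : IsDiagonal k w (m - 1) := by
      intro i hi x hx hx'
      rw [w0, wm] at hx' ⊢
      have : x ∈ edgeUnion (chainEdges v (Iio k)) := by
        rw [← hRE]; exact mem_edgeUnion_chainEdges.2 ⟨i, hi, hx⟩
      obtain ⟨j, hj, hxj⟩ := mem_edgeUnion_chainEdges.1 this
      exact hdiag j hj x hxj hx'
    have hb : ∀ i, 1 ≤ i → i + 1 < k → w 0 ∉ segment ℝ (w i) (w (i + 1)) := by
      intro i h1 h2 hx
      rcases hR.vertex_mem (by omega) (by omega) hx with h' | h' <;>
        have := hR.inj _ _ (by omega) (by omega) h' <;> omega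
    refine exists_isTriangulation_of_isDiagonal ih hR (by omega) (by omega) hd ?_ ?_
    · intro T hT
      obtain ⟨x, hx, hxT⟩ : ∃ x ∈ openSegment ℝ (v 1) (v 2), x ∉ triangleUnion T := by
        refine hT.exists_mem_openSegment_notMem B.swap zγ zα f f1 fz ?_
            (isClosed_chain w (finite_Ico (m - 1) (k - 1))) ?_ ?_
        · rintro e (rfl | ⟨i, hi, rfl⟩)
          · exact fw 0 (by omega)
          · exact fw i hi.2
        · intro hx
          obtain ⟨i, hi, hx⟩ := mem_edgeUnion_chainEdges.1 hx
          simp only [mem_Ico] at hi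
          rw [← w0] at hx
          exact hb i (by omega) (by omega) hx
        · rw [edgeUnion_insert]
          rintro x (hx | hx)
          · left; simpa [w0, wm] using hx
          · right
            obtain ⟨i, hi, hx⟩ := mem_edgeUnion_chainEdges.1 hx
            simp only [mem_Ico] at hi
            by_cases hik : i + 1 = k
            · left
              rw [hik, hwk, show i = k - 1 by omega, wk, segment_symm] at hx
              exact hx
            · right
              exact mem_edgeUnion_chainEdges.2 ⟨i, by simp; omega, hx⟩
      refine ⟨x, ?_, ?_, ?_, hxT⟩
      · refine mem_edgeUnion_chainEdges.2 ⟨0, by simp; omega, ?_⟩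
        rw [w0, w1]; exact openSegment_subset_segment ℝ _ _ hx
      · rintro rfl
        rw [w0, left_mem_openSegment_iff] at hx
        have := h.inj _ _ (by omega) (by omega) hx; omega
      · rintro rfl
        rw [wm] at hx
        exact zα.ne' (B.mem_segment_right.1 (openSegment_subset_segment ℝ _ _ hx)).1
    · intro T hT
      obtain ⟨x, hx, hxT⟩ : ∃ x ∈ openSegment ℝ (v 1) (v 0), x ∉ triangleUnion T := by
        refine hT.exists_mem_openSegment_notMem B zα zγ f f1 fz ?_
            (isClosed_chain w (finite_Ico 1 (m - 1))) ?_ ?_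
        · rintro e (rfl | ⟨i, hi, rfl⟩)
          · exact fw (m - 1) (by omega)
          · simp only [mem_Ico] at hi; exact fw i (by omega)
        · intro hx
          obtain ⟨i, hi, hx⟩ := mem_edgeUnion_chainEdges.1 hx
          simp only [mem_Ico] at hi
          rw [← w0] at hx
          exact hb i (by omega) (by omega) hx
        · rw [edgeUnion_insert]
          rintro x (hx | hx)
          · left; rw [segment_symm]; simpa [w0, wm] using hx
          · right
            obtain ⟨i, hi, hx⟩ := mem_edgeUnion_chainEdges.1 hx
            simp only [mem_Ico] at hi
            by_cases hi0 : i = 0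
            · left
              subst hi0
              rw [w0, w1] at hx
              exact hx
            · right
              exact mem_edgeUnion_chainEdges.2 ⟨i, by simp; omega, hx⟩
      refine ⟨x, ?_, ?_, ?_, hxT⟩
      · refine mem_edgeUnion_chainEdges.2 ⟨k - 1, by simp; omega, ?_⟩
        rw [wk, show k - 1 + 1 = k by omega, hwk, segment_symm]
        exact openSegment_subset_segment ℝ _ _ hx
      · rintro rfl
        rw [w0, left_mem_openSegment_iff] at hx
        have := h.inj _ _ (by omega) (by omega) hx; omega
      · rintro rfl
        rw [wm] at hx
        have hx := openSegment_subset_segment ℝ _ _ hx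
        rw [segment_symm] at hx
        exact zγ.ne' (B.mem_segment_left.1 hx).1
  · have hno : ∀ j, 3 ≤ j → j < k → v j ∉ convexHull ℝ {v 0, v 1, v 2} :=
      fun j h1 h2 h3 => hno ⟨j, ⟨h1, h2⟩, h3⟩
    refine exists_isTriangulation_of_isDiagonal ih h le_rfl hk4 (h.isDiagonal_two hk4 B hno) ?_ ?_
    · intro T hT
      refine ⟨v 1, ?_, fun h' => ?_, fun h' => ?_, fun h' => ?_⟩
      · exact mem_edgeUnion_chainEdges.2 ⟨0, by simp, right_mem_segment ℝ _ _⟩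
      · have := h.inj _ _ (by omega) (by omega) h'; omega
      · have := h.inj _ _ (by omega) (by omega) h'; omega
      · refine absurd (triangleUnion_subset hT (convex_affine_gt f 0) ?_ h') (by simp [f1])
        rintro e (rfl | ⟨i, hi, rfl⟩)
        · exact fpos 0 (by omega) (by omega)
        · exact fpos i hi.2 (by have := hi.1; omega)
    · intro T hT
      refine ⟨v 3, ?_, fun h' => ?_, fun h' => ?_, fun h' => hno 3 le_rfl hk4 ?_⟩
      · exact mem_edgeUnion_chainEdges.2 ⟨3, by simp; omega, left_mem_segment ℝ _ _⟩
      · have := h.inj _ _ (by omega) (by omega) h'; omega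
      · have := h.inj _ _ (by omega) (by omega) h'; omega
      · refine triangleUnion_subset hT (convex_convexHull ℝ {v 0, v 1, v 2}) ?_ h'
        rintro e (rfl | ⟨i, hi, rfl⟩)
        · exact subset_convexHull _ _ (by simp)
        · simp only [mem_Ico] at hi
          have : i = 0 ∨ i = 1 := by omega
          rcases this with rfl | rfl <;> exact subset_convexHull _ _ (by simp)

end IsPolygon

theorem isPolygon_of_zmod {k : ℕ} (hk : 3 ≤ k) {v : ZMod k → Plane} (hinj : Function.Injective v)
    (hsimple : ∀ i j : ZMod k, i ≠ j → i ≠ j + 1 → j ≠ i + 1 →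
      segment ℝ (v i) (v (i + 1)) ∩ segment ℝ (v j) (v (j + 1)) = ∅)
    (hadj : ∀ i : ZMod k,
      segment ℝ (v i) (v (i + 1)) ∩ segment ℝ (v (i + 1)) (v (i + 2)) = {v (i + 1)}) :
    IsPolygon k (fun i => v (i : ZMod k)) := by
  have hcast : ∀ i j : ℕ, i < k → j < k → (i : ZMod k) = j → i = j := by
    intro i j hi hj h
    rw [ZMod.natCast_eq_natCast_iff] at h
    exact Nat.ModEq.eq_of_lt_of_lt h hi hj
  have hk0 : ((k - 1 : ℕ) : ZMod k) + 1 = 0 := by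
    rw [← Nat.cast_succ, Nat.succ_eq_add_one, show k - 1 + 1 = k by omega, ZMod.natCast_self]
  refine ⟨by simp, fun i j hi hj h => hcast i j hi hj (hinj h), ?_⟩
  intro i j hij hj x hx1 hx2
  simp only [Nat.cast_succ, Nat.cast_zero] at hx1 hx2 ⊢
  by_cases h1 : j = i + 1
  · left
    refine ⟨h1, ?_⟩
    subst h1
    have := (hadj i).le ⟨hx1, by simpa [add_assoc, one_add_one_eq_two] using hx2⟩
    simpa using this
  · by_cases h2 : i = 0 ∧ j + 1 = k
    · right
      refine ⟨h2.1, h2.2, ?_⟩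
      obtain ⟨rfl, h2⟩ := h2
      have hj0 : (j : ZMod k) + 1 = 0 := by rw [show j = k - 1 by omega]; exact hk0
      have hj1 : (j : ZMod k) + 2 = 1 := by rw [← one_add_one_eq_two, ← add_assoc, hj0, zero_add]
      have := hadj j
      rw [hj1, hj0] at this
      rw [hj0] at hx2
      exact this.le ⟨hx2, by simpa using hx1⟩
    · exfalso
      have := hsimple i j (fun h => ?_) (fun h => ?_) (fun h => ?_)
      · exact this.le ⟨hx1, hx2⟩
      · have := hcast _ _ (by omega) hj h; omega
      · by_cases hjk : j + 1 < k
        · have := hcast i (j + 1) (by omega) hjk (by push_cast; exact h); omega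
        · rw [show j = k - 1 by omega, hk0] at h
          have := hcast i 0 (by omega) (by omega) (by push_cast; exact h); omega
      · have := hcast j (i + 1) hj (by omega) (by push_cast; exact h); omega

theorem not_isBounded_compl {S : Set Plane} (hS : Bornology.IsBounded S) :
    ¬ Bornology.IsBounded Sᶜ := by
  intro h
  have := hS.union h
  rw [union_compl_self] at this
  exact NormedSpace.unbounded_univ ℝ Plane this

theorem IsTriangulation.triangleUnion_eq {E : Set (Plane × Plane)} {T : Set (Fin 3 → Plane)}
    (h : IsTriangulation E T) {e : Plane × Plane} (he : e ∈ E) (hne : e.1 ≠ e.2) :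
    triangleUnion T = edgeUnion E ∪
      {x | x ∉ edgeUnion E ∧ Bornology.IsBounded (connectedComponentIn (edgeUnion E)ᶜ x)} := by
  have hcpt := isCompact_triangleUnion h.finite
  have hsub := h.boundary_subset
  ext x
  constructor
  · intro hx
    by_cases hxE : x ∈ edgeUnion E
    · exact Or.inl hxE
    refine Or.inr ⟨hxE, ?_⟩
    have hxm : x ∈ connectedComponentIn (edgeUnion E)ᶜ x := mem_connectedComponentIn hxE
    rcases h.subset_or_disjoint (isPreconnected_connectedComponentIn (F := (edgeUnion E)ᶜ) (x := x))
      (disjoint_left.2 fun y hy => connectedComponentIn_subset _ _ hy) with h' | h'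
    · exact hcpt.isBounded.subset (h'.trans sdiff_subset)
    · exact (disjoint_left.1 h' hxm hx).elim
  · rintro (hx | ⟨hxE, hb⟩)
    · exact hsub hx
    by_contra hx
    have hK := h.isPreconnected_compl_union e he _ (isClosed_segment _ _)
      (isPreconnected_compl_segment hne) ?_
    · have hseg : segment ℝ e.1 e.2 ∪ triangleUnion T = triangleUnion T :=
        union_eq_right.2 (fun y hy => hsub (mem_edgeUnion.2 ⟨e, he, hy⟩))
      rw [hseg] at hK
      exact not_isBounded_compl hcpt.isBounded
        (hb.subset (hK.subset_connectedComponentIn hx (compl_subset_compl.2 hsub)))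
    · exact inter_eq_left.2 (fun y hy => hsub (mem_edgeUnion.2 ⟨e, he, hy⟩))

/-- The closed region enclosed by a simple closed polygonal curve `C ⊆ ℝ²`
with cyclically-indexed vertices `v : ZMod k → ℝ²` can be triangulated with
all triangle vertices among the nodes of `C`. -/
theorem triangulate_polygon_interior
    (k : ℕ) [NeZero k] (hk : 3 ≤ k) (v : ZMod k → (Fin 2 → ℝ))
    (hinj : Function.Injective v)
    (C : Set (Fin 2 → ℝ))
    (hC : C = ⋃ i : ZMod k, segment ℝ (v i) (v (i + 1)))
    -- simplicity: non-adjacent edges are disjoint,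
    (hsimple : ∀ i j : ZMod k, i ≠ j → i ≠ j + 1 → j ≠ i + 1 →
      segment ℝ (v i) (v (i + 1)) ∩ segment ℝ (v j) (v (j + 1)) = ∅)
    -- and adjacent edges meet exactly in their common vertex
    (hadj : ∀ i : ZMod k,
      segment ℝ (v i) (v (i + 1)) ∩ segment ℝ (v (i + 1)) (v (i + 2)) = {v (i + 1)})
    -- the closed enclosed region: the curve together with the bounded
    -- connected components of its complement
    (R : Set (Fin 2 → ℝ))
    (hR : R = C ∪ {x | x ∉ C ∧ Bornology.IsBounded (connectedComponentIn Cᶜ x)}) :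
    ∃ (N : ℕ) (t : Fin N → Fin 3 → (Fin 2 → ℝ)),
      (∀ a i, ∃ j : ZMod k, t a i = v j) ∧
      (∀ a, AffineIndependent ℝ (t a)) ∧
      (⋃ a, convexHull ℝ (Set.range (t a))) = R ∧
      (∀ a b, a ≠ b →
        interior (convexHull ℝ (Set.range (t a))) ∩
          interior (convexHull ℝ (Set.range (t b))) = ∅ ∧
        convexHull ℝ (Set.range (t a)) ∩ convexHull ℝ (Set.range (t b)) =
          convexHull ℝ (Set.range (t a) ∩ Set.range (t b))) := by
  have hP := isPolygon_of_zmod hk hinj hsimple hadj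
  obtain ⟨T, hT⟩ := IsPolygon.exists_isTriangulation k _ hP hk
  have hCE : C = edgeUnion (chainEdges (fun i => v (i : ZMod k)) (Iio k)) := by
    ext x
    rw [hC, mem_iUnion, mem_edgeUnion_chainEdges]
    constructor
    · rintro ⟨i, hi⟩
      exact ⟨i.val, ZMod.val_lt i, by simpa using hi⟩
    · rintro ⟨i, -, hi⟩
      exact ⟨i, by simpa using hi⟩
  have hRT : triangleUnion T = R := by
    rw [hR, hCE]
    exact hT.triangleUnion_eq ⟨0, by simp; omega, rfl⟩ (hP.ne_succ (by omega) (i := 0) (by omega))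
  have := hT.finite.to_subtype
  let e := Finite.equivFin T
  refine ⟨Nat.card T, fun a => (e.symm a : Fin 3 → Plane), ?_, ?_, ?_, ?_⟩
  · intro a i
    obtain ⟨_, ⟨j, -, rfl⟩, h⟩ := hT.vertex _ (e.symm a).2 i
    exact ⟨j, h⟩
  · exact fun a => hT.indep _ (e.symm a).2
  · rw [← hRT, triangleUnion, biUnion_eq_iUnion]
    exact e.symm.surjective.iUnion_comp fun t : T => convexHull ℝ (range (t : Fin 3 → Plane))
  · intro a b hab
    exact hT.face _ (e.symm a).2 _ (e.symm b).2
      (fun h => hab (e.symm.injective (Subtype.ext h)))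
end

section
/- Every simple closed polygonal curve in ℝ² with at least four vertices, positively oriented, has a vertex v₂ with positive exterior angle (i.e., a convex vertex with respect to the enclosed region); moreover at such a vertex with neighbors v₁, v₃, either the open segment (v₁,v₃) lies entirely in the enclosed open region, or the curve C intersects the segment [v₁,v₃] in a point other than v₁, v₃. -/
/-- The planar cross product (signed area form). -/
def cross2 (p q : Fin 2 → ℝ) : ℝ := p 0 * q 1 - p 1 * q 0

section

open Complex Topology Filter Set

theorem exists_eq_neg_mul_of_div_notMem_slitPlane {p q : ℂ} (hp : p ≠ 0)
    (h : q / p ∉ slitPlane) : ∃ r : ℝ, 0 ≤ r ∧ q = -(r : ℂ) * p := by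
  rw [mem_slitPlane_iff] at h
  push Not at h
  refine ⟨-(q / p).re, by linarith [h.1], ?_⟩
  have : ((-(q / p).re : ℝ) : ℂ) = -(q / p) := by
    apply Complex.ext <;> simp [h.2]
  rw [this]
  field_simp

/-- The oriented angle in `(-π, π]` under which the segment from `p` to `q` is seen from `x`. -/
noncomputable def viewAngle (p q x : ℂ) : ℝ := arg ((q - x) / (p - x))

theorem sub_div_sub_mem_slitPlane {p q x : ℂ} (h : x ∉ segment ℝ p q) :
    (q - x) / (p - x) ∈ slitPlane := by
  by_contra hx
  have hp : p - x ≠ 0 := by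
    rw [sub_ne_zero]
    rintro rfl
    exact h (left_mem_segment ℝ _ _)
  obtain ⟨r, hr, e⟩ := exists_eq_neg_mul_of_div_notMem_slitPlane hp hx
  apply h
  have h1 : (0 : ℝ) < 1 + r := by linarith
  have h1' : (1 + r : ℂ) ≠ 0 := by exact_mod_cast h1.ne'
  refine ⟨r / (1 + r), 1 / (1 + r), by positivity, by positivity, by field_simp; ring, ?_⟩
  simp only [real_smul]
  push_cast
  field_simp
  linear_combination e

theorem continuousAt_viewAngle {p q x : ℂ} (h : x ∉ segment ℝ p q) :
    ContinuousAt (viewAngle p q) x := by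
  have hp : p - x ≠ 0 := by
    rw [sub_ne_zero]
    rintro rfl
    exact h (left_mem_segment ℝ _ _)
  have h2 : ContinuousAt (fun y => (q - y) / (p - y)) x :=
    ContinuousAt.div (by fun_prop) (by fun_prop) hp
  exact ContinuousAt.comp (f := fun y => (q - y) / (p - y))
    (continuousAt_arg (sub_div_sub_mem_slitPlane h)) h2

theorem viewAngle_of_mem_openSegment {p q x : ℂ} (hpq : p ≠ q) (h : x ∈ openSegment ℝ p q) :
    viewAngle p q x = Real.pi := by
  obtain ⟨a, b, ha, hb, hab, rfl⟩ := h
  have e : (q - (a • p + b • q)) / (p - (a • p + b • q)) = ((-(a / b) : ℝ) : ℂ) := by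
    have hb' : (b : ℂ) ≠ 0 := by exact_mod_cast hb.ne'
    have hab' : (a : ℂ) + b = 1 := by exact_mod_cast hab
    have h1 : q - (a • p + b • q) = a * (q - p) := by
      simp only [real_smul]; linear_combination (-q) * hab'
    have h2 : p - (a • p + b • q) = -b * (q - p) := by
      simp only [real_smul]; linear_combination (-p) * hab'
    have : q - p ≠ 0 := sub_ne_zero.2 hpq.symm
    rw [h1, h2]
    push_cast
    field_simp
  rw [viewAngle, e]
  exact arg_ofReal_of_neg (by have := div_pos ha hb; linarith)

theorem tendsto_viewAngle_cobounded (p q : ℂ) :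
    Tendsto (viewAngle p q) (Bornology.cobounded ℂ) (𝓝 0) := by
  have h0 : Tendsto (fun x => p - x) (Bornology.cobounded ℂ) (Bornology.cobounded ℂ) := by
    exact tendsto_const_sub_cobounded p
  have h1 : Tendsto (fun x => 1 + (q - p) * (p - x)⁻¹) (Bornology.cobounded ℂ) (𝓝 1) := by
    have := ((tendsto_inv₀_cobounded.comp h0).const_mul (q - p)).const_add 1
    simpa using this
  have h2 : Tendsto (fun x => arg (1 + (q - p) * (p - x)⁻¹)) (Bornology.cobounded ℂ) (𝓝 0) := by
    simpa only [arg_one, Function.comp_def] using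
      (continuousAt_arg one_mem_slitPlane).tendsto.comp h1
  refine h2.congr' ?_
  filter_upwards [Bornology.eventually_ne_cobounded p] with x hx
  have : p - x ≠ 0 := sub_ne_zero.2 hx.symm
  rw [viewAngle]
  congr 1
  field_simp
  ring

theorem eq_of_isPreconnected_of_angle_eq_zero {X : Type*} [TopologicalSpace X] {s : Set X}
    (hs : IsPreconnected s) {f : X → ℝ} (hf : ContinuousOn f s)
    (h0 : ∀ x ∈ s, (f x : Real.Angle) = 0) {x y : X} (hx : x ∈ s) (hy : y ∈ s) : f x = f y := by
  have hpi := Real.two_pi_pos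
  have hd : IsDiscrete (range ((↑) : ℤ → ℝ)) :=
    Int.isClosedEmbedding_coe_real.isEmbedding.isInducing.isDiscrete_range
  have := hs.constant_of_mapsTo hd (hf.div_const (2 * Real.pi)) (fun z hz => ?_) hx hy
  · field_simp at this
    exact this
  · obtain ⟨n, hn⟩ := Real.Angle.coe_eq_zero_iff.1 (h0 z hz)
    refine ⟨n, ?_⟩
    simp only [← hn, zsmul_eq_mul]
    field_simp

theorem tendsto_viewAngle_add_right {p q u : ℂ} (hpq : p ≠ q)
    (h : u = p - q ∨ u / (q - p) ∈ slitPlane) :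
    Tendsto (fun t : ℝ => viewAngle p q (q + t * u)) (𝓝[>] 0) (𝓝 (arg (u / (q - p)))) := by
  have hne : q - p ≠ 0 := sub_ne_zero.2 hpq.symm
  have key : ∀ t : ℝ, 0 < t → viewAngle p q (q + t * u) = arg (u / (q - p + t * u)) := by
    intro t ht
    rw [viewAngle, ← arg_real_mul (u / (q - p + t * u)) ht]
    congr 1
    rw [← neg_div_neg_eq]
    ring
  rcases h with rfl | h
  · refine tendsto_const_nhds.congr' ?_
    filter_upwards [self_mem_nhdsWithin, mem_nhdsWithin_of_mem_nhds (Iio_mem_nhds one_pos)]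
      with t ht ht1
    rw [key t ht]
    have e1 : (p - q) / (q - p) = -1 := by field_simp; ring
    have ht1' : (1 - t : ℂ) ≠ 0 := by
      exact_mod_cast (sub_pos.2 ht1).ne'
    have e2 : (p - q) / (q - p + t * (p - q)) = ((-(1 - t)⁻¹ : ℝ) : ℂ) := by
      have : q - p + t * (p - q) = (1 - t) * (q - p) := by ring
      rw [this]
      push_cast
      field_simp
      ring
    rw [e1, e2, arg_neg_one, arg_ofReal_of_neg]
    simpa using ht1
  · have h2 : ContinuousAt (fun t : ℝ => u / (q - p + t * u)) 0 :=
      ContinuousAt.div (by fun_prop) (by fun_prop) (by simpa using hne)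
    have h3 : ContinuousAt (fun t : ℝ => arg (u / (q - p + t * u))) 0 :=
      ContinuousAt.comp (f := fun t : ℝ => u / (q - p + t * u))
        (continuousAt_arg (by simpa using h)) h2
    have h4 := h3.tendsto.mono_left (nhdsWithin_le_nhds (s := Ioi 0))
    simp only [ofReal_zero, zero_mul, add_zero] at h4
    refine h4.congr' ?_
    filter_upwards [self_mem_nhdsWithin] with t ht
    exact (key t ht).symm

theorem tendsto_viewAngle_add_left {p q u : ℂ} (hpq : p ≠ q) (hu : u ≠ 0)
    (h : u = q - p ∨ -(q - p) / u ∈ slitPlane) :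
    Tendsto (fun t : ℝ => viewAngle p q (p + t * u)) (𝓝[>] 0) (𝓝 (arg (-(q - p) / u))) := by
  have hne : q - p ≠ 0 := sub_ne_zero.2 hpq.symm
  have key : ∀ t : ℝ, 0 < t → viewAngle p q (p + t * u) = arg ((-(q - p) + t * u) / u) := by
    intro t ht
    rw [viewAngle, ← arg_real_mul ((-(q - p) + t * u) / u) (inv_pos.2 ht)]
    congr 1
    have : (t : ℂ) ≠ 0 := by exact_mod_cast ht.ne'
    have h2 : p - (p + t * u) = -(t * u) := by ring
    rw [h2]
    push_cast
    field_simp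
    ring
  rcases h with rfl | h
  · refine tendsto_const_nhds.congr' ?_
    filter_upwards [self_mem_nhdsWithin, mem_nhdsWithin_of_mem_nhds (Iio_mem_nhds one_pos)]
      with t ht ht1
    rw [key t ht]
    have e1 : -(q - p) / (q - p) = -1 := by field_simp
    have e2 : (-(q - p) + t * (q - p)) / (q - p) = ((-(1 - t) : ℝ) : ℂ) := by
      push_cast
      field_simp
      ring
    rw [e1, e2, arg_neg_one, arg_ofReal_of_neg]
    simpa using ht1
  · have h2 : ContinuousAt (fun t : ℝ => (-(q - p) + t * u) / u) 0 := by fun_prop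
    have h3 : ContinuousAt (fun t : ℝ => arg ((-(q - p) + t * u) / u)) 0 :=
      ContinuousAt.comp (f := fun t : ℝ => (-(q - p) + t * u) / u)
        (continuousAt_arg (by simpa using h)) h2
    have h4 := h3.tendsto.mono_left (nhdsWithin_le_nhds (s := Ioi 0))
    simp only [ofReal_zero, zero_mul, add_zero] at h4
    refine h4.congr' ?_
    filter_upwards [self_mem_nhdsWithin] with t ht
    exact (key t ht).symm

theorem exists_mem_disjoint_openSegment {K : Set ℂ} (hK : IsCompact K) (hne : K.Nonempty)
    {x : ℂ} (hx : x ∉ K) : ∃ m ∈ K, Disjoint (openSegment ℝ m x) K := by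
  obtain ⟨m, hm, hmin⟩ := hK.exists_infDist_eq_dist hne x
  refine ⟨m, hm, disjoint_left.2 ?_⟩
  rintro _ ⟨a, b, ha, hb, hab, rfl⟩ hy
  have h1 := Metric.infDist_le_dist_of_mem (x := x) hy
  have hpos : 0 < dist x m := dist_pos.2 fun e => hx (e ▸ hm)
  have h2 : dist x (a • m + b • x) = a * dist x m := by
    have : x - (a • m + b • x) = a • (x - m) := by
      rw [← sub_eq_zero]
      have : b = 1 - a := by linarith
      subst this
      module
    rw [dist_eq_norm, this, norm_smul, Real.norm_of_nonneg ha.le, dist_eq_norm]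
  rw [hmin, h2] at h1
  nlinarith

theorem eq_or_eq_sub_two_pi {x y : ℝ} (hx : (x : Real.Angle) = 0) (hy : (y : Real.Angle) = 0)
    (h1 : x - y < 2 * Real.pi) (h2 : -(4 * Real.pi) < x - y) : x = y ∨ x = y - 2 * Real.pi := by
  obtain ⟨m, rfl⟩ := Real.Angle.coe_eq_zero_iff.1 hx
  obtain ⟨n, rfl⟩ := Real.Angle.coe_eq_zero_iff.1 hy
  simp only [zsmul_eq_mul] at *
  have hpi := Real.two_pi_pos
  have a1 : ((m - n : ℤ) : ℝ) < 1 := by push_cast; nlinarith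
  have a2 : (-2 : ℝ) < ((m - n : ℤ) : ℝ) := by push_cast; nlinarith
  have b1 : m - n < 1 := by exact_mod_cast a1
  have b2 : -2 < m - n := by exact_mod_cast a2
  rcases (by omega : m = n ∨ m = n - 1) with h | h
  · left; rw [h]
  · right; rw [h]; push_cast; ring

theorem arg_mem_Ioo_of_mem_slitPlane {w : ℂ} (hw : w ∈ slitPlane) :
    arg w ∈ Ioo (-Real.pi) Real.pi :=
  ⟨neg_pi_lt_arg w, (arg_le_pi w).lt_of_ne (slitPlane_arg_ne_pi hw)⟩

/-- The planar cross product on the complex plane. -/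
def complexCross (p q : ℂ) : ℝ := p.re * q.im - p.im * q.re

theorem div_im_eq_complexCross (p q : ℂ) : (q / p).im = complexCross p q / normSq p := by
  rw [div_im, complexCross]; ring

theorem div_im_pos_iff {p q : ℂ} (hp : p ≠ 0) : 0 < (q / p).im ↔ 0 < complexCross p q := by
  rw [div_im_eq_complexCross, div_pos_iff_of_pos_right (normSq_pos.2 hp)]

theorem div_im_neg_iff {p q : ℂ} (hp : p ≠ 0) : (q / p).im < 0 ↔ complexCross p q < 0 := by
  rw [div_im_eq_complexCross, div_neg_iff]
  have := normSq_pos.2 hp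
  constructor
  · rintro (h | h) <;> linarith
  · exact fun h => Or.inr ⟨h, this⟩

theorem im_pos_of_arg_pos {w : ℂ} (hw : w ∈ slitPlane) (h : 0 < arg w) : 0 < w.im := by
  refine (arg_nonneg_iff.1 h.le).lt_of_ne fun h0 => ?_
  rcases mem_slitPlane_iff.1 hw with h1 | h1
  · exact h.ne' (arg_eq_zero_iff.2 ⟨h1.le, h0.symm⟩)
  · exact h1 h0.symm

theorem arg_pos_of_im_pos {w : ℂ} (h : 0 < w.im) : 0 < arg w :=
  (arg_nonneg_iff.2 h.le).lt_of_ne fun h0 => h.ne' (arg_eq_zero_iff.1 h0.symm).2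

theorem openSegment_subset_of_mem_openSegment {a c x : ℂ} (hx : x ∈ openSegment ℝ a c) :
    openSegment ℝ a x ⊆ openSegment ℝ a c := by
  obtain ⟨p, q, hp, hq, hpq, rfl⟩ := hx
  rintro _ ⟨s, t, hs, ht, hst, rfl⟩
  refine ⟨s + t * p, t * q, by positivity, by positivity, ?_, by module⟩
  linear_combination t * hpq + hst

/-- The change of argument from `p` to `q`, as a difference of arguments with a correction when the
segment from `p` to `q` crosses the positive real axis. -/
theorem arg_div_eq_arg_neg_sub_arg_neg {p q : ℂ} (hp : p.im ≠ 0) (hq : q.im ≠ 0)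
    (h : q / p ∈ slitPlane) :
    arg (q / p) = arg (-q) - arg (-p) + 2 * Real.pi *
      (((if 0 ≤ q.im then 1 else 0) - (if 0 ≤ p.im then 1 else 0)) *
        if 0 ≤ complexCross p q * (q.im - p.im) then 1 else 0) := by
  have hp0 : p ≠ 0 := by rintro rfl; simp at hp
  have hq0 : q ≠ 0 := by rintro rfl; simp at hq
  have hpi := Real.pi_pos
  obtain ⟨n, hn⟩ : ∃ n : ℤ, arg (q / p) - (arg (-q) - arg (-p)) = 2 * Real.pi * n := by
    rw [← Real.Angle.angle_eq_iff_two_pi_dvd_sub, Real.Angle.coe_sub, ← neg_div_neg_eq,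
      arg_div_coe_angle (neg_ne_zero.2 hq0) (neg_ne_zero.2 hp0)]
  have a := arg_mem_Ioo_of_mem_slitPlane h
  have hbound : ∀ w : ℂ, w.im ≠ 0 →
      (0 < w.im → arg (-w) ∈ Ioo (-Real.pi) 0) ∧ (w.im < 0 → arg (-w) ∈ Ioo 0 Real.pi) := by
    intro w hw
    refine ⟨fun h0 => ⟨neg_pi_lt_arg _, arg_neg_iff.2 (by simpa using h0)⟩, fun h0 =>
      ⟨arg_pos_of_im_pos (by simpa using h0), arg_lt_pi_iff.2 (Or.inr (by simpa using hw))⟩⟩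
  have hzero : complexCross p q = 0 → arg (q / p) = 0 := by
    intro h0
    have him : (q / p).im = 0 := by rw [div_im_eq_complexCross, h0, zero_div]
    exact arg_eq_zero_iff.2
      ⟨((mem_slitPlane_iff.1 h).resolve_right (not_not.2 him)).le, him⟩
  have hpos : 0 < complexCross p q → 0 < arg (q / p) := fun h0 =>
    arg_pos_of_im_pos ((div_im_pos_iff hp0).2 h0)
  have hneg : complexCross p q < 0 → arg (q / p) < 0 := fun h0 =>
    arg_neg_iff.2 ((div_im_neg_iff hp0).2 h0)
  have hint : ∀ m : ℤ, 2 * Real.pi * n < 2 * Real.pi * (m + 1) →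
      2 * Real.pi * (m - 1) < 2 * Real.pi * n → (n : ℝ) = m := by
    intro m h1 h2
    have h1' : (n : ℝ) < m + 1 := lt_of_mul_lt_mul_left h1 (by positivity)
    have h2' : (m : ℝ) - 1 < n := lt_of_mul_lt_mul_left h2 (by positivity)
    have h1'' : n < m + 1 := by exact_mod_cast h1'
    have h2'' : m - 1 < n := by exact_mod_cast h2'
    exact_mod_cast (by omega : n = m)
  have hfin : ∀ m : ℤ, 2 * Real.pi * n < 2 * Real.pi * (m + 1) →
      2 * Real.pi * (m - 1) < 2 * Real.pi * n →
      arg (q / p) = arg (-q) - arg (-p) + 2 * Real.pi * m := by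
    intro m h1 h2
    rw [← hint m h1 h2]
    linarith
  rcases lt_or_gt_of_ne hp with p1 | p1 <;> rcases lt_or_gt_of_ne hq with q1 | q1
  · have b1 := (hbound p hp).2 p1
    have b2 := (hbound q hq).2 q1
    rw [if_neg p1.not_ge, if_neg q1.not_ge]
    simpa using hfin 0 (by push_cast; linarith [a.1, a.2, b1.1, b1.2, b2.1, b2.2])
      (by push_cast; linarith [a.1, a.2, b1.1, b1.2, b2.1, b2.2])
  · have b1 := (hbound p hp).2 p1
    have b2 := (hbound q hq).1 q1
    rw [if_neg p1.not_ge, if_pos q1.le]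
    rcases lt_trichotomy (complexCross p q) 0 with hc | hc | hc
    · have := hneg hc
      rw [if_neg (by nlinarith)]
      simpa using hfin 0 (by push_cast; linarith [a.1, a.2, b1.1, b1.2, b2.1, b2.2])
        (by push_cast; linarith [a.1, a.2, b1.1, b1.2, b2.1, b2.2])
    · have := hzero hc
      exfalso
      have h0 := hint 0 (by push_cast; linarith [a.1, a.2, b1.1, b1.2, b2.1, b2.2])
        (by push_cast; linarith [a.1, a.2, b1.1, b1.2, b2.1, b2.2])
      rw [h0] at hn
      push_cast at hn
      linarith [b1.1, b2.2]
    · have := hpos hc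
      rw [if_pos (by nlinarith)]
      simpa using hfin 1 (by push_cast; linarith [a.1, a.2, b1.1, b1.2, b2.1, b2.2])
        (by push_cast; linarith [a.1, a.2, b1.1, b1.2, b2.1, b2.2])
  · have b1 := (hbound p hp).1 p1
    have b2 := (hbound q hq).2 q1
    rw [if_pos p1.le, if_neg q1.not_ge]
    rcases lt_trichotomy (complexCross p q) 0 with hc | hc | hc
    · have := hneg hc
      rw [if_pos (by nlinarith)]
      simpa using hfin (-1) (by push_cast; linarith [a.1, a.2, b1.1, b1.2, b2.1, b2.2])
        (by push_cast; linarith [a.1, a.2, b1.1, b1.2, b2.1, b2.2])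
    · have := hzero hc
      exfalso
      have h0 := hint 0 (by push_cast; linarith [a.1, a.2, b1.1, b1.2, b2.1, b2.2])
        (by push_cast; linarith [a.1, a.2, b1.1, b1.2, b2.1, b2.2])
      rw [h0] at hn
      push_cast at hn
      linarith [b1.2, b2.1]
    · have := hpos hc
      rw [if_neg (by nlinarith)]
      simpa using hfin 0 (by push_cast; linarith [a.1, a.2, b1.1, b1.2, b2.1, b2.2])
        (by push_cast; linarith [a.1, a.2, b1.1, b1.2, b2.1, b2.2])
  · have b1 := (hbound p hp).1 p1
    have b2 := (hbound q hq).1 q1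
    rw [if_pos p1.le, if_pos q1.le]
    simpa using hfin 0 (by push_cast; linarith [a.1, a.2, b1.1, b1.2, b2.1, b2.2])
      (by push_cast; linarith [a.1, a.2, b1.1, b1.2, b2.1, b2.2])

/-- The real part of the point of height `t` on the line through `p` and `q`. -/
noncomputable def lineRe (p q : ℂ) (t : ℝ) : ℝ := p.re + (t - p.im) * ((q.re - p.re) / (q.im - p.im))

/-- The signed number of crossings of the height `t` by the segment from `p` to `q`. -/
noncomputable def heightCrossing (p q : ℂ) (t : ℝ) : ℝ :=
  (if t ≤ q.im then 1 else 0) - if t ≤ p.im then 1 else 0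

theorem viewAngle_eq_heightCrossing {p q x : ℂ} (hp : p.im ≠ x.im) (hq : q.im ≠ x.im)
    (hx : x ∉ segment ℝ p q) :
    viewAngle p q x = arg (-(q - x)) - arg (-(p - x)) + 2 * Real.pi *
      (heightCrossing p q x.im * if x.re ≤ lineRe p q x.im then 1 else 0) := by
  rw [viewAngle, arg_div_eq_arg_neg_sub_arg_neg (by simpa [sub_eq_zero] using hp)
    (by simpa [sub_eq_zero] using hq) (sub_div_sub_mem_slitPlane hx)]
  simp only [sub_im, sub_nonneg, heightCrossing]
  congr 2
  by_cases hpq : q.im = p.im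
  · simp [hpq]
  have hpq' : q.im - p.im ≠ 0 := sub_ne_zero.2 hpq
  congr 2
  have : complexCross (p - x) (q - x) * (q.im - x.im - (p.im - x.im)) =
      (lineRe p q x.im - x.re) * (q.im - p.im) ^ 2 := by
    simp only [complexCross, lineRe, sub_re, sub_im]
    field_simp
    ring
  rw [this, mul_nonneg_iff_of_pos_right (by positivity), sub_nonneg]

theorem re_eq_lineRe_of_mem_segment {p q x : ℂ} (hp : p.im ≠ x.im) (hx : x ∈ segment ℝ p q) :
    x.re = lineRe p q x.im := by
  obtain ⟨a, b, ha, hb, hab, rfl⟩ := hx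
  obtain rfl : a = 1 - b := by linarith
  simp only [add_im, smul_im, smul_eq_mul, add_re, smul_re, lineRe] at hp ⊢
  have : q.im - p.im ≠ 0 := fun h => hp (by linear_combination -b * h)
  field_simp
  ring

theorem integral_mul_ite_le {f : ℝ → ℝ} (hf : Continuous f) {a b c : ℝ} (hac : a ≤ c)
    (hcb : c ≤ b) :
    IntervalIntegrable (fun t => (if t ≤ c then 1 else 0) * f t) MeasureTheory.volume a b ∧
      ∫ t in a..b, (if t ≤ c then 1 else 0) * f t = ∫ t in a..c, f t := by
  have h : (fun t => (if t ≤ c then 1 else 0) * f t) = indicator {t | t ≤ c} f := by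
    ext t
    simp [indicator_apply]
  rw [h]
  refine ⟨?_, intervalIntegral.integral_indicator ⟨hac, hcb⟩⟩
  rw [intervalIntegrable_iff]
  exact ((hf.intervalIntegrable a b).def').indicator measurableSet_Iic

/-- The identification of the coordinate plane with the complex plane. -/
noncomputable def planeEquivComplex : (Fin 2 → ℝ) ≃L[ℝ] ℂ :=
  basisOneI.equivFun.symm.toContinuousLinearEquiv

theorem planeEquivComplex_apply (x : Fin 2 → ℝ) : planeEquivComplex x = ⟨x 0, x 1⟩ := by
  apply Complex.ext <;> simp [planeEquivComplex, Module.Basis.equivFun_symm_apply]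

theorem cross2_eq_complexCross (p q : Fin 2 → ℝ) :
    cross2 p q = complexCross (planeEquivComplex p) (planeEquivComplex q) := by
  simp only [cross2, complexCross, planeEquivComplex_apply]

theorem planeEquivComplex_mem_segment {p q x : Fin 2 → ℝ} :
    planeEquivComplex x ∈ segment ℝ (planeEquivComplex p) (planeEquivComplex q) ↔
      x ∈ segment ℝ p q := by
  rw [← planeEquivComplex.injective.mem_set_image (s := segment ℝ p q)]
  exact (Set.ext_iff.1
    (image_segment ℝ planeEquivComplex.toLinearEquiv.toLinearMap.toAffineMap p q) _).symm

theorem planeEquivComplex_mem_openSegment {p q x : Fin 2 → ℝ} :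
    planeEquivComplex x ∈ openSegment ℝ (planeEquivComplex p) (planeEquivComplex q) ↔
      x ∈ openSegment ℝ p q := by
  rw [← planeEquivComplex.injective.mem_set_image (s := openSegment ℝ p q)]
  exact (Set.ext_iff.1
    (image_openSegment ℝ planeEquivComplex.toLinearEquiv.toLinearMap.toAffineMap p q) _).symm

/-- A simple closed polygon in the complex plane, given by its cyclic sequence of vertices. -/
structure IsSimplePolygon {k : ℕ} (z : ZMod k → ℂ) : Prop where
  four_le : 4 ≤ k
  injective : Function.Injective z
  disjoint_edges : ∀ i j : ZMod k, i ≠ j → i ≠ j + 1 → j ≠ i + 1 →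
    segment ℝ (z i) (z (i + 1)) ∩ segment ℝ (z j) (z (j + 1)) = ∅
  inter_next : ∀ i : ZMod k,
    segment ℝ (z i) (z (i + 1)) ∩ segment ℝ (z (i + 1)) (z (i + 2)) = {z (i + 1)}

/-- The union of the edges of a closed polygon. -/
def polygonTrace {k : ℕ} (z : ZMod k → ℂ) : Set ℂ := ⋃ i, segment ℝ (z i) (z (i + 1))

/-- The total angle swept by a closed polygon as seen from `x`: away from the polygon this is
`2π` times the winding number. -/
noncomputable def totalAngle {k : ℕ} [NeZero k] (z : ZMod k → ℂ) (x : ℂ) : ℝ :=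
  ∑ j, viewAngle (z j) (z (j + 1)) x

/-- The angles under which the edges not adjacent to the vertex `z (i + 1)` are seen from it. -/
noncomputable def farAngle {k : ℕ} [NeZero k] (z : ZMod k → ℂ) (i : ZMod k) : ℝ :=
  ∑ j ∈ Finset.univ \ {i, i + 1}, viewAngle (z j) (z (j + 1)) (z (i + 1))

section Polygon

variable {k : ℕ} {z : ZMod k → ℂ}

theorem vertex_mem_polygonTrace (i : ZMod k) : z i ∈ polygonTrace z :=
  mem_iUnion.2 ⟨i, left_mem_segment ℝ _ _⟩

theorem planeEquivComplex_mem_polygonTrace {v : ZMod k → Fin 2 → ℝ} {x : Fin 2 → ℝ} :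
    planeEquivComplex x ∈ polygonTrace (fun i => planeEquivComplex (v i)) ↔
      x ∈ ⋃ i, segment ℝ (v i) (v (i + 1)) := by
  simp only [polygonTrace, mem_iUnion, planeEquivComplex_mem_segment]

theorem IsSimplePolygon.natCast_ne_zero {n : ℕ} (hz : IsSimplePolygon z) (h0 : 0 < n)
    (h4 : n < 4) : (n : ZMod k) ≠ 0 := by
  rw [Ne, ZMod.natCast_eq_zero_iff]
  intro h
  have := Nat.le_of_dvd h0 h
  have := hz.four_le
  omega

namespace IsSimplePolygon

theorem one_ne_zero (hz : IsSimplePolygon z) : (1 : ZMod k) ≠ 0 := by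
  simpa using hz.natCast_ne_zero (n := 1) (by norm_num) (by norm_num)

theorem two_ne_zero (hz : IsSimplePolygon z) : (2 : ZMod k) ≠ 0 := by
  simpa using hz.natCast_ne_zero (n := 2) (by norm_num) (by norm_num)

theorem three_ne_zero (hz : IsSimplePolygon z) : (3 : ZMod k) ≠ 0 := by
  simpa using hz.natCast_ne_zero (n := 3) (by norm_num) (by norm_num)

theorem vertex_ne_next (hz : IsSimplePolygon z) (i : ZMod k) : z i ≠ z (i + 1) := fun h =>
  hz.one_ne_zero (by linear_combination -hz.injective h)

theorem vertex_ne_next_next (hz : IsSimplePolygon z) (i : ZMod k) : z i ≠ z (i + 2) := fun h =>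
  hz.two_ne_zero (by linear_combination -hz.injective h)

theorem next_ne_next_next (hz : IsSimplePolygon z) (i : ZMod k) : z (i + 1) ≠ z (i + 2) :=
  fun h => hz.one_ne_zero (by linear_combination -hz.injective h)

theorem vertex_notMem_segment (hz : IsSimplePolygon z) {i j : ZMod k} (h1 : j ≠ i)
    (h2 : j ≠ i + 1) : z (i + 1) ∉ segment ℝ (z j) (z (j + 1)) := by
  intro h
  by_cases h3 : i = j + 1
  · have hd := hz.disjoint_edges (i + 1) j h2.symm
      (fun e => hz.one_ne_zero (by linear_combination e - h3))
      (fun e => hz.three_ne_zero (by linear_combination -e - h3))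
    exact (Set.ext_iff.1 hd (z (i + 1))).1 ⟨left_mem_segment ℝ _ _, h⟩
  · have hd := hz.disjoint_edges i j h1.symm h3 h2
    exact (Set.ext_iff.1 hd (z (i + 1))).1 ⟨right_mem_segment ℝ _ _, h⟩

theorem vertex_notMem_openSegment (hz : IsSimplePolygon z) (i j : ZMod k) :
    z j ∉ openSegment ℝ (z i) (z (i + 1)) := by
  intro h
  by_cases h1 : j = i
  · rw [h1, left_mem_openSegment_iff] at h
    exact hz.vertex_ne_next i h
  by_cases h2 : j = i + 1
  · rw [h2, right_mem_openSegment_iff] at h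
    exact hz.vertex_ne_next i h
  have h3 : z (j - 1 + 1) ∉ segment ℝ (z i) (z (i + 1)) :=
    hz.vertex_notMem_segment (fun e => h2 (by rw [e]; ring)) (fun e => h1 (by rw [e]; ring))
  rw [sub_add_cancel] at h3
  exact h3 (openSegment_subset_segment ℝ _ _ h)

theorem mem_openSegment_notMem_segment (hz : IsSimplePolygon z) {i j : ZMod k} (h1 : j ≠ i)
    {x : ℂ} (hx : x ∈ openSegment ℝ (z i) (z (i + 1))) : x ∉ segment ℝ (z j) (z (j + 1)) := by
  intro h
  have hx' := openSegment_subset_segment ℝ _ _ hx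
  have hv : ∀ j, z j ≠ x := fun j e => hz.vertex_notMem_openSegment i j (e ▸ hx)
  by_cases h2 : j = i + 1
  · have e : i + 1 + 1 = i + 2 := by ring
    rw [h2, e] at h
    exact hv _ (((Set.ext_iff.1 (hz.inter_next i) x).1 ⟨hx', h⟩).symm)
  by_cases h3 : i = j + 1
  · have e : j + 1 + 1 = j + 2 := by ring
    rw [h3, e] at hx'
    exact hv _ (((Set.ext_iff.1 (hz.inter_next j) x).1 ⟨h, hx'⟩).symm)
  exact (Set.ext_iff.1 (hz.disjoint_edges i j h1.symm h3 h2) x).1 ⟨hx', h⟩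

/-- Consecutive edges of a simple polygon do not fold back onto each other. -/
theorem edge_div_edge_mem_slitPlane (hz : IsSimplePolygon z) (i : ZMod k) :
    (z (i + 2) - z (i + 1)) / (z (i + 1) - z i) ∈ slitPlane := by
  by_contra h
  obtain ⟨r, hr, e⟩ := exists_eq_neg_mul_of_div_notMem_slitPlane
    (sub_ne_zero.2 (hz.vertex_ne_next i).symm) h
  have hadj := Set.ext_iff.1 (hz.inter_next i)
  rcases le_total r 1 with h1 | h1
  · refine hz.next_ne_next_next i ((hadj (z (i + 2))).1 ⟨?_, right_mem_segment ℝ _ _⟩).symm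
    refine ⟨r, 1 - r, hr, by linarith, by ring, ?_⟩
    simp only [real_smul]
    push_cast
    linear_combination -e
  · refine hz.vertex_ne_next i ((hadj (z i)).1 ⟨left_mem_segment ℝ _ _, ?_⟩)
    have hr0 : 0 < r := by linarith
    have hr0' : (r : ℂ) ≠ 0 := by exact_mod_cast hr0.ne'
    refine ⟨1 - r⁻¹, r⁻¹, sub_nonneg.2 (inv_le_one_of_one_le₀ h1), by positivity, by ring, ?_⟩
    simp only [real_smul]
    push_cast
    field_simp
    linear_combination e

end IsSimplePolygon

variable [NeZero k]

theorem sum_zmod_add_one {M : Type*} [AddCommMonoid M] (f : ZMod k → M) :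
    ∑ j, f (j + 1) = ∑ j, f j :=
  Equiv.sum_comp (Equiv.addRight (1 : ZMod k)) f

theorem coe_totalAngle {x : ℂ} (hx : ∀ i, z i ≠ x) : (totalAngle z x : Real.Angle) = 0 := by
  have h : ∀ j, (viewAngle (z j) (z (j + 1)) x : Real.Angle) =
      (arg (z (j + 1) - x) : Real.Angle) - arg (z j - x) := fun j =>
    arg_div_coe_angle (sub_ne_zero.2 (hx _)) (sub_ne_zero.2 (hx _))
  change Real.Angle.coeHom (totalAngle z x) = 0
  rw [totalAngle, map_sum]
  change ∑ j, (viewAngle (z j) (z (j + 1)) x : Real.Angle) = 0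
  simp only [h, Finset.sum_sub_distrib]
  rw [sum_zmod_add_one (fun j => (arg (z j - x) : Real.Angle)), sub_self]

theorem coe_totalAngle_of_notMem {x : ℂ} (hx : x ∉ polygonTrace z) :
    (totalAngle z x : Real.Angle) = 0 :=
  coe_totalAngle fun i h => hx (h ▸ vertex_mem_polygonTrace i)

theorem continuousAt_totalAngle {x : ℂ} (hx : x ∉ polygonTrace z) :
    ContinuousAt (totalAngle z) x := by
  unfold totalAngle
  refine tendsto_finsetSum _ fun j _ => continuousAt_viewAngle fun h => hx ?_
  exact mem_iUnion.2 ⟨j, h⟩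

theorem totalAngle_eq_of_isPreconnected {s : Set ℂ} (hs : IsPreconnected s)
    (hd : Disjoint s (polygonTrace z)) {x y : ℂ} (hx : x ∈ s) (hy : y ∈ s) :
    totalAngle z x = totalAngle z y := by
  have h : ∀ w ∈ s, w ∉ polygonTrace z := fun w hw => disjoint_left.1 hd hw
  exact eq_of_isPreconnected_of_angle_eq_zero hs
    (fun w hw => (continuousAt_totalAngle (h w hw)).continuousWithinAt)
    (fun w hw => coe_totalAngle_of_notMem (h w hw)) hx hy

theorem isCompact_polygonTrace (z : ZMod k → ℂ) : IsCompact (polygonTrace z) := by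
  refine isCompact_iUnion fun i => ?_
  rw [segment_eq_image]
  exact isCompact_Icc.image (by fun_prop)

theorem eventually_totalAngle_eq_zero (z : ZMod k → ℂ) :
    ∀ᶠ x in Bornology.cobounded ℂ, x ∉ polygonTrace z ∧ totalAngle z x = 0 := by
  have h : Tendsto (totalAngle z) (Bornology.cobounded ℂ) (𝓝 0) := by
    have := tendsto_finsetSum Finset.univ
      fun (j : ZMod k) _ => tendsto_viewAngle_cobounded (z j) (z (j + 1))
    rwa [Finset.sum_const_zero] at this
  have hb : ∀ᶠ x in Bornology.cobounded ℂ, x ∉ polygonTrace z :=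
    Bornology.isBounded_def.1 (isCompact_polygonTrace z).isBounded
  filter_upwards [hb, h (Ioo_mem_nhds (neg_lt_zero.2 Real.two_pi_pos) Real.two_pi_pos)]
    with x hx hx2
  refine ⟨hx, ?_⟩
  obtain ⟨n, hn⟩ := Real.Angle.coe_eq_zero_iff.1 (coe_totalAngle_of_notMem hx)
  rw [mem_preimage, ← hn, zsmul_eq_mul, mem_Ioo] at hx2
  have hpi := Real.two_pi_pos
  have h1 : (n : ℝ) < 1 := by nlinarith
  have h2 : (-1 : ℝ) < n := by nlinarith
  have : n = 0 := by
    have h1 : n < 1 := by exact_mod_cast h1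
    have h2 : -1 < n := by exact_mod_cast h2
    omega
  rw [← hn, this, zero_smul]

namespace IsSimplePolygon

theorem tendsto_totalAngle_vertex (hz : IsSimplePolygon z) (i : ZMod k) {u : ℂ} (hu : u ≠ 0)
    (h1 : u = z i - z (i + 1) ∨ u / (z (i + 1) - z i) ∈ slitPlane)
    (h2 : u = z (i + 2) - z (i + 1) ∨ -(z (i + 2) - z (i + 1)) / u ∈ slitPlane) :
    Tendsto (fun t : ℝ => totalAngle z (z (i + 1) + t * u)) (𝓝[>] 0)
      (𝓝 (farAngle z i + arg (u / (z (i + 1) - z i)) + arg (-(z (i + 2) - z (i + 1)) / u))) := by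
  have hne : i ≠ i + 1 := fun e => hz.one_ne_zero (by linear_combination -e)
  have hsum : ∀ x, totalAngle z x = ∑ j ∈ Finset.univ \ {i, i + 1}, viewAngle (z j) (z (j + 1)) x +
      viewAngle (z i) (z (i + 1)) x + viewAngle (z (i + 1)) (z (i + 2)) x := by
    intro x
    rw [totalAngle, ← Finset.sum_sdiff (Finset.subset_univ {i, i + 1}), Finset.sum_pair hne,
      add_assoc i 1 1, one_add_one_eq_two, add_assoc]
  simp only [hsum]
  refine Tendsto.add (Tendsto.add ?_ ?_) ?_
  · refine tendsto_finsetSum _ fun j hj => ?_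
    simp only [Finset.mem_sdiff, Finset.mem_univ, true_and, Finset.mem_insert,
      Finset.mem_singleton, not_or] at hj
    have hc := (continuousAt_viewAngle (hz.vertex_notMem_segment hj.1 hj.2)).tendsto
    have ht : Tendsto (fun t : ℝ => z (i + 1) + t * u) (𝓝[>] 0) (𝓝 (z (i + 1))) := by
      have : Continuous (fun t : ℝ => z (i + 1) + t * u) := by fun_prop
      simpa using (this.tendsto 0).mono_left (nhdsWithin_le_nhds (s := Ioi 0))
    exact hc.comp ht
  · exact tendsto_viewAngle_add_right (hz.vertex_ne_next i) h1
  · exact tendsto_viewAngle_add_left (hz.next_ne_next_next i) hu h2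

theorem totalAngle_edge (hz : IsSimplePolygon z) {i : ZMod k} {x : ℂ}
    (hx : x ∈ openSegment ℝ (z i) (z (i + 1))) :
    totalAngle z x = ∑ j ∈ Finset.univ \ {i}, viewAngle (z j) (z (j + 1)) x + Real.pi := by
  rw [totalAngle, ← Finset.sum_sdiff (Finset.subset_univ {i}), Finset.sum_singleton,
    viewAngle_of_mem_openSegment (hz.vertex_ne_next i) hx]

theorem continuousAt_sum_viewAngle_edge (hz : IsSimplePolygon z) {i : ZMod k} {x : ℂ}
    (hx : x ∈ openSegment ℝ (z i) (z (i + 1))) :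
    ContinuousAt (fun x => ∑ j ∈ Finset.univ \ {i}, viewAngle (z j) (z (j + 1)) x) x := by
  refine tendsto_finsetSum _ fun j hj => continuousAt_viewAngle ?_
  exact hz.mem_openSegment_notMem_segment (by simpa using hj) hx

theorem totalAngle_eq_of_mem_edge (hz : IsSimplePolygon z) {i : ZMod k} {x y : ℂ}
    (hx : x ∈ openSegment ℝ (z i) (z (i + 1))) (hy : y ∈ openSegment ℝ (z i) (z (i + 1))) :
    totalAngle z x = totalAngle z y := by
  refine eq_of_isPreconnected_of_angle_eq_zero (convex_openSegment _ _).isPreconnected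
    (fun w hw => ?_) (fun w hw => ?_) hx hy
  · refine ContinuousWithinAt.congr ?_ (fun v hv => hz.totalAngle_edge hv) (hz.totalAngle_edge hw)
    exact ((hz.continuousAt_sum_viewAngle_edge hw).add_const Real.pi).continuousWithinAt
  · exact coe_totalAngle fun j e => hz.vertex_notMem_openSegment i j (e ▸ hw)

theorem totalAngle_edge_eq_vertex_left (hz : IsSimplePolygon z) {i : ZMod k} {x : ℂ}
    (hx : x ∈ openSegment ℝ (z i) (z (i + 1))) :
    totalAngle z x = farAngle z i + Real.pi +
      arg ((z (i + 2) - z (i + 1)) / (z (i + 1) - z i)) := by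
  have hne : z (i + 1) - z i ≠ 0 := sub_ne_zero.2 (hz.vertex_ne_next i).symm
  have e2 : -(z (i + 2) - z (i + 1)) / (z i - z (i + 1)) =
      (z (i + 2) - z (i + 1)) / (z (i + 1) - z i) := by
    rw [← neg_div_neg_eq]; simp
  have e1 : (z i - z (i + 1)) / (z (i + 1) - z i) = -1 := by field_simp; ring
  have h := hz.tendsto_totalAngle_vertex i (u := z i - z (i + 1))
    (sub_ne_zero.2 (hz.vertex_ne_next i)) (Or.inl rfl)
    (Or.inr (e2 ▸ hz.edge_div_edge_mem_slitPlane i))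
  rw [e1, e2, arg_neg_one] at h
  refine tendsto_nhds_unique (tendsto_const_nhds.congr' ?_) h
  filter_upwards [self_mem_nhdsWithin, mem_nhdsWithin_of_mem_nhds (Iio_mem_nhds one_pos)]
    with t ht ht1
  refine hz.totalAngle_eq_of_mem_edge hx ⟨t, 1 - t, ht, sub_pos.2 ht1, by ring, ?_⟩
  simp only [real_smul]
  push_cast
  ring

theorem totalAngle_edge_eq_vertex_right (hz : IsSimplePolygon z) {i : ZMod k} {x : ℂ}
    (hx : x ∈ openSegment ℝ (z (i + 1)) (z (i + 2))) :
    totalAngle z x = farAngle z i + arg ((z (i + 2) - z (i + 1)) / (z (i + 1) - z i)) +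
      Real.pi := by
  have hne : z (i + 2) - z (i + 1) ≠ 0 := sub_ne_zero.2 (hz.next_ne_next_next i).symm
  have e1 : -(z (i + 2) - z (i + 1)) / (z (i + 2) - z (i + 1)) = -1 := by field_simp
  have h := hz.tendsto_totalAngle_vertex i (u := z (i + 2) - z (i + 1)) hne
    (Or.inr (hz.edge_div_edge_mem_slitPlane i)) (Or.inl rfl)
  rw [e1, arg_neg_one] at h
  refine tendsto_nhds_unique (tendsto_const_nhds.congr' ?_) h
  filter_upwards [self_mem_nhdsWithin, mem_nhdsWithin_of_mem_nhds (Iio_mem_nhds one_pos)]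
    with t ht ht1
  have e : i + 1 + 1 = i + 2 := by ring
  refine hz.totalAngle_eq_of_mem_edge (i := i + 1) (by rwa [e])
    ⟨1 - t, t, sub_pos.2 ht1, ht, by ring, ?_⟩
  rw [e]
  simp only [real_smul]
  push_cast
  ring

/-- The total angle takes a common value on all the open edges of a simple polygon. -/
theorem exists_totalAngle_edge_eq (hz : IsSimplePolygon z) :
    ∃ L : ℝ, (L : Real.Angle) = 0 ∧
      ∀ i, ∀ x ∈ openSegment ℝ (z i) (z (i + 1)), totalAngle z x = L := by
  have hmid : ∀ i, midpoint ℝ (z i) (z (i + 1)) ∈ openSegment ℝ (z i) (z (i + 1)) := fun i =>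
    midpoint_mem_openSegment _ _
  set m : ZMod k → ℂ := fun i => midpoint ℝ (z i) (z (i + 1)) with hm
  have hstep : ∀ i, totalAngle z (m (i + 1)) = totalAngle z (m i) := by
    intro i
    have e : i + 1 + 1 = i + 2 := by ring
    rw [hz.totalAngle_edge_eq_vertex_left (hmid i),
      hz.totalAngle_edge_eq_vertex_right (i := i) (e ▸ hmid (i + 1))]
    ring
  have hall : ∀ n : ℕ, totalAngle z (m n) = totalAngle z (m 0) := by
    intro n
    induction n with
    | zero => simp
    | succ n ih => rw [Nat.cast_succ, hstep, ih]
  refine ⟨totalAngle z (m 0), ?_, fun i x hx => ?_⟩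
  · exact coe_totalAngle fun j e => hz.vertex_notMem_openSegment 0 j (e ▸ hmid 0)
  · rw [hz.totalAngle_eq_of_mem_edge hx (hmid i), ← ZMod.natCast_zmod_val i]
    exact hall _

end IsSimplePolygon

namespace IsSimplePolygon

/-- The value of the total angle at a point from which a vertex is visible. -/
theorem totalAngle_of_vertex_visible (hz : IsSimplePolygon z) (i : ZMod k) {x : ℂ}
    (hx : x ∉ polygonTrace z) (hd : Disjoint (openSegment ℝ (z (i + 1)) x) (polygonTrace z)) :
    (x - z (i + 1)) / (z (i + 1) - z i) ∈ slitPlane ∧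
      -(z (i + 2) - z (i + 1)) / (x - z (i + 1)) ∈ slitPlane ∧
      totalAngle z x = farAngle z i + arg ((x - z (i + 1)) / (z (i + 1) - z i)) +
        arg (-(z (i + 2) - z (i + 1)) / (x - z (i + 1))) := by
  have hu : x - z (i + 1) ≠ 0 := by
    rw [sub_ne_zero]
    rintro rfl
    exact hx (vertex_mem_polygonTrace _)
  have hα : z (i + 1) - z i ≠ 0 := sub_ne_zero.2 (hz.vertex_ne_next i).symm
  have hβ : z (i + 2) - z (i + 1) ≠ 0 := sub_ne_zero.2 (hz.next_ne_next_next i).symm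
  have e12 : i + 1 + 1 = i + 2 := by ring
  have hmem : ∀ t : ℝ, 0 < t → t < 1 →
      z (i + 1) + t * (x - z (i + 1)) ∈ openSegment ℝ (z (i + 1)) x := by
    intro t h0 h1
    refine ⟨1 - t, t, sub_pos.2 h1, h0, by ring, ?_⟩
    simp only [real_smul]
    push_cast
    ring
  have h1 : (x - z (i + 1)) / (z (i + 1) - z i) ∈ slitPlane := by
    by_contra h
    obtain ⟨r, hr, e⟩ := exists_eq_neg_mul_of_div_notMem_slitPlane hα h
    have hr0 : 0 < r := hr.lt_of_ne (by rintro rfl; simp [hu] at e)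
    refine disjoint_left.1 hd (hmem (1 / (1 + r)) (by positivity)
      ((div_lt_one (by positivity)).2 (by linarith))) (mem_iUnion.2 ⟨i, ?_⟩)
    refine ⟨r / (1 + r), 1 / (1 + r), by positivity, by positivity, by field_simp; ring, ?_⟩
    have : (1 + r : ℂ) ≠ 0 := by exact_mod_cast (by positivity : (0 : ℝ) < 1 + r).ne'
    rw [e]
    simp only [real_smul]
    push_cast
    field_simp
    ring
  have h2 : -(z (i + 2) - z (i + 1)) / (x - z (i + 1)) ∈ slitPlane := by
    by_contra h
    obtain ⟨r, hr, e⟩ := exists_eq_neg_mul_of_div_notMem_slitPlane hu h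
    have hr0 : 0 < r := hr.lt_of_ne (by rintro rfl; rw [neg_eq_iff_eq_neg] at e; simp [hβ] at e)
    refine disjoint_left.1 hd (hmem (r / (1 + r)) (by positivity)
      ((div_lt_one (by positivity)).2 (by linarith))) (mem_iUnion.2 ⟨i + 1, ?_⟩)
    rw [e12]
    refine ⟨r / (1 + r), 1 / (1 + r), by positivity, by positivity, by field_simp; ring, ?_⟩
    have : (1 + r : ℂ) ≠ 0 := by exact_mod_cast (by positivity : (0 : ℝ) < 1 + r).ne'
    simp only [real_smul]
    push_cast
    field_simp
    linear_combination -e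
  refine ⟨h1, h2, ?_⟩
  refine tendsto_nhds_unique (tendsto_const_nhds.congr' ?_)
    (hz.tendsto_totalAngle_vertex i hu (Or.inr h1) (Or.inr h2))
  have hpre : IsPreconnected
      ((fun t : ℝ => z (i + 1) + t * (x - z (i + 1))) '' Ioc 0 1) :=
    isPreconnected_Ioc.image _ (by fun_prop)
  have hdis : Disjoint ((fun t : ℝ => z (i + 1) + t * (x - z (i + 1))) '' Ioc 0 1)
      (polygonTrace z) := by
    rw [disjoint_left]
    rintro _ ⟨t, ht, rfl⟩
    rcases ht.2.lt_or_eq with h | h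
    · exact disjoint_left.1 hd (hmem t ht.1 h)
    · simpa [h] using hx
  filter_upwards [self_mem_nhdsWithin, mem_nhdsWithin_of_mem_nhds (Iio_mem_nhds one_pos)]
    with t ht ht1
  exact totalAngle_eq_of_isPreconnected hpre hdis ⟨1, by simp, by simp⟩
    ⟨t, ⟨ht, ht1.le⟩, rfl⟩

theorem totalAngle_of_edge_visible (hz : IsSimplePolygon z) {i : ZMod k} {m x : ℂ}
    (hm : m ∈ openSegment ℝ (z i) (z (i + 1)))
    (hx : x ∉ polygonTrace z) (hd : Disjoint (openSegment ℝ m x) (polygonTrace z)) :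
    |totalAngle z x - totalAngle z m + Real.pi| ≤ Real.pi := by
  have hpre : IsPreconnected ((fun t : ℝ => m + t * (x - m)) '' Ioc 0 1) :=
    isPreconnected_Ioc.image _ (by fun_prop)
  have hdis : Disjoint ((fun t : ℝ => m + t * (x - m)) '' Ioc 0 1) (polygonTrace z) := by
    rw [disjoint_left]
    rintro _ ⟨t, ht, rfl⟩
    rcases ht.2.lt_or_eq with h | h
    · refine disjoint_left.1 hd ⟨1 - t, t, sub_pos.2 h, ht.1, by ring, ?_⟩
      simp only [real_smul]
      push_cast
      ring
    · simpa [h] using hx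
  have ht : Tendsto (fun t : ℝ => m + t * (x - m)) (𝓝[>] 0) (𝓝 m) := by
    have : Continuous (fun t : ℝ => m + t * (x - m)) := by fun_prop
    simpa using (this.tendsto 0).mono_left (nhdsWithin_le_nhds (s := Ioi 0))
  have hlim := ((hz.continuousAt_sum_viewAngle_edge hm).tendsto.comp ht).const_sub (totalAngle z x)
  have hval : totalAngle z x - ∑ j ∈ Finset.univ \ {i}, viewAngle (z j) (z (j + 1)) m =
      totalAngle z x - totalAngle z m + Real.pi := by
    rw [hz.totalAngle_edge hm]; ring
  rw [hval] at hlim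
  refine le_of_tendsto hlim.abs ?_
  filter_upwards [self_mem_nhdsWithin, mem_nhdsWithin_of_mem_nhds (Iio_mem_nhds one_pos)]
    with t ht ht1
  have hW : totalAngle z x = totalAngle z (m + t * (x - m)) :=
    totalAngle_eq_of_isPreconnected hpre hdis ⟨1, by simp, by simp⟩ ⟨t, ⟨ht, ht1.le⟩, rfl⟩
  have : totalAngle z x - ((fun y => ∑ j ∈ Finset.univ \ {i}, viewAngle (z j) (z (j + 1)) y) ∘
      fun t : ℝ => m + t * (x - m)) t = viewAngle (z i) (z (i + 1)) (m + t * (x - m)) := by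
    rw [hW, totalAngle, ← Finset.sum_sdiff (Finset.subset_univ {i}), Finset.sum_singleton]
    simp
  rw [this]
  exact abs_arg_le_pi _

end IsSimplePolygon

namespace IsSimplePolygon

/-- A simple polygon has winding numbers in `{0, 1}` or in `{-1, 0}`; the parameter `L` is the
total angle on the left side of the polygon. -/
theorem exists_left_totalAngle (hz : IsSimplePolygon z) :
    ∃ L : ℝ, (L = 0 ∨ L = 2 * Real.pi) ∧
      (∀ i, farAngle z i + Real.pi + arg ((z (i + 2) - z (i + 1)) / (z (i + 1) - z i)) = L) ∧
      ∀ x ∉ polygonTrace z, totalAngle z x = L ∨ totalAngle z x = L - 2 * Real.pi := by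
  have hpi := Real.pi_pos
  obtain ⟨L, hL0, hL⟩ := hz.exists_totalAngle_edge_eq
  have hmid : ∀ i, midpoint ℝ (z i) (z (i + 1)) ∈ openSegment ℝ (z i) (z (i + 1)) := fun i =>
    midpoint_mem_openSegment _ _
  have hV : ∀ i, farAngle z i + Real.pi +
      arg ((z (i + 2) - z (i + 1)) / (z (i + 1) - z i)) = L := fun i => by
    rw [← hz.totalAngle_edge_eq_vertex_left (hmid i), hL i _ (hmid i)]
  have hW : ∀ x ∉ polygonTrace z, totalAngle z x = L ∨ totalAngle z x = L - 2 * Real.pi := by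
    intro x hx
    obtain ⟨m, hm, hd⟩ := exists_mem_disjoint_openSegment (isCompact_polygonTrace z)
      ⟨_, vertex_mem_polygonTrace 0⟩ hx
    have hx0 := coe_totalAngle_of_notMem hx
    have hvert : ∀ j, m ≠ z j → m ≠ z (j + 1) → m ∈ segment ℝ (z j) (z (j + 1)) →
        totalAngle z x = L ∨ totalAngle z x = L - 2 * Real.pi := by
      intro j h1 h2 h3
      have hmo := mem_openSegment_of_ne_left_right h1.symm h2.symm h3
      have := abs_le.1 (hz.totalAngle_of_edge_visible hmo hx hd)
      rw [hL j m hmo] at this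
      exact eq_or_eq_sub_two_pi hx0 hL0 (by linarith) (by linarith)
    by_cases hv : ∃ i, m = z i
    · obtain ⟨i, rfl⟩ := hv
      obtain ⟨i, rfl⟩ : ∃ j, i = j + 1 := ⟨i - 1, by ring⟩
      obtain ⟨s1, s2, e⟩ := hz.totalAngle_of_vertex_visible i hx hd
      have a1 := arg_mem_Ioo_of_mem_slitPlane s1
      have a2 := arg_mem_Ioo_of_mem_slitPlane s2
      have a3 := arg_mem_Ioo_of_mem_slitPlane (hz.edge_div_edge_mem_slitPlane i)
      have := hV i
      exact eq_or_eq_sub_two_pi hx0 hL0 (by linarith [a1.2, a2.2, a3.1])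
        (by linarith [a1.1, a2.1, a3.2])
    · push Not at hv
      obtain ⟨j, hj⟩ := mem_iUnion.1 hm
      exact hvert j (hv _) (hv _) hj
  refine ⟨L, ?_, hV, hW⟩
  obtain ⟨x, hx, hx0⟩ := (eventually_totalAngle_eq_zero z).exists
  rcases hW x hx with h | h
  · left; linarith
  · right; linarith

/-- At a vertex of largest modulus of a positively oriented simple polygon, the polygon turns
left. -/
theorem exists_arg_pos (hz : IsSimplePolygon z)
    (hV : ∀ i, farAngle z i + arg ((z (i + 2) - z (i + 1)) / (z (i + 1) - z i)) = Real.pi) :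
    ∃ i, 0 < arg ((z (i + 2) - z (i + 1)) / (z (i + 1) - z i)) := by
  obtain ⟨i, -, hi⟩ := Finset.exists_max_image Finset.univ (fun i => ‖z i‖) ⟨0, Finset.mem_univ _⟩
  obtain ⟨i, rfl⟩ : ∃ j, i = j + 1 := ⟨i - 1, by ring⟩
  refine ⟨i, ?_⟩
  have hmax : ∀ j, ‖z j‖ ≤ ‖z (i + 1)‖ := fun j => hi j (Finset.mem_univ _)
  set b := z (i + 1) with hb
  have hsub : polygonTrace z ⊆ Metric.closedBall 0 ‖b‖ := by
    refine iUnion_subset fun j => (convex_closedBall _ _).segment_subset ?_ ?_ <;>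
      simpa using hmax _
  have hb0 : b ≠ 0 := by
    intro h0
    have h1 := hmax i
    rw [h0, norm_zero, norm_le_zero_iff, ← h0] at h1
    exact hz.vertex_ne_next i h1
  have hT : Tendsto (fun t : ℝ => (t : ℂ) * b) atTop (Bornology.cobounded ℂ) := by
    rw [← tendsto_norm_atTop_iff_cobounded]
    have : Tendsto (fun t : ℝ => |t| * ‖b‖) atTop atTop :=
      tendsto_abs_atTop_atTop.atTop_mul_const (norm_pos_iff.2 hb0)
    simpa using this
  obtain ⟨t, ⟨hx, hx0⟩, ht⟩ :=
    ((hT.eventually (eventually_totalAngle_eq_zero z)).and (eventually_gt_atTop 1)).exists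
  have hd : Disjoint (openSegment ℝ b (t * b)) (polygonTrace z) := by
    rw [disjoint_left]
    rintro _ ⟨p, q, hp, hq, hpq, rfl⟩ hy
    have := hsub hy
    have e : p • b + q • (t * b) = ((p + q * t : ℝ) : ℂ) * b := by
      simp only [real_smul]; push_cast; ring
    rw [e, mem_closedBall_zero_iff, norm_mul, norm_real, Real.norm_of_nonneg (by positivity)] at this
    have hbp := norm_pos_iff.2 hb0
    nlinarith [mul_pos hq (sub_pos.2 ht), mul_pos (mul_pos hq (sub_pos.2 ht)) hbp]
  obtain ⟨-, -, e⟩ := hz.totalAngle_of_vertex_visible i hx hd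
  rw [← hb, hx0] at e
  have hre : ∀ w : ℂ, w ≠ b → ‖w‖ ≤ ‖b‖ → 0 < ((b - w) / (t * b - b)).re ∧
      0 < ((t * b - b) / (b - w)).re := by
    intro w hw hn
    have h1 : 0 < (b - w).re * b.re + (b - w).im * b.im := by
      have h2 : ‖w‖ ^ 2 ≤ ‖b‖ ^ 2 := by gcongr
      have h3 : 0 < normSq (b - w) := normSq_pos.2 (sub_ne_zero.2 hw.symm)
      rw [← normSq_eq_norm_sq, ← normSq_eq_norm_sq] at h2
      simp only [normSq_apply, sub_re, sub_im] at h2 h3 ⊢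
      nlinarith
    have ht1 : 0 < t - 1 := sub_pos.2 ht
    have e1 : t * b - b = ((t - 1 : ℝ) : ℂ) * b := by push_cast; ring
    have hn1 : 0 < normSq (b - w) := normSq_pos.2 (sub_ne_zero.2 hw.symm)
    have hn2 : 0 < normSq (t * b - b) := by
      rw [e1]; exact normSq_pos.2 (mul_ne_zero (by exact_mod_cast ht1.ne') hb0)
    rw [div_re, div_re, ← add_div, ← add_div]
    refine ⟨div_pos ?_ hn2, div_pos ?_ hn1⟩ <;>
    · rw [e1, re_ofReal_mul, im_ofReal_mul]
      nlinarith
  have h1 := (hre (z i) (hz.vertex_ne_next i) (hmax _)).2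
  have h2 := (hre (z (i + 2)) (hz.next_ne_next_next i).symm (hmax _)).1
  have a1 := abs_lt.1 (abs_arg_lt_pi_div_two_iff.2 (Or.inl h1))
  have a2 := abs_lt.1 (abs_arg_lt_pi_div_two_iff.2 (Or.inl h2))
  rw [neg_sub] at e
  linarith [hV i, a1.1, a2.1]

end IsSimplePolygon

namespace IsSimplePolygon

theorem exists_diagonal_dichotomy (hz : IsSimplePolygon z)
    (hV : ∀ i, farAngle z i + arg ((z (i + 2) - z (i + 1)) / (z (i + 1) - z i)) = Real.pi) :
    ∃ i, 0 < complexCross (z (i + 1) - z i) (z (i + 2) - z (i + 1)) ∧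
      ((∀ x ∈ openSegment ℝ (z i) (z (i + 2)), x ∉ polygonTrace z ∧ totalAngle z x ≠ 0) ∨
        ∃ p ∈ polygonTrace z, p ∈ segment ℝ (z i) (z (i + 2)) ∧ p ≠ z i ∧ p ≠ z (i + 2)) := by
  by_contra! hcon
  have hbad : ∀ i, 0 < complexCross (z (i + 1) - z i) (z (i + 2) - z (i + 1)) →
      Disjoint (openSegment ℝ (z i) (z (i + 2))) (polygonTrace z) ∧
        ∃ x ∈ openSegment ℝ (z i) (z (i + 2)), x ∉ polygonTrace z ∧ totalAngle z x = 0 := by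
    intro i hi
    obtain ⟨⟨x, hx, hx0⟩, hB⟩ := hcon i hi
    have hd : Disjoint (openSegment ℝ (z i) (z (i + 2))) (polygonTrace z) := by
      rw [disjoint_left]
      intro y hy hyt
      have hne := hz.vertex_ne_next_next i
      have h1 : y ≠ z i := by
        rintro rfl
        exact hne (left_mem_openSegment_iff.1 hy)
      have h2 : y ≠ z (i + 2) := by
        rintro rfl
        exact hne (right_mem_openSegment_iff.1 hy)
      exact h2 (hB y hyt (openSegment_subset_segment ℝ _ _ hy) h1)
    have hxt := disjoint_left.1 hd hx
    exact ⟨hd, x, hx, hxt, hx0 hxt⟩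
  obtain ⟨i, hi⟩ := hz.exists_arg_pos hV
  have hci : 0 < complexCross (z (i + 1) - z i) (z (i + 2) - z (i + 1)) :=
    (div_im_pos_iff (sub_ne_zero.2 (hz.vertex_ne_next i).symm)).1
      (im_pos_of_arg_pos (hz.edge_div_edge_mem_slitPlane i) hi)
  obtain ⟨j, rfl⟩ : ∃ j, i = j + 1 := ⟨i - 1, by ring⟩
  obtain ⟨hd, x, hx, hxt, hx0⟩ := hbad _ hci
  have hV1 := hV j
  have hV2 := hV (j + 1)
  have hslit1 := hz.edge_div_edge_mem_slitPlane j
  obtain ⟨s1, s2, e⟩ := hz.totalAngle_of_vertex_visible j hxt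
    (hd.mono_left (openSegment_subset_of_mem_openSegment hx))
  have hedge := hz.disjoint_edges j (j + 2)
    (fun e => hz.two_ne_zero (by linear_combination -e))
    (fun e => hz.three_ne_zero (by linear_combination -e))
    (fun e => hz.one_ne_zero (by linear_combination e))
  have hdα := hz.vertex_ne_next j
  have hbα := hz.next_ne_next_next j
  have hvis := fun {y} => hz.totalAngle_of_vertex_visible (j + 1) (x := y)
  have hbadj := hbad j
  have e2 : j + 1 + 1 = j + 2 := by ring
  have e3 : j + 1 + 2 = j + 3 := by ring
  have e4 : j + 2 + 1 = j + 3 := by ring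
  simp only [e2, e3] at hci hx hd hV2
  rw [e4] at hedge
  simp only [e2, e3] at hvis
  clear hbad hcon
  set d := z j
  set a := z (j + 1)
  set b := z (j + 2)
  set c := z (j + 3)
  have hD : 0 < complexCross (b - a) (c - a) := by
    simp only [complexCross, sub_re, sub_im] at hci ⊢; linarith
  have hα : a - d ≠ 0 := sub_ne_zero.2 hdα.symm
  have hβ : b - a ≠ 0 := sub_ne_zero.2 hbα.symm
  have hu : x - a ≠ 0 := by
    rw [sub_ne_zero]
    rintro rfl
    exact hxt (vertex_mem_polygonTrace _)
  obtain ⟨p, q, hp, hq, hpq, rfl⟩ := hx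
  have hxa : p • a + q • c - a = q • (c - a) := by
    have : p = 1 - q := by linarith
    subst this
    module
  rw [hxa] at s1 s2 e hu
  have hpos : 0 < arg (-(b - a) / (q • (c - a))) := by
    refine arg_pos_of_im_pos ((div_im_pos_iff hu).2 ?_)
    simp only [complexCross, sub_re, sub_im, neg_re, neg_im, smul_re, smul_im, smul_eq_mul] at hD ⊢
    nlinarith
  have a1 := arg_mem_Ioo_of_mem_slitPlane s1
  have a2 := arg_mem_Ioo_of_mem_slitPlane s2
  have a3 := arg_mem_Ioo_of_mem_slitPlane hslit1
  have hneg : complexCross (a - d) (c - a) < 0 := by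
    have := (div_im_neg_iff hα).1 (arg_neg_iff.1 (by linarith [a3.2] :
      arg (q • (c - a) / (a - d)) < 0))
    simp only [complexCross, sub_re, sub_im, smul_re, smul_im, smul_eq_mul] at this ⊢
    nlinarith
  have hcj : 0 < complexCross (a - d) (b - a) :=
    (div_im_pos_iff hα).1 (im_pos_of_arg_pos hslit1 (by linarith [a1.1]))
  -- the vertex `d` lies in the interior of the triangle `a`, `b`, `c`
  obtain ⟨l, m, hl, hm, hdl⟩ : ∃ l m : ℝ, 0 < l ∧ 0 < m ∧
      d = a + l * (b - a) + m * (c - a) := by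
    refine ⟨-complexCross (a - d) (c - a) / complexCross (b - a) (c - a),
      complexCross (a - d) (b - a) / complexCross (b - a) (c - a),
      div_pos (by linarith) hD, div_pos hcj hD, ?_⟩
    have hD' := hD.ne'
    apply Complex.ext <;>
    · simp only [add_re, add_im, re_ofReal_mul, im_ofReal_mul]
      field_simp
      simp only [complexCross, sub_re, sub_im]
      ring
  have hlm : l + m < 1 := by
    by_contra! h
    refine (Set.ext_iff.1 hedge (a + (l + m : ℂ)⁻¹ * (d - a))).1 ⟨?_, ?_⟩
    · have h0 : 0 < l + m := by linarith
      refine ⟨(l + m)⁻¹, 1 - (l + m)⁻¹, by positivity,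
        sub_nonneg.2 (inv_le_one_of_one_le₀ h), by ring, ?_⟩
      simp only [real_smul]
      push_cast
      ring
    · have h0 : 0 < l + m := by linarith
      have h0' : (l + m : ℂ) ≠ 0 := by exact_mod_cast h0.ne'
      refine ⟨l / (l + m), m / (l + m), by positivity, by positivity, by field_simp, ?_⟩
      rw [hdl]
      simp only [real_smul]
      push_cast
      field_simp
      ring
  obtain ⟨hd', y, hy, hyt, hy0⟩ := hbadj hcj
  rw [openSegment_symm] at hy hd'
  obtain ⟨t1, t2, f⟩ := hvis hyt (hd'.mono_left (openSegment_subset_of_mem_openSegment hy))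
  have hv : y - b ≠ 0 := by
    rw [sub_ne_zero]
    rintro rfl
    exact hyt (vertex_mem_polygonTrace _)
  obtain ⟨p', q', hp', hq', hpq', rfl⟩ := hy
  have hyb : p' • b + q' • d - b =
      (q' * (1 - l - m) : ℝ) * (a - b) + (q' * m : ℝ) * (c - b) := by
    have : p' = 1 - q' := by linarith
    subst this
    rw [hdl]
    simp only [real_smul]
    push_cast
    ring
  have h1 : 0 < q' * (1 - l - m) := mul_pos hq' (by linarith)
  have h2 : 0 < q' * m := mul_pos hq' hm
  rw [hyb] at f hv
  have b1 : 0 < arg (((q' * (1 - l - m) : ℝ) * (a - b) + (q' * m : ℝ) * (c - b)) / (b - a)) := by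
    refine arg_pos_of_im_pos ((div_im_pos_iff hβ).2 ?_)
    simp only [complexCross, sub_re, sub_im, add_re, add_im, re_ofReal_mul, im_ofReal_mul] at hci ⊢
    nlinarith
  have b2 : 0 < arg (-(c - b) / ((q' * (1 - l - m) : ℝ) * (a - b) + (q' * m : ℝ) * (c - b))) := by
    refine arg_pos_of_im_pos ((div_im_pos_iff hv).2 ?_)
    simp only [complexCross, sub_re, sub_im, add_re, add_im, re_ofReal_mul, im_ofReal_mul,
      neg_re, neg_im] at hci ⊢
    nlinarith
  have := arg_le_pi ((c - b) / (b - a))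
  linarith

end IsSimplePolygon

theorem sum_heightCrossing (z : ZMod k → ℂ) (t : ℝ) :
    ∑ j, heightCrossing (z j) (z (j + 1)) t = 0 := by
  simp only [heightCrossing, Finset.sum_sub_distrib]
  rw [sum_zmod_add_one fun j => if t ≤ (z j).im then (1 : ℝ) else 0, sub_self]

theorem totalAngle_eq_sum_heightCrossing {x : ℂ} (hx : x ∉ polygonTrace z)
    (hz : ∀ j, (z j).im ≠ x.im) :
    totalAngle z x = 2 * Real.pi * ∑ j, heightCrossing (z j) (z (j + 1)) x.im *
      if x.re ≤ lineRe (z j) (z (j + 1)) x.im then 1 else 0 := by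
  rw [totalAngle, Finset.sum_congr rfl fun j _ => viewAngle_eq_heightCrossing (hz j) (hz (j + 1))
    fun h => hx (mem_iUnion.2 ⟨j, h⟩), Finset.sum_add_distrib, Finset.sum_sub_distrib,
    sum_zmod_add_one fun j => arg (-(z j - x)), sub_self, zero_add, Finset.mul_sum]

/-- If a closed polygon winds nowhere positively, its signed width at each generic height is
nonpositive. -/
theorem sum_heightCrossing_mul_lineRe_nonpos (h : ∀ x ∉ polygonTrace z, totalAngle z x ≤ 0) {t : ℝ}
    (ht : ∀ j, (z j).im ≠ t) :
    ∑ j, heightCrossing (z j) (z (j + 1)) t * lineRe (z j) (z (j + 1)) t ≤ 0 := by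
  set X : ZMod k → ℝ := fun j => lineRe (z j) (z (j + 1)) t with hX
  set M : ℝ := ∑ j, |X j|
  have hM : ∀ j, |X j| ≤ M := fun j =>
    Finset.single_le_sum (f := fun j => |X j|) (fun i _ => abs_nonneg _) (Finset.mem_univ j)
  have hI := fun j => integral_mul_ite_le (continuous_const (y := (1 : ℝ)))
    (abs_le.1 (hM j)).1 (abs_le.1 (hM j)).2
  simp only [mul_one, intervalIntegral.integral_const, smul_eq_mul] at hI
  have hint : ∫ x in -M..M, ∑ j, heightCrossing (z j) (z (j + 1)) t * (if x ≤ X j then 1 else 0) =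
      ∑ j, heightCrossing (z j) (z (j + 1)) t * X j := by
    rw [intervalIntegral.integral_finsetSum fun j _ => (hI j).1.const_mul _]
    simp only [intervalIntegral.integral_const_mul, (hI _).2, sub_neg_eq_add, mul_add,
      Finset.sum_add_distrib, ← Finset.sum_mul, sum_heightCrossing, zero_mul, add_zero]
  rw [← hint, ← neg_nonneg, ← intervalIntegral.integral_neg]
  refine intervalIntegral.integral_nonneg_of_ae
    (neg_le_self (Finset.sum_nonneg fun i _ => abs_nonneg _)) ?_
  filter_upwards [(Set.finite_range X).countable.ae_notMem MeasureTheory.volume] with x hx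
  have hxz : (⟨x, t⟩ : ℂ) ∉ polygonTrace z := by
    intro hm
    obtain ⟨j, hj⟩ := mem_iUnion.1 hm
    exact hx ⟨j, (re_eq_lineRe_of_mem_segment (ht j) hj).symm⟩
  have h1 := h _ hxz
  rw [totalAngle_eq_sum_heightCrossing hxz ht] at h1
  rw [Pi.zero_apply, neg_nonneg]
  exact nonpos_of_mul_nonpos_right h1 Real.two_pi_pos

theorem integral_lineRe (p q : ℂ) :
    ∫ t in p.im..q.im, lineRe p q t = (q.im - p.im) * (p.re + q.re) / 2 := by
  by_cases h : q.im = p.im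
  · simp [h]
  have h' : q.im - p.im ≠ 0 := sub_ne_zero.2 h
  simp only [lineRe]
  rw [intervalIntegral.integral_add (by simp) (by apply Continuous.intervalIntegrable; fun_prop),
    intervalIntegral.integral_mul_const, intervalIntegral.integral_sub (by simp) (by simp)]
  simp only [intervalIntegral.integral_const, integral_id, smul_eq_mul]
  field_simp
  ring

/-- A closed polygon that winds nowhere positively has nonpositive signed area. -/
theorem sum_complexCross_nonpos (h : ∀ x ∉ polygonTrace z, totalAngle z x ≤ 0) :
    ∑ j, complexCross (z j) (z (j + 1)) ≤ 0 := by
  set T : ℝ := ∑ j, |(z j).im|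
  have hT : ∀ j, |(z j).im| ≤ T := fun j =>
    Finset.single_le_sum (f := fun j => |(z j).im|) (fun i _ => abs_nonneg _) (Finset.mem_univ j)
  have hc : ∀ j, Continuous (lineRe (z j) (z (j + 1))) := fun j => by
    unfold lineRe
    fun_prop
  have hI := fun i j => integral_mul_ite_le (hc j) (abs_le.1 (hT i)).1 (abs_le.1 (hT i)).2
  have hint : ∫ t in -T..T, ∑ j, heightCrossing (z j) (z (j + 1)) t *
      lineRe (z j) (z (j + 1)) t = (∑ j, complexCross (z j) (z (j + 1))) / 2 := by
    simp only [heightCrossing, sub_mul]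
    rw [intervalIntegral.integral_finsetSum fun j _ => (hI (j + 1) j).1.sub (hI j j).1]
    have h1 : ∀ j, ∫ t in -T..T, ((if t ≤ (z (j + 1)).im then 1 else 0) *
        lineRe (z j) (z (j + 1)) t - (if t ≤ (z j).im then 1 else 0) *
        lineRe (z j) (z (j + 1)) t) = complexCross (z j) (z (j + 1)) / 2 +
          ((z (j + 1)).re * (z (j + 1)).im / 2 - (z j).re * (z j).im / 2) := by
      intro j
      rw [intervalIntegral.integral_sub (hI (j + 1) j).1 (hI j j).1, (hI (j + 1) j).2, (hI j j).2,
        intervalIntegral.integral_interval_sub_left ((hc j).intervalIntegrable _ _)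
          ((hc j).intervalIntegrable _ _), integral_lineRe, complexCross]
      ring
    rw [Finset.sum_congr rfl fun j _ => h1 j, Finset.sum_add_distrib, Finset.sum_sub_distrib,
      sum_zmod_add_one fun j => (z j).re * (z j).im / 2, sub_self, add_zero, Finset.sum_div]
  have hle : 0 ≤ -∫ t in -T..T, ∑ j, heightCrossing (z j) (z (j + 1)) t *
      lineRe (z j) (z (j + 1)) t := by
    rw [← intervalIntegral.integral_neg]
    refine intervalIntegral.integral_nonneg_of_ae
      (neg_le_self (Finset.sum_nonneg fun i _ => abs_nonneg _)) ?_
    filter_upwards [(Set.finite_range fun j => (z j).im).countable.ae_notMem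
      MeasureTheory.volume] with t ht
    rw [Pi.zero_apply, neg_nonneg]
    exact sum_heightCrossing_mul_lineRe_nonpos h fun j hj => ht ⟨j, hj⟩
  linarith

namespace IsSimplePolygon

/-- For a simple polygon of positive signed area, the interior angle determined by the view from
each vertex is the supplement of the exterior angle. -/
theorem farAngle_add_arg (hz : IsSimplePolygon z)
    (hor : 0 < ∑ j, complexCross (z j) (z (j + 1))) (i : ZMod k) :
    farAngle z i + arg ((z (i + 2) - z (i + 1)) / (z (i + 1) - z i)) = Real.pi := by
  obtain ⟨L, hL | hL, hV, hW⟩ := hz.exists_left_totalAngle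
  · refine absurd (sum_complexCross_nonpos fun x hx => ?_) hor.not_ge
    rcases hW x hx with h | h <;> linarith [Real.pi_pos]
  · linarith [hV i]

end IsSimplePolygon

/-- A point around which a closed polygon has nonzero total angle lies in a bounded component of
the complement of the polygon. -/
theorem isBounded_connectedComponentIn_of_totalAngle_ne_zero {v : ZMod k → Fin 2 → ℝ}
    {x : Fin 2 → ℝ} (hx : x ∉ ⋃ i, segment ℝ (v i) (v (i + 1)))
    (h : totalAngle (fun i => planeEquivComplex (v i)) (planeEquivComplex x) ≠ 0) :
    Bornology.IsBounded (connectedComponentIn (⋃ i, segment ℝ (v i) (v (i + 1)))ᶜ x) := by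
  set C := ⋃ i, segment ℝ (v i) (v (i + 1)) with hC
  set K := connectedComponentIn Cᶜ x
  have hK : IsPreconnected (planeEquivComplex '' K) :=
    isPreconnected_connectedComponentIn.image _ planeEquivComplex.continuous.continuousOn
  have hd : Disjoint (planeEquivComplex '' K) (polygonTrace fun i => planeEquivComplex (v i)) := by
    rw [disjoint_left]
    rintro _ ⟨y, hy, rfl⟩ hy'
    exact connectedComponentIn_subset _ _ hy (planeEquivComplex_mem_polygonTrace.1 hy')
  have hb : Bornology.IsBounded (planeEquivComplex '' K) := by
    rw [Bornology.isBounded_def]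
    filter_upwards [eventually_totalAngle_eq_zero fun i => planeEquivComplex (v i)] with y hy hyK
    exact h ((totalAngle_eq_of_isPreconnected hK hd
      (mem_image_of_mem _ (mem_connectedComponentIn hx)) hyK).trans hy.2)
  have := planeEquivComplex.symm.lipschitz.isBounded_image hb
  rwa [← image_comp, ContinuousLinearEquiv.symm_comp_self, image_id] at this

end Polygon

end

/-- A positively oriented simple closed polygonal curve with at least four
vertices has a vertex `v (i+1)` with positive exterior angle (a convex
vertex); moreover, at such a vertex with neighbors `v i` and `v (i+2)`,
either the open segment `(v i, v (i+2))` lies entirely in the enclosed open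
region, or the curve meets the closed segment `[v i, v (i+2)]` in a point
other than its endpoints. -/
theorem exists_convex_vertex_with_diagonal_dichotomy
    (k : ℕ) [NeZero k] (hk : 4 ≤ k) (v : ZMod k → (Fin 2 → ℝ))
    (hinj : Function.Injective v)
    (C : Set (Fin 2 → ℝ))
    (hC : C = ⋃ i : ZMod k, segment ℝ (v i) (v (i + 1)))
    (hsimple : ∀ i j : ZMod k, i ≠ j → i ≠ j + 1 → j ≠ i + 1 →
      segment ℝ (v i) (v (i + 1)) ∩ segment ℝ (v j) (v (j + 1)) = ∅)
    (hadj : ∀ i : ZMod k,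
      segment ℝ (v i) (v (i + 1)) ∩ segment ℝ (v (i + 1)) (v (i + 2)) = {v (i + 1)})
    -- positive orientation: positive signed area
    (hor : 0 < ∑ i : ZMod k, cross2 (v i) (v (i + 1))) :
    ∃ i : ZMod k,
      0 < cross2 (v (i + 1) - v i) (v (i + 2) - v (i + 1)) ∧
      (openSegment ℝ (v i) (v (i + 2)) ⊆
          {x | x ∉ C ∧ Bornology.IsBounded (connectedComponentIn Cᶜ x)} ∨
        ∃ p ∈ C, p ∈ segment ℝ (v i) (v (i + 2)) ∧ p ≠ v i ∧ p ≠ v (i + 2)) := by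
  subst hC
  have hz : IsSimplePolygon fun i => planeEquivComplex (v i) := by
    refine ⟨hk, planeEquivComplex.injective.comp hinj, fun i j h1 h2 h3 => ?_, fun i => ?_⟩
    · rw [← Set.disjoint_iff_inter_eq_empty, Set.disjoint_left]
      intro x
      obtain ⟨x, rfl⟩ := planeEquivComplex.surjective x
      simp only [planeEquivComplex_mem_segment]
      exact fun ha hb => (Set.ext_iff.1 (hsimple i j h1 h2 h3) x).1 ⟨ha, hb⟩
    · ext x
      obtain ⟨x, rfl⟩ := planeEquivComplex.surjective x
      simp only [Set.mem_inter_iff, planeEquivComplex_mem_segment, Set.mem_singleton_iff,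
        EmbeddingLike.apply_eq_iff_eq]
      exact Set.ext_iff.1 (hadj i) x
  simp only [cross2_eq_complexCross] at hor
  obtain ⟨i, hi, hd⟩ := hz.exists_diagonal_dichotomy (hz.farAngle_add_arg hor)
  refine ⟨i, by simpa only [cross2_eq_complexCross, map_sub] using hi, hd.imp ?_ ?_⟩
  · intro h x hx
    obtain ⟨hxt, hx0⟩ := h _ (planeEquivComplex_mem_openSegment.2 hx)
    rw [planeEquivComplex_mem_polygonTrace] at hxt
    exact ⟨hxt, isBounded_connectedComponentIn_of_totalAngle_ne_zero hxt hx0⟩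
  · rintro ⟨p, hp⟩
    obtain ⟨p, rfl⟩ := planeEquivComplex.surjective p
    simp only [planeEquivComplex_mem_polygonTrace, planeEquivComplex_mem_segment, ne_eq,
      EmbeddingLike.apply_eq_iff_eq] at hp
    exact ⟨p, hp⟩
end
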